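/- Let q be an odd prime power and let L = PSL(4, F_q) be the quotient of SL(4, F_q) by its center. Then L is recognizable by spectrum among covers: for every finite group H having a normal subgroup K with H/K isomorphic to L, if ω(H) = ω(L) then H is isomorphic to L. -/

import Mathlib

open Matrix

/-- The spectrum of a group: the set of orders of its elements. -/
def elementOrders (G : Type*) [Monoid G] : Set ℕ := Set.range (orderOf : G → ℕ)

lemma red_dvd {G : Type*} [Group G] [Finite G] {a b : ℕ} (h : a ∈ elementOrders G) (hb : b ∣ a) :
    b ∈ elementOrders G := by
  obtain ⟨g, rfl⟩ := h
  obtain ⟨k, hk⟩ := hb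
  have h0 : 0 < orderOf g := orderOf_pos g
  refine ⟨g ^ k, ?_⟩
  have hk0 : k ≠ 0 := by rintro rfl; rw [mul_zero] at hk; omega
  rw [orderOf_pow_of_dvd hk0 ⟨b, by rw [hk, mul_comm]⟩, hk]
  exact Nat.mul_div_cancel _ (Nat.pos_of_ne_zero hk0)

theorem red_main (L : Type) [Group L] [Finite L]
    (hmod : ∀ (r : ℕ) [Fact r.Prime] (V : Type) [AddCommGroup V] [Finite V] [Nontrivial V]
      (ρ : L →* AddMonoid.End V), (∀ v : V, r • v = 0) →
      (∀ l : L, r * orderOf l ∉ elementOrders L →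
        ∀ v : V, ∑ i ∈ Finset.range (orderOf l), ρ (l ^ i) v = 0) → False) :
    ∀ (n : ℕ) (H : Type) [Group H] [Finite H], Nat.card H = n → ∀ π : H →* L,
      Function.Surjective π → elementOrders H ⊆ elementOrders L → π.ker = ⊥ := by
  intro n
  induction n using Nat.strong_induction_on with
  | _ n ih =>
  intro H _ _ hn π hπ hω
  by_contra hK
  have A : ∀ M : Subgroup H, M.Normal → M ≤ π.ker → M ≠ ⊥ → π.ker ≤ M := by
    intro M hM hMK hM1
    have hc : Nat.card (H ⧸ M) < n := by
      have h1 := M.card_eq_card_quotient_mul_card_subgroup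
      have h2 : 1 < Nat.card M := by
        rw [Subgroup.one_lt_card_iff_ne_bot]; exact hM1
      have h3 : 0 < Nat.card (H ⧸ M) := Nat.card_pos
      rw [← hn, h1]; nlinarith
    have := ih _ hc (H ⧸ M) rfl (QuotientGroup.lift M π hMK) (by
      intro l; obtain ⟨h, rfl⟩ := hπ l; exact ⟨(h : H ⧸ M), rfl⟩) (by
      rintro _ ⟨x, rfl⟩
      obtain ⟨h, rfl⟩ := QuotientGroup.mk_surjective x
      exact hω (red_dvd ⟨h, rfl⟩ (orderOf_map_dvd (QuotientGroup.mk' M) h)))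
    intro k hk
    have h1 : ((k : H) : H ⧸ M) ∈ (QuotientGroup.lift M π hMK).ker := by
      rw [MonoidHom.mem_ker]; exact hk
    rw [this, Subgroup.mem_bot] at h1
    exact (QuotientGroup.eq_one_iff k).1 h1
  have B : ∀ N : Subgroup H, N ⊔ π.ker = ⊤ → N ≠ ⊤ → ∀ x ∈ N, x ∈ π.ker → x = 1 := by
    intro N hNK hN x hx hxk
    have hc : Nat.card N < n := by
      rw [← hn]
      refine lt_of_le_of_ne (Subgroup.card_le_card_group N) ?_
      intro h; exact hN (Subgroup.eq_top_of_card_eq N h)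
    have := ih _ hc N rfl (π.comp N.subtype) (by
      intro l; obtain ⟨h, rfl⟩ := hπ l
      have : h ∈ N ⊔ π.ker := by rw [hNK]; trivial
      obtain ⟨y, hy, z, hz, rfl⟩ := (Subgroup.mem_sup_of_normal_right).1 this
      refine ⟨⟨y, hy⟩, ?_⟩
      have hz' : π z = 1 := hz
      simp [hz']) (by
      rintro _ ⟨x, rfl⟩
      exact hω ⟨(x : H), Subgroup.orderOf_coe x⟩)
    have h1 : (⟨x, hx⟩ : N) ∈ (π.comp N.subtype).ker := hxk
    rw [this, Subgroup.mem_bot] at h1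
    simpa using congrArg Subtype.val h1
  have hc1 : Nat.card π.ker ≠ 1 := by
    rw [Ne, Subgroup.card_eq_one]; exact hK
  obtain ⟨r, hr, hrd⟩ := Nat.exists_prime_and_dvd hc1
  have : Fact r.Prime := ⟨hr⟩
  let P : Sylow r π.ker := default
  have hP1 : (P : Subgroup π.ker) ≠ ⊥ := P.ne_bot_of_dvd_card hrd
  have hPm : Subgroup.map π.ker.subtype P ≠ ⊥ := by
    rw [Ne, Subgroup.map_eq_bot_iff_of_injective _ (Subgroup.subtype_injective _)]; exact hP1
  have hPle : Subgroup.map π.ker.subtype P ≤ π.ker := Subgroup.map_subtype_le _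
  have hfr := Sylow.normalizer_sup_eq_top P
  have hnorm : Subgroup.normalizer (Subgroup.map π.ker.subtype P : Set H) = ⊤ := by
    by_contra hne
    apply hPm
    rw [Subgroup.eq_bot_iff_forall]
    intro x hx
    exact B _ hfr hne x (Subgroup.le_normalizer hx) (hPle hx)
  have hPn : (Subgroup.map π.ker.subtype (P : Subgroup π.ker)).Normal :=
    Subgroup.normalizer_eq_top_iff.1 hnorm
  have hPK := A _ hPn hPle hPm
  have hPtop : (P : Subgroup π.ker) = ⊤ := by
    rw [eq_top_iff]
    intro x _
    obtain ⟨y, hy, hyx⟩ := hPK x.2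
    have : y = x := Subtype.ext hyx
    exact this ▸ hy
  have hpg : IsPGroup r π.ker := by
    have := P.2
    have h2 : IsPGroup r (⊤ : Subgroup π.ker) := hPtop ▸ P.isPGroup'
    exact h2.of_equiv Subgroup.topEquiv
  have hnt : Nontrivial π.ker := (Subgroup.nontrivial_iff_ne_bot _).2 hK
  have hcen : Nontrivial (Subgroup.center π.ker) := hpg.center_nontrivial
  have hZ : (Subgroup.map π.ker.subtype (Subgroup.center π.ker)).Normal := inferInstance
  have hZ2 := A _ hZ (Subgroup.map_subtype_le _) (by
    rw [Ne, Subgroup.map_eq_bot_iff_of_injective _ (Subgroup.subtype_injective _)]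
    exact (Subgroup.nontrivial_iff_ne_bot _).1 hcen)
  have hcomm : ∀ a ∈ π.ker, ∀ b ∈ π.ker, a * b = b * a := by
    intro a ha b hb
    obtain ⟨y, hy, rfl⟩ := hZ2 ha
    have := (Subgroup.mem_center_iff.1 hy) ⟨b, hb⟩
    simpa using (congrArg Subtype.val this).symm
  let T : Subgroup H :=
    { carrier := {x | x ∈ π.ker ∧ x ^ r = 1}
      one_mem' := ⟨one_mem _, one_pow _⟩
      mul_mem' := by
        rintro a b ⟨ha, ha'⟩ ⟨hb, hb'⟩
        refine ⟨mul_mem ha hb, ?_⟩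
        rw [Commute.mul_pow (hcomm a ha b hb), ha', hb', one_mul]
      inv_mem' := by
        rintro a ⟨ha, ha'⟩
        exact ⟨inv_mem ha, by rw [inv_pow, ha', inv_one]⟩ }
  have hT := A T ⟨by
    rintro x ⟨hx, hx'⟩ g
    refine ⟨(inferInstance : π.ker.Normal).conj_mem x hx g, ?_⟩
    rw [conj_pow, hx', mul_one, mul_inv_cancel]⟩ (fun x hx => hx.1) (by
    have := Fintype.ofFinite π.ker
    obtain ⟨x, hx⟩ := exists_prime_orderOf_dvd_card (G := π.ker) r (by rwa [← Nat.card_eq_fintype_card])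
    intro hbot
    have h1 : (x : H) ∈ T := ⟨x.2, by
      have := pow_orderOf_eq_one x
      rw [hx] at this
      simpa using congrArg Subtype.val this⟩
    rw [hbot, Subgroup.mem_bot] at h1
    have : x = 1 := Subtype.ext h1
    rw [this, orderOf_one] at hx
    exact hr.one_lt.ne hx)
  have htor : ∀ a ∈ π.ker, a ^ r = 1 := fun a ha => (hT ha).2
  clear hT T hZ2 hZ hcen hpg hPtop hPK hPn hnorm hfr hPle hPm hP1 P B A ih
  let _ : CommGroup π.ker := { (inferInstance : Group π.ker) with
    mul_comm := fun a b => Subtype.ext (hcomm a a.2 b b.2) }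
  obtain ⟨s, hs⟩ := hπ.hasRightInverse
  have hcj : ∀ (h : H) (x : π.ker), h * x * h⁻¹ ∈ π.ker :=
    fun h x => (inferInstance : π.ker.Normal).conj_mem x x.2 h
  have hcj2 : ∀ (h h' : H) (x : π.ker), π h = π h' → h * x * h⁻¹ = h' * x * h'⁻¹ := by
    intro h h' x hh
    have h1 : h'⁻¹ * h ∈ π.ker := by rw [MonoidHom.mem_ker]; simp [hh]
    have h2 := hcomm _ h1 x x.2
    calc h * x * h⁻¹ = h' * (h'⁻¹ * h * x) * h⁻¹ := by group
      _ = h' * x * h'⁻¹ := by rw [h2]; group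
  let ρ : L →* AddMonoid.End (Additive π.ker) :=
    { toFun := fun l => AddMonoidHom.mk' (fun v => Additive.ofMul (⟨s l * (Additive.toMul v : π.ker) * (s l)⁻¹, hcj _ _⟩ : π.ker)) (by
        intro a b
        rw [← ofMul_mul]
        congr 1
        apply Subtype.ext
        simp)
      map_one' := by
        ext v
        change s 1 * (Additive.toMul v : π.ker) * (s 1)⁻¹ = (Additive.toMul v : π.ker)
        rw [hcj2 (s 1) 1 _ (by rw [hs, map_one])]; simp
      map_mul' := by
        intro a b
        ext v
        change s (a * b) * (Additive.toMul v : π.ker) * (s (a * b))⁻¹ = s a * (s b * (Additive.toMul v : π.ker) * (s b)⁻¹) * (s a)⁻¹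
        rw [hcj2 (s (a * b)) (s a * s b) _ (by rw [hs, map_mul, hs, hs])]; group }
  have hρ : ∀ (h : H) (v : Additive π.ker), ((Additive.toMul (ρ (π h) v) : π.ker) : H) = h * (Additive.toMul v : π.ker) * h⁻¹ := by
    intro h v
    change s (π h) * (Additive.toMul v : π.ker) * (s (π h))⁻¹ = _
    exact hcj2 _ _ _ (hs _)
  refine hmod r (Additive π.ker) ρ ?_ ?_
  · intro v
    apply Additive.toMul.injective
    apply Subtype.ext
    simpa using htor _ (Additive.toMul v : π.ker).2
  · intro l hl v
    have key : ∀ h : H, π h = l → h ^ orderOf l = 1 := by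
      intro h hh
      by_contra hne
      apply hl
      have h1 : orderOf l ∣ orderOf h := hh ▸ orderOf_map_dvd π h
      have h2 : h ^ (orderOf l * r) = 1 := by
        rw [pow_mul]; apply htor; rw [MonoidHom.mem_ker, map_pow, hh, pow_orderOf_eq_one]
      obtain ⟨k, hk⟩ := h1
      have h3 := orderOf_dvd_of_pow_eq_one h2
      rw [hk] at h3
      have h4 : k ∣ r := Nat.dvd_of_mul_dvd_mul_left (orderOf_pos l) h3
      rcases (Nat.dvd_prime hr).1 h4 with h5 | h5
      · rw [h5, mul_one] at hk; exact absurd (hk ▸ pow_orderOf_eq_one h) hne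
      · apply hω; exact ⟨h, by rw [hk, h5, mul_comm]⟩
    obtain ⟨h, rfl⟩ := hπ l
    set n := orderOf (π h) with hn'
    have gen : ∀ m : ℕ, ((Additive.toMul v : π.ker) * h) ^ m = ((Additive.toMul (∑ i ∈ Finset.range m, ρ (π h ^ i) v) : π.ker) : H) * h ^ m := by
      intro m
      induction m with
      | zero => simp
      | succ m ihm =>
        rw [pow_succ, ihm, Finset.sum_range_succ, toMul_add, Subgroup.coe_mul, ← map_pow π h m, hρ (h ^ m) v, pow_succ]
        group
    have h1 := gen n
    rw [key h rfl, key _ (by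
      have : π ((Additive.toMul v : π.ker) : H) = 1 := (Additive.toMul v : π.ker).2
      rw [map_mul, this, one_mul]), mul_one] at h1
    apply Additive.toMul.injective
    apply Subtype.ext
    exact h1.symm

abbrev S4 (F : Type) [Field F] := SpecialLinearGroup (Fin 4) F
abbrev S2 (F : Type) [Field F] := SpecialLinearGroup (Fin 2) F

lemma mul4 {F : Type} [Field F] (a b c d e f g h i j k l m n o p a' b' c' d' e' f' g' h' i' j' k' l' m' n' o' p' : F) :
  !![a,b,c,d;e,f,g,h;i,j,k,l;m,n,o,p] * !![a',b',c',d';e',f',g',h';i',j',k',l';m',n',o',p'] =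
  !![a*a'+b*e'+c*i'+d*m', a*b'+b*f'+c*j'+d*n', a*c'+b*g'+c*k'+d*o', a*d'+b*h'+c*l'+d*p';
     e*a'+f*e'+g*i'+h*m', e*b'+f*f'+g*j'+h*n', e*c'+f*g'+g*k'+h*o', e*d'+f*h'+g*l'+h*p';
     i*a'+j*e'+k*i'+l*m', i*b'+j*f'+k*j'+l*n', i*c'+j*g'+k*k'+l*o', i*d'+j*h'+k*l'+l*p';
     m*a'+n*e'+o*i'+p*m', m*b'+n*f'+o*j'+p*n', m*c'+n*g'+o*k'+p*o', m*d'+n*h'+o*l'+p*p'] := by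
  ext x y
  fin_cases x <;> fin_cases y <;> exact (Matrix.mul_apply).trans (Fin.sum_univ_four _)
lemma fin3 (i : Fin 3) : i = 0 ∨ i = 1 ∨ i = 2 := by fin_cases i <;> simp
lemma ext4 {F : Type} [Field F] {a b c d e f g h i j k l m n o p a' b' c' d' e' f' g' h' i' j' k' l' m' n' o' p' : F}
  (h1 : a = a') (h2 : b = b') (h3 : c = c') (h4 : d = d') (h5 : e = e') (h6 : f = f') (h7 : g = g') (h8 : h = h')
  (h9 : i = i') (h10 : j = j') (h11 : k = k') (h12 : l = l') (h13 : m = m') (h14 : n = n') (h15 : o = o') (h16 : p = p') :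
  !![a,b,c,d;e,f,g,h;i,j,k,l;m,n,o,p] = !![a',b',c',d';e',f',g',h';i',j',k',l';m',n',o',p'] := by
  subst_vars; rfl

set_option linter.unusedSimpArgs false
set_option linter.unusedSectionVars false
section defs
variable {F : Type} [Field F]

def mx {n : ℕ} (g : SpecialLinearGroup (Fin n) F) : Matrix (Fin n) (Fin n) F := g.1
def mkS {n : ℕ} (A : Matrix (Fin n) (Fin n) F) (h : A.det = 1) : SpecialLinearGroup (Fin n) F := ⟨A, h⟩
@[simp] lemma mx_mkS {n : ℕ} (A : Matrix (Fin n) (Fin n) F) (h : A.det = 1) : mx (mkS A h) = A := rfl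
lemma mx_inj {n : ℕ} {g h : SpecialLinearGroup (Fin n) F} (e : mx g = mx h) : g = h := Subtype.ext e
@[simp] lemma mx_mul {n : ℕ} (g h : SpecialLinearGroup (Fin n) F) : mx (g * h) = mx g * mx h := rfl
@[simp] lemma mx_one {n : ℕ} : mx (1 : SpecialLinearGroup (Fin n) F) = 1 := rfl
@[simp] lemma mx_pow {n : ℕ} (g : SpecialLinearGroup (Fin n) F) (k : ℕ) : mx (g ^ k) = mx g ^ k := by
  induction k with
  | zero => rw [pow_zero, pow_zero, mx_one]
  | succ k ih => rw [pow_succ, pow_succ, mx_mul, ih]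
lemma mx_det {n : ℕ} (g : SpecialLinearGroup (Fin n) F) : (mx g).det = 1 := g.2

def emb4 (i : Fin 3) (m : Matrix (Fin 2) (Fin 2) F) : Matrix (Fin 4) (Fin 4) F :=
  match i with
  | 0 => !![m 0 0, m 0 1, 0, 0; m 1 0, m 1 1, 0, 0; 0, 0, 1, 0; 0, 0, 0, 1]
  | 1 => !![1, 0, 0, 0; 0, m 0 0, m 0 1, 0; 0, m 1 0, m 1 1, 0; 0, 0, 0, 1]
  | 2 => !![1, 0, 0, 0; 0, 1, 0, 0; 0, 0, m 0 0, m 0 1; 0, 0, m 1 0, m 1 1]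

lemma emb4_one (i : Fin 3) : emb4 i (1 : Matrix (Fin 2) (Fin 2) F) = 1 := by
  fin_cases i <;> ext a b <;> fin_cases a <;> fin_cases b <;> simp [emb4, Matrix.one_apply]

lemma emb4_mul (i : Fin 3) (m n : Matrix (Fin 2) (Fin 2) F) : emb4 i (m * n) = emb4 i m * emb4 i n := by
  rcases fin3 i with rfl | rfl | rfl <;> simp only [emb4, mul4] <;> apply ext4 <;>
    simp [Matrix.mul_apply, Fin.sum_univ_two]

lemma emb4_det (i : Fin 3) (m : Matrix (Fin 2) (Fin 2) F) : (emb4 i m).det = m.det := by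
  rw [Matrix.det_fin_two]
  fin_cases i <;> simp [emb4, Matrix.det_succ_row_zero, Fin.sum_univ_succ, show Fin.succAbove (1 : Fin 4) (2 : Fin 3) = 3 from rfl] <;> ring

def iota (i : Fin 3) : S2 F →* S4 F where
  toFun m := mkS (emb4 i (mx m)) (by rw [emb4_det, mx_det])
  map_one' := mx_inj (emb4_one i)
  map_mul' m n := mx_inj (emb4_mul i (mx m) (mx n))

lemma iota_coe (i : Fin 3) (m : S2 F) : mx (iota i m) = emb4 i (mx m) := rfl

def su (y : F) : S2 F := mkS !![1, y; 0, 1] (by simp [Matrix.det_fin_two])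
def sl (y : F) : S2 F := mkS !![1, 0; y, 1] (by simp [Matrix.det_fin_two])
def sw : S2 F := mkS !![0, 1; -1, 0] (by simp [Matrix.det_fin_two])
def sh (c : Fˣ) : S2 F := mkS !![(c : F), 0; 0, ((c⁻¹ : Fˣ) : F)] (by simp [Matrix.det_fin_two])

lemma su_add (y z : F) : su (y + z) = su y * su z := by
  apply mx_inj; ext a b; fin_cases a <;> fin_cases b <;>
    simp [su, Matrix.mul_apply, Fin.sum_univ_two, add_comm]

lemma sh_mul (c d : Fˣ) : (sh (c * d) : S2 F) = sh c * sh d := by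
  apply mx_inj; ext a b; fin_cases a <;> fin_cases b <;>
    simp [sh, Matrix.mul_apply, Fin.sum_univ_two, mul_comm]

lemma sw_rel (z : Fˣ) : (sw * su (z : F) * sw : S2 F) =
    su (-((z⁻¹ : Fˣ) : F)) * sw * sh (-z) * su (-((z⁻¹ : Fˣ) : F)) := by
  apply mx_inj; ext a b; fin_cases a <;> fin_cases b <;>
    simp [su, sw, sh, Matrix.mul_apply, Fin.sum_univ_two]

lemma sw_sq : (sw * sw : S2 F) = sh (-1) := by
  apply mx_inj; ext a b; fin_cases a <;> fin_cases b <;>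
    simp [sw, sh, Matrix.mul_apply, Fin.sum_univ_two]

lemma sw_inv : (sw⁻¹ : S2 F) = sw * sh (-1) := by
  rw [inv_eq_iff_mul_eq_one, ← mul_assoc, sw_sq, ← sh_mul]
  apply mx_inj; ext a b; fin_cases a <;> fin_cases b <;> simp [sh]

lemma sw_conj (y : F) : (sw⁻¹ * su y * sw : S2 F) = sl (-y) := by
  rw [sw_inv]
  apply mx_inj; ext a b; fin_cases a <;> fin_cases b <;>
    simp [su, sw, sl, sh, Matrix.mul_apply, Fin.sum_univ_two]

def IsU (g : S4 F) : Prop := (∀ i j, j < i → mx g i j = 0) ∧ ∀ i, mx g i i = 1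
def IsL (g : S4 F) : Prop := ∀ i j, i < j → mx g i j = 0
def IsD (g : S4 F) : Prop := ∀ i j, i ≠ j → mx g i j = 0

lemma IsU.mul {g h : S4 F} (hg : IsU g) (hh : IsU h) : IsU (g * h) := by
  constructor
  · intro i j hij
    rw [mx_mul, Matrix.mul_apply]
    apply Finset.sum_eq_zero
    intro k _
    rcases lt_or_ge k i with h1 | h1
    · rw [hg.1 i k h1, zero_mul]
    · rw [hh.1 k j (lt_of_lt_of_le hij h1), mul_zero]
  · intro i
    rw [mx_mul, Matrix.mul_apply, Finset.sum_eq_single i]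
    · rw [hg.2, hh.2, mul_one]
    · intro k _ hk
      rcases lt_or_gt_of_ne hk with h1 | h1
      · rw [hg.1 i k h1, zero_mul]
      · rw [hh.1 k i h1, mul_zero]
    · simp

lemma IsL.mul {g h : S4 F} (hg : IsL g) (hh : IsL h) : IsL (g * h) := by
  intro i j hij
  rw [mx_mul, Matrix.mul_apply]
  apply Finset.sum_eq_zero
  intro k _
  rcases lt_or_ge i k with h1 | h1
  · rw [hg i k h1, zero_mul]
  · rw [hh k j (lt_of_le_of_lt h1 hij), mul_zero]

def trS (g : S4 F) : S4 F := mkS (mx g)ᵀ (by rw [Matrix.det_transpose, mx_det])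
lemma trS_mul (g h : S4 F) : trS (g * h) = trS h * trS g := by
  apply mx_inj; exact Matrix.transpose_mul _ _

def subOfMon {G : Type*} [Group G] [Finite G] (S : Submonoid G) : Subgroup G :=
  { S with
    inv_mem' := by
      intro x hx
      have h0 := orderOf_pos x
      have : x⁻¹ = x ^ (orderOf x - 1) := by
        rw [inv_eq_iff_mul_eq_one, ← pow_succ', Nat.sub_add_cancel h0, pow_orderOf_eq_one]
      change x⁻¹ ∈ S
      rw [this]
      exact S.pow_mem hx _ }

lemma mem_subOfMon {G : Type*} [Group G] [Finite G] (S : Submonoid G) (x : G) :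
    x ∈ subOfMon S ↔ x ∈ S := Iff.rfl

lemma isU_one : IsU (1 : S4 F) := by
  constructor
  · intro i j h; exact Matrix.one_apply_ne (ne_of_gt h)
  · intro i; exact Matrix.one_apply_eq i

def Usub (F : Type) [Field F] [Fintype F] : Subgroup (S4 F) :=
  subOfMon { carrier := {g | IsU g}, one_mem' := isU_one, mul_mem' := IsU.mul }

def Lsub (F : Type) [Field F] [Fintype F] : Subgroup (S4 F) :=
  subOfMon { carrier := {g | IsU (trS g)}, one_mem' := by
               have : trS (1 : S4 F) = 1 := mx_inj Matrix.transpose_one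
               change IsU (trS 1)
               rw [this]; exact isU_one
             mul_mem' := by
               intro a b ha hb
               change IsU (trS (a * b))
               rw [trS_mul]; exact IsU.mul hb ha }

lemma isU_pow4 {g : S4 F} (hg : IsU g) : (mx g - 1) ^ 4 = 0 := by
  obtain ⟨h1, h2⟩ := hg
  have e : mx g - 1 = !![0, mx g 0 1, mx g 0 2, mx g 0 3; 0, 0, mx g 1 2, mx g 1 3; 0, 0, 0, mx g 2 3; 0, 0, 0, 0] := by
    ext a b
    fin_cases a <;> fin_cases b <;> simp [h2, h1]
  have e2 : (mx g - 1) ^ 2 = !![0, 0, mx g 0 1 * mx g 1 2, mx g 0 1 * mx g 1 3 + mx g 0 2 * mx g 2 3; 0, 0, 0, mx g 1 2 * mx g 2 3; 0, 0, 0, 0; 0, 0, 0, 0] := by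
    rw [e, pow_two, mul4]
    apply ext4 <;> simp
  have e3 : (mx g - 1) ^ 4 = (mx g - 1) ^ 2 * (mx g - 1) ^ 2 := by rw [← pow_add]
  rw [e3, e2, mul4]
  ext a b
  fin_cases a <;> fin_cases b <;> simp

lemma isU_ppow {g : S4 F} (hg : IsU g) (p : ℕ) [Fact p.Prime] [CharP F p] : g ^ (p ^ 2) = 1 := by
  have h4 : 4 ≤ p ^ 2 := by
    have := (Fact.out : p.Prime).two_le
    nlinarith
  have h : (mx g - 1) ^ (p ^ 2) = 0 := by
    rw [← Nat.sub_add_cancel h4, pow_add, isU_pow4 hg, mul_zero]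
  rw [sub_pow_char_pow_of_commute _ _ (Commute.one_right _), one_pow, sub_eq_zero] at h
  apply mx_inj
  rw [mx_pow, h, mx_one]

lemma usub_pgroup [Fintype F] (p : ℕ) [Fact p.Prime] [CharP F p] : IsPGroup p (Usub F) := by
  rintro ⟨g, hg⟩
  exact ⟨2, Subtype.ext (isU_ppow hg p)⟩

lemma lsub_pgroup [Fintype F] (p : ℕ) [Fact p.Prime] [CharP F p] : IsPGroup p (Lsub F) := by
  rintro ⟨g, hg⟩
  refine ⟨2, Subtype.ext ?_⟩
  have h := isU_ppow (g := trS g) hg p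
  have h2 : ∀ n, trS (g ^ n) = trS g ^ n := by
    intro n
    apply mx_inj
    simp [trS, Matrix.transpose_pow]
  rw [← h2] at h
  have h3 := congrArg trS h
  have h4 : ∀ x : S4 F, trS (trS x) = x := fun x => mx_inj (Matrix.transpose_transpose _)
  rw [h4] at h3
  change g ^ p ^ 2 = 1
  rw [h3]
  exact mx_inj Matrix.transpose_one

lemma fixpt [Fintype F] (p : ℕ) [Fact p.Prime] [CharP F p] {A : Type} [Group A] (hA : IsPGroup p A)
    (act : A → S4 F → S4 F) (act_one : ∀ x, act 1 x = x)
    (act_mul : ∀ a b x, act b (act a x) = act (a * b) x)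
    (W : Submodule F (S4 F → F)) (hW : ∀ a, ∀ f ∈ W, (fun x => f (act a x)) ∈ W) (hne : W ≠ ⊥) :
    ∃ f ∈ W, f ≠ 0 ∧ ∀ a x, f (act a x) = f x := by
  let _ : MulAction A W :=
    { smul := fun a f => ⟨fun x => f.1 (act a x), hW a f.1 f.2⟩
      one_smul := fun f => Subtype.ext (funext fun x => congrArg f.1 (act_one x))
      mul_smul := fun a b f => Subtype.ext (funext fun x => (congrArg f.1 (act_mul a b x)).symm) }
  have hs : ∀ (a : A) (f : W) x, (a • f).1 x = f.1 (act a x) := fun _ _ _ => rfl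
  have : Finite W := inferInstance
  have hc : p ∣ Nat.card W := by
    have : Nontrivial W := (Submodule.nontrivial_iff_ne_bot).2 hne
    obtain ⟨f, hf⟩ := exists_ne (0 : W)
    have h1 : addOrderOf f = p := by
      apply addOrderOf_eq_prime
      · apply Subtype.ext; ext x
        simp
      · exact hf
    rw [← h1]; exact addOrderOf_dvd_natCard f
  obtain ⟨b, hb, hb0⟩ := hA.exists_fixed_point_of_prime_dvd_card_of_fixed_point W hc (a := 0) (by
    intro a; apply Subtype.ext; funext x; rfl)
  refine ⟨b.1, b.2, fun h => hb0 (Subtype.ext h.symm), fun a x => ?_⟩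
  have := hb a
  rw [← hs a b x, this]

end defs

set_option linter.unusedSimpArgs false
set_option linter.unusedSectionVars false
section heck
variable {F : Type} [Field F] [Fintype F]

def aw (i : Fin 3) (y : F) : S4 F := iota i (su y * sw)
def swi (z : F) : S2 F := mkS !![0, -1; 1, -z] (by simp [Matrix.det_fin_two])
def rT (i : Fin 3) (f : S4 F → F) : S4 F → F := fun x => ∑ y : F, f (x * aw i y)

def IsWt (f : S4 F → F) : Prop := (∀ u, IsU u → ∀ x, f (x * u) = f x) ∧
  ∀ t, IsD t → ∃ c, ∀ x, f (x * t) = c * f x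

lemma mx_aw (i : Fin 3) (y : F) : mx (aw i y) = emb4 i !![-y, 1; -1, 0] := by
  rw [aw, iota_coe]
  congr 1
  ext a b; fin_cases a <;> fin_cases b <;> simp [su, sw, Matrix.mul_apply, Fin.sum_univ_two]

lemma aw_swi (i : Fin 3) (z : F) : aw i z * iota i (swi z) = 1 := by
  rw [aw, ← map_mul, ← map_one (iota i)]
  congr 1
  apply mx_inj; ext a b; fin_cases a <;> fin_cases b <;>
    simp [su, sw, swi, Matrix.mul_apply, Fin.sum_univ_two, Matrix.one_apply]

lemma mx_U {u : S4 F} (h : IsU u) : mx u = !![1, mx u 0 1, mx u 0 2, mx u 0 3; 0, 1, mx u 1 2, mx u 1 3; 0, 0, 1, mx u 2 3; 0, 0, 0, 1] := by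
  ext a b
  fin_cases a <;> fin_cases b <;> simp [h.2, h.1]

lemma isU_of {u : S4 F} {a b c d e f : F} (h : mx u = !![1, a, b, c; 0, 1, d, e; 0, 0, 1, f; 0, 0, 0, 1]) : IsU u := by
  constructor
  · intro i j
    rw [h]
    fin_cases i <;> fin_cases j <;> simp
  · intro i
    rw [h]
    fin_cases i <;> simp

lemma mx_D {t : S4 F} (h : IsD t) : mx t = !![mx t 0 0, 0, 0, 0; 0, mx t 1 1, 0, 0; 0, 0, mx t 2 2, 0; 0, 0, 0, mx t 3 3] := by
  ext a b
  fin_cases a <;> fin_cases b <;> first | rfl | exact h _ _ (by decide)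

lemma isD_of {t : S4 F} {a b c d : F} (h : mx t = !![a, 0, 0, 0; 0, b, 0, 0; 0, 0, c, 0; 0, 0, 0, d]) : IsD t := by
  intro i j
  rw [h]
  fin_cases i <;> fin_cases j <;> simp

lemma isU_su (i : Fin 3) (y : F) : IsU (iota i (su y)) := by
  fin_cases i
  · exact isU_of (a := y) (b := 0) (c := 0) (d := 0) (e := 0) (f := 0) (by rw [iota_coe]; simp [emb4, su])
  · exact isU_of (a := 0) (b := 0) (c := 0) (d := y) (e := 0) (f := 0) (by rw [iota_coe]; simp [emb4, su])
  · exact isU_of (a := 0) (b := 0) (c := 0) (d := 0) (e := 0) (f := y) (by rw [iota_coe]; simp [emb4, su])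

lemma isD_sh (i : Fin 3) (c : Fˣ) : IsD (iota i (sh c)) := by
  intro a b
  rw [iota_coe]
  fin_cases i <;> fin_cases a <;> fin_cases b <;> simp [emb4, sh]

lemma IsU_conj {u : S4 F} (h : IsU u) (i : Fin 3) : ∃ a : F, ∀ y, IsU (iota i (swi (y + a)) * u * aw i y) := by
  have e := mx_U h
  have e2 : ∀ a y, mx (iota i (swi (y + a)) * u * aw i y) = emb4 i !![0, -1; 1, -(y + a)] * mx u * emb4 i !![-y, 1; -1, 0] := by
    intro a y
    rw [mx_mul, mx_mul, mx_aw, iota_coe]; rfl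
  generalize mx u 0 1 = u01, mx u 0 2 = u02, mx u 0 3 = u03, mx u 1 2 = u12, mx u 1 3 = u13, mx u 2 3 = u23 at e
  rw [e] at e2
  rcases fin3 i with rfl | rfl | rfl
  · refine ⟨u01, fun y => isU_of (a := 0) (b := -u12) (c := -u13) (d := u02 - (y + u01) * u12) (e := u03 - (y + u01) * u13) (f := u23) ((e2 _ _).trans ?_)⟩
    simp only [emb4, mul4]
    apply ext4 <;> simp <;> ring
  · refine ⟨u12, fun y => isU_of (a := -y * u01 - u02) (b := u01) (c := u03) (d := 0) (e := -u23) (f := u13 - (y + u12) * u23) ((e2 _ _).trans ?_)⟩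
    simp only [emb4, mul4]
    apply ext4 <;> simp <;> ring
  · refine ⟨u23, fun y => isU_of (a := u01) (b := -y * u02 - u03) (c := u02) (d := -y * u12 - u13) (e := u12) (f := 0) ((e2 _ _).trans ?_)⟩
    simp only [emb4, mul4]
    apply ext4 <;> simp <;> ring

lemma IsD_conj {t : S4 F} (h : IsD t) (i : Fin 3) : ∃ k : F, k ≠ 0 ∧ ∃ t', IsD t' ∧ ∀ y, t * aw i y = aw i (k * y) * t' := by
  have e := mx_D h
  have hd : (mx t).det = mx t 0 0 * mx t 1 1 * mx t 2 2 * mx t 3 3 := by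
    have : (mx t).BlockTriangular id := fun a b hab => h _ _ (ne_of_gt hab)
    rw [Matrix.det_of_isUpperTriangular this, Fin.prod_univ_four]
  rw [mx_det] at hd
  have n0 : mx t 0 0 ≠ 0 := by intro h0; simp [h0] at hd
  have n1 : mx t 1 1 ≠ 0 := by intro h0; simp [h0] at hd
  have n2 : mx t 2 2 ≠ 0 := by intro h0; simp [h0] at hd
  have n3 : mx t 3 3 ≠ 0 := by intro h0; simp [h0] at hd
  have key : ∀ y : F, mx (iota i (swi 0) * t * aw i 0) = emb4 i !![0, -1; 1, 0] * mx t * emb4 i !![0, 1; -1, 0] := by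
    intro y
    rw [mx_mul, mx_mul, mx_aw, iota_coe]; simp [swi]
  have key := key 0
  generalize mx t 0 0 = a0, mx t 1 1 = a1, mx t 2 2 = a2, mx t 3 3 = a3 at e n0 n1 n2 n3
  rw [e] at key
  rcases fin3 i with rfl | rfl | rfl
  · refine ⟨a0 / a1, div_ne_zero n0 n1, iota 0 (swi 0) * t * aw 0 0, ?_, fun y => ?_⟩
    · refine isD_of (a := a1) (b := a0) (c := a2) (d := a3) (key.trans ?_)
      simp only [emb4, mul4]
      apply ext4 <;> simp
    · apply mx_inj
      rw [mx_mul, mx_mul, mx_aw, mx_aw, key, e]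
      simp only [emb4, mul4]
      apply ext4 <;> simp <;> field_simp
  · refine ⟨a1 / a2, div_ne_zero n1 n2, iota 1 (swi 0) * t * aw 1 0, ?_, fun y => ?_⟩
    · refine isD_of (a := a0) (b := a2) (c := a1) (d := a3) (key.trans ?_)
      simp only [emb4, mul4]
      apply ext4 <;> simp
    · apply mx_inj
      rw [mx_mul, mx_mul, mx_aw, mx_aw, key, e]
      simp only [emb4, mul4]
      apply ext4 <;> simp <;> field_simp
  · refine ⟨a2 / a3, div_ne_zero n2 n3, iota 2 (swi 0) * t * aw 2 0, ?_, fun y => ?_⟩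
    · refine isD_of (a := a0) (b := a1) (c := a3) (d := a2) (key.trans ?_)
      simp only [emb4, mul4]
      apply ext4 <;> simp
    · apply mx_inj
      rw [mx_mul, mx_mul, mx_aw, mx_aw, key, e]
      simp only [emb4, mul4]
      apply ext4 <;> simp <;> field_simp

lemma rT_wt (i : Fin 3) {f : S4 F → F} (hf : IsWt f) : IsWt (rT i f) := by
  constructor
  · intro u hu x
    obtain ⟨a, ha⟩ := IsU_conj hu i
    rw [rT, rT]
    refine Fintype.sum_equiv (Equiv.addRight a) _ _ fun y => ?_
    rw [← hf.1 _ (ha y) (x * aw i (Equiv.addRight a y))]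
    congr 1
    simp only [Equiv.coe_addRight]
    calc x * u * aw i y = x * (aw i (y + a) * iota i (swi (y + a))) * u * aw i y := by rw [aw_swi, mul_one]
      _ = _ := by simp only [mul_assoc]
  · intro t ht
    obtain ⟨k, hk, t', ht', h⟩ := IsD_conj ht i
    obtain ⟨c, hc⟩ := hf.2 t' ht'
    refine ⟨c, fun x => ?_⟩
    rw [rT, rT, Finset.mul_sum]
    refine Fintype.sum_equiv (Equiv.mulLeft₀ k hk) _ _ fun y => ?_
    rw [← hc, mul_assoc, h, mul_assoc]; rfl

open scoped Classical in
lemma sum_zero_units (g : F → F) : ∑ z, g z = g 0 + ∑ u : Fˣ, g u := by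
  rw [← Finset.add_sum_erase _ _ (Finset.mem_univ 0)]
  congr 1
  symm
  refine Finset.sum_bij (fun u _ => (u : F)) ?_ ?_ ?_ ?_
  · intro a _; simp
  · intro a _ b _ h; exact Units.ext h
  · intro b hb
    exact ⟨Units.mk0 b (by simpa using hb), Finset.mem_univ _, rfl⟩
  · intro a _; rfl

lemma wt_char {f : S4 F → F} (hf : IsWt f) (h0 : f ≠ 0) (i : Fin 3) :
    ∃ n < Fintype.card F - 1, ∀ (c : Fˣ) x, f (x * iota i (sh c)) = (c : F) ^ n * f x := by
  classical
  obtain ⟨g, hg⟩ := IsCyclic.exists_generator (α := Fˣ)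
  obtain ⟨c, hc⟩ := hf.2 _ (isD_sh i g)
  obtain ⟨x0, hx0⟩ := Function.ne_iff.1 h0
  have hc0 : c ≠ 0 := by
    rintro rfl
    have := hc (x0 * (iota i (sh g))⁻¹)
    rw [inv_mul_cancel_right, zero_mul] at this
    exact hx0 this
  obtain ⟨n, hn⟩ := (mem_powers_iff_mem_zpowers).2 (hg (Units.mk0 c hc0))
  have hn : g ^ n = Units.mk0 c hc0 := hn
  have hcard : Fintype.card Fˣ = Fintype.card F - 1 := by rw [Fintype.card_units]
  refine ⟨n % (Fintype.card F - 1), Nat.mod_lt _ ?_, ?_⟩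
  · rw [← hcard]; exact Fintype.card_pos
  · intro d x
    have hd : (d : F) ^ (n % (Fintype.card F - 1)) = (d : F) ^ n := by
      rw [← hcard, ← Units.val_pow_eq_pow_val, pow_mod_card, Units.val_pow_eq_pow_val]
    rw [hd]
    obtain ⟨m, hm⟩ := (mem_powers_iff_mem_zpowers).2 (hg d)
    have hm : g ^ m = d := hm
    subst hm
    have hcg : c = (g : F) ^ n := by
      have := congrArg Units.val hn
      simpa using this.symm
    clear hd
    clear * - hc hcg
    induction m with
    | zero =>
      have : (sh (g ^ 0) : S2 F) = 1 := by
        apply mx_inj; ext a b; fin_cases a <;> fin_cases b <;> simp [sh, Matrix.one_apply]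
      rw [this]; simp
    | succ m ih =>
      rw [pow_succ, sh_mul, map_mul, ← mul_assoc, hc, ih, hcg]
      push_cast
      ring

lemma rT_quad (i : Fin 3) {f : S4 F → F} (hf : IsWt f) {n : ℕ} (hn : n < Fintype.card F - 1)
    (h : ∀ (c : Fˣ) x, f (x * iota i (sh c)) = (c : F) ^ n * f x) :
    rT i (rT i f) = (if n = 0 then (-1 : F) else 0) • rT i f := by
  classical
  funext x
  have h1 : rT i (rT i f) x = ∑ z : F, ∑ y : F, f (x * aw i y * aw i z) := by
    rw [Finset.sum_comm]; rfl
  rw [h1, sum_zero_units]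
  have h2 : ∑ y : F, f (x * aw i y * aw i 0) = 0 := by
    have : ∀ y : F, f (x * aw i y * aw i 0) = ((-1 : Fˣ) : F) ^ n * f x := by
      intro y
      rw [← hf.1 _ (isU_su i y) x, ← h]
      unfold aw
      rw [mul_assoc, mul_assoc, ← map_mul, ← map_mul, ← sw_sq]
      congr 2
      have : (su 0 : S2 F) = 1 := by
        apply mx_inj; ext a b; fin_cases a <;> fin_cases b <;> simp [su, Matrix.one_apply]
      rw [this, one_mul, mul_assoc]
    rw [Finset.sum_congr rfl (fun y _ => this y)]
    simp
  have h3 : ∀ z : Fˣ, ∑ y : F, f (x * aw i y * aw i (z : F)) = ((-z : Fˣ) : F) ^ n * rT i f x := by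
    intro z
    rw [rT, Finset.mul_sum]
    refine Fintype.sum_equiv (Equiv.addRight (-((z⁻¹ : Fˣ) : F))) _ _ fun y => ?_
    rw [← h, ← hf.1 _ (isU_su i (-((z⁻¹ : Fˣ) : F))) (x * aw i (Equiv.addRight (-((z⁻¹ : Fˣ) : F)) y) * iota i (sh (-z)))]
    congr 1
    unfold aw
    rw [Equiv.coe_addRight, mul_assoc, mul_assoc, mul_assoc, ← map_mul, ← map_mul, ← map_mul]
    congr 2
    rw [su_add]
    have := sw_rel z
    calc su y * sw * (su (z : F) * sw) = su y * (sw * su (z : F) * sw) := by simp only [mul_assoc]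
      _ = _ := by rw [this]; simp only [mul_assoc]
  rw [h2, zero_add, Finset.sum_congr rfl (fun z _ => h3 z), ← Finset.sum_mul, Pi.smul_apply, smul_eq_mul]
  congr 1
  rw [← Equiv.sum_comp (Equiv.neg Fˣ)]
  simp only [Equiv.neg_apply, neg_neg]
  rw [FiniteField.sum_pow_units]
  by_cases h0 : n = 0
  · simp [h0]
  · rw [if_neg h0, if_neg]
    intro hd
    exact h0 (Nat.eq_zero_of_dvd_of_lt hd hn)

lemma aw_braid (i j : Fin 3) (hij : (i = 0 ∧ j = 1) ∨ (i = 1 ∧ j = 2)) (a b c : F) :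
    aw i a * aw j b * aw i c = aw j c * aw i (-b - a * c) * aw j a := by
  apply mx_inj
  simp only [mx_mul, mx_aw]
  rcases hij with ⟨rfl, rfl⟩ | ⟨rfl, rfl⟩ <;>
    simp only [emb4, mul4] <;> apply ext4 <;> simp <;> ring

lemma aw_comm (a b : F) : aw 0 a * aw 2 b = aw 2 b * aw 0 a := by
  apply mx_inj
  simp only [mx_mul, mx_aw]
  simp only [emb4, mul4]
  apply ext4 <;> simp

lemma rT_comm (f : S4 F → F) : rT 0 (rT 2 f) = rT 2 (rT 0 f) := by
  funext x
  simp only [rT]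
  rw [Finset.sum_comm]
  simp only [mul_assoc, aw_comm]

lemma rT_braid (i j : Fin 3) (hij : (i = 0 ∧ j = 1) ∨ (i = 1 ∧ j = 2)) (f : S4 F → F) :
    rT i (rT j (rT i f)) = rT j (rT i (rT j f)) := by
  funext x
  simp only [rT]
  have : ∀ a b c : F, f (x * aw i a * aw j b * aw i c) = f (x * aw j c * aw i (-b - a * c) * aw j a) := by
    intro a b c
    have h := aw_braid i j hij a b c
    have e1 : x * aw i a * aw j b * aw i c = x * (aw i a * aw j b * aw i c) := by simp only [mul_assoc]
    rw [e1, h]; simp only [mul_assoc]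
  simp only [this]
  calc ∑ a, ∑ b, ∑ c, f (x * aw j c * aw i (-b - a * c) * aw j a)
      = ∑ a, ∑ c, ∑ b, f (x * aw j c * aw i (-b - a * c) * aw j a) := by
        refine Finset.sum_congr rfl fun a _ => Finset.sum_comm
    _ = ∑ a, ∑ c, ∑ b, f (x * aw j c * aw i b * aw j a) := by
        refine Finset.sum_congr rfl fun a _ => Finset.sum_congr rfl fun c _ => ?_
        refine Fintype.sum_equiv ((Equiv.neg F).trans (Equiv.subRight (a * c))) _ _ fun b => ?_
        rfl
    _ = ∑ c, ∑ a, ∑ b, f (x * aw j c * aw i b * aw j a) := Finset.sum_comm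
    _ = _ := Finset.sum_congr rfl fun c _ => Finset.sum_comm

end heck

set_option linter.unusedSimpArgs false
set_option linter.unusedSectionVars false
section five
variable {F : Type} [Field F]

lemma eta4 {R : Type*} (M : Matrix (Fin 4) (Fin 4) R) : M = !![M 0 0, M 0 1, M 0 2, M 0 3; M 1 0, M 1 1, M 1 2, M 1 3; M 2 0, M 2 1, M 2 2, M 2 3; M 3 0, M 3 1, M 3 2, M 3 3] := by
  ext a b; fin_cases a <;> fin_cases b <;> rfl

lemma IsD.det {t : S4 F} (h : IsD t) : mx t 0 0 * mx t 1 1 * mx t 2 2 * mx t 3 3 = 1 := by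
  have : (mx t).BlockTriangular id := fun a b hab => h _ _ (ne_of_gt hab)
  rw [← mx_det t, Matrix.det_of_isUpperTriangular this, Fin.prod_univ_four]

lemma diag_sh [Fintype F] {t : S4 F} (h : IsD t) : ∃ c0 c1 c2 : Fˣ, t = iota 0 (sh c0) * iota 1 (sh c1) * iota 2 (sh c2) := by
  have hd := h.det
  have e := mx_D h
  have n0 : mx t 0 0 ≠ 0 := by intro h0; simp [h0] at hd
  have n1 : mx t 1 1 ≠ 0 := by intro h0; simp [h0] at hd
  have n2 : mx t 2 2 ≠ 0 := by intro h0; simp [h0] at hd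
  have n3 : mx t 3 3 ≠ 0 := by intro h0; simp [h0] at hd
  generalize mx t 0 0 = a, mx t 1 1 = b, mx t 2 2 = c, mx t 3 3 = d at *
  refine ⟨Units.mk0 a n0, Units.mk0 (a * b) (mul_ne_zero n0 n1), Units.mk0 (a * b * c) (mul_ne_zero (mul_ne_zero n0 n1) n2), ?_⟩
  apply mx_inj
  rw [mx_mul, mx_mul, iota_coe, iota_coe, iota_coe, e]
  simp only [emb4, mul4]
  apply ext4 <;> simp [sh]
  · field_simp
  · field_simp
  · rw [mul_comm, ← mul_inv, ← mul_inv]; exact eq_inv_of_mul_eq_one_right (by rw [← hd]; ring)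

lemma clear2 (x y : F) : ∃ m : S2 F, x * mx m 0 1 + y * mx m 1 1 = 0 := by
  by_cases hx : x = 0
  · by_cases hy : y = 0
    · exact ⟨1, by simp [hx, hy]⟩
    · exact ⟨sw, by simp [hx, sw]⟩
  · refine ⟨su (-(y / x)), ?_⟩
    simp [su]; field_simp; ring

def KK (F : Type) [Field F] : Subgroup (S4 F) := ⨆ i : Fin 3, (iota (F := F) i).range

lemma iota_KK (i : Fin 3) (m : S2 F) : iota i m ∈ KK F :=
  Subgroup.mem_iSup_of_mem (S := fun i : Fin 3 => (iota (F := F) i).range) i ⟨m, rfl⟩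

lemma mul_emb0 (M : Matrix (Fin 4) (Fin 4) F) (m : Matrix (Fin 2) (Fin 2) F) : M * emb4 0 m =
    !![M 0 0 * m 0 0 + M 0 1 * m 1 0, M 0 0 * m 0 1 + M 0 1 * m 1 1, M 0 2, M 0 3;
       M 1 0 * m 0 0 + M 1 1 * m 1 0, M 1 0 * m 0 1 + M 1 1 * m 1 1, M 1 2, M 1 3;
       M 2 0 * m 0 0 + M 2 1 * m 1 0, M 2 0 * m 0 1 + M 2 1 * m 1 1, M 2 2, M 2 3;
       M 3 0 * m 0 0 + M 3 1 * m 1 0, M 3 0 * m 0 1 + M 3 1 * m 1 1, M 3 2, M 3 3] := by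
  conv_lhs => rw [eta4 M]
  simp only [emb4, mul4]; apply ext4 <;> simp
lemma mul_emb1 (M : Matrix (Fin 4) (Fin 4) F) (m : Matrix (Fin 2) (Fin 2) F) : M * emb4 1 m =
    !![M 0 0, M 0 1 * m 0 0 + M 0 2 * m 1 0, M 0 1 * m 0 1 + M 0 2 * m 1 1, M 0 3;
       M 1 0, M 1 1 * m 0 0 + M 1 2 * m 1 0, M 1 1 * m 0 1 + M 1 2 * m 1 1, M 1 3;
       M 2 0, M 2 1 * m 0 0 + M 2 2 * m 1 0, M 2 1 * m 0 1 + M 2 2 * m 1 1, M 2 3;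
       M 3 0, M 3 1 * m 0 0 + M 3 2 * m 1 0, M 3 1 * m 0 1 + M 3 2 * m 1 1, M 3 3] := by
  conv_lhs => rw [eta4 M]
  simp only [emb4, mul4]; apply ext4 <;> simp
lemma mul_emb2 (M : Matrix (Fin 4) (Fin 4) F) (m : Matrix (Fin 2) (Fin 2) F) : M * emb4 2 m =
    !![M 0 0, M 0 1, M 0 2 * m 0 0 + M 0 3 * m 1 0, M 0 2 * m 0 1 + M 0 3 * m 1 1;
       M 1 0, M 1 1, M 1 2 * m 0 0 + M 1 3 * m 1 0, M 1 2 * m 0 1 + M 1 3 * m 1 1;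
       M 2 0, M 2 1, M 2 2 * m 0 0 + M 2 3 * m 1 0, M 2 2 * m 0 1 + M 2 3 * m 1 1;
       M 3 0, M 3 1, M 3 2 * m 0 0 + M 3 3 * m 1 0, M 3 2 * m 0 1 + M 3 3 * m 1 1] := by
  conv_lhs => rw [eta4 M]
  simp only [emb4, mul4]; apply ext4 <;> simp

lemma LQ (M : Matrix (Fin 4) (Fin 4) F) : ∃ k ∈ KK F, ∀ i j, i < j → (M * mx k) i j = 0 := by
  have s1 : ∀ M : Matrix (Fin 4) (Fin 4) F, ∃ k ∈ KK F, (M * mx k) 0 3 = 0 := by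
    intro M
    obtain ⟨m, hm⟩ := clear2 (M 0 2) (M 0 3)
    exact ⟨_, iota_KK 2 m, by rw [iota_coe, mul_emb2]; exact hm⟩
  have s2 : ∀ M : Matrix (Fin 4) (Fin 4) F, ∃ k ∈ KK F, (M * mx k) 0 3 = 0 ∧ (M * mx k) 0 2 = 0 := by
    intro M
    obtain ⟨k, hk, h⟩ := s1 M
    obtain ⟨m, hm⟩ := clear2 ((M * mx k) 0 1) ((M * mx k) 0 2)
    refine ⟨_, mul_mem hk (iota_KK 1 m), ?_⟩
    rw [mx_mul, ← mul_assoc, iota_coe, mul_emb1]; exact ⟨h, hm⟩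
  have s3 : ∀ M : Matrix (Fin 4) (Fin 4) F, ∃ k ∈ KK F, (M * mx k) 0 3 = 0 ∧ (M * mx k) 0 2 = 0 ∧ (M * mx k) 0 1 = 0 := by
    intro M
    obtain ⟨k, hk, h⟩ := s2 M
    obtain ⟨m, hm⟩ := clear2 ((M * mx k) 0 0) ((M * mx k) 0 1)
    refine ⟨_, mul_mem hk (iota_KK 0 m), ?_⟩
    rw [mx_mul, ← mul_assoc, iota_coe, mul_emb0]; exact ⟨h.1, h.2, hm⟩
  have s4 : ∀ M : Matrix (Fin 4) (Fin 4) F, ∃ k ∈ KK F, (M * mx k) 0 3 = 0 ∧ (M * mx k) 0 2 = 0 ∧ (M * mx k) 0 1 = 0 ∧ (M * mx k) 1 3 = 0 := by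
    intro M
    obtain ⟨k, hk, h⟩ := s3 M
    obtain ⟨m, hm⟩ := clear2 ((M * mx k) 1 2) ((M * mx k) 1 3)
    refine ⟨_, mul_mem hk (iota_KK 2 m), ?_⟩
    rw [mx_mul, ← mul_assoc, iota_coe, mul_emb2]
    exact ⟨by simp [h], by simp [h], h.2.2, hm⟩
  have s5 : ∀ M : Matrix (Fin 4) (Fin 4) F, ∃ k ∈ KK F, (M * mx k) 0 3 = 0 ∧ (M * mx k) 0 2 = 0 ∧ (M * mx k) 0 1 = 0 ∧ (M * mx k) 1 3 = 0 ∧ (M * mx k) 1 2 = 0 := by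
    intro M
    obtain ⟨k, hk, h⟩ := s4 M
    obtain ⟨m, hm⟩ := clear2 ((M * mx k) 1 1) ((M * mx k) 1 2)
    refine ⟨_, mul_mem hk (iota_KK 1 m), ?_⟩
    rw [mx_mul, ← mul_assoc, iota_coe, mul_emb1]
    exact ⟨h.1, by simp [h], by simp [h], h.2.2.2, hm⟩
  obtain ⟨k, hk, h⟩ := s5 M
  obtain ⟨m, hm⟩ := clear2 ((M * mx k) 2 2) ((M * mx k) 2 3)
  refine ⟨_, mul_mem hk (iota_KK 2 m), ?_⟩
  rw [mx_mul, ← mul_assoc, iota_coe, mul_emb2]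
  intro i j hij
  fin_cases i <;> fin_cases j <;> first | exact absurd hij (by decide) | simp [h, hm]

/-- leading principal minors -/
def dl {R : Type*} [CommRing R] (i : Fin 3) (M : Matrix (Fin 4) (Fin 4) R) : R :=
  match i with
  | 0 => M 0 0
  | 1 => M 0 0 * M 1 1 - M 0 1 * M 1 0
  | 2 => M 0 0 * (M 1 1 * M 2 2 - M 1 2 * M 2 1) - M 0 1 * (M 1 0 * M 2 2 - M 1 2 * M 2 0) + M 0 2 * (M 1 0 * M 2 1 - M 1 1 * M 2 0)

def ff {R : Type*} [CommRing R] (n : Fin 3 → ℕ) (M : Matrix (Fin 4) (Fin 4) R) : R :=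
  dl 0 M ^ n 0 * dl 1 M ^ n 1 * dl 2 M ^ n 2

lemma mul4' {R : Type*} [CommRing R] (A B : Matrix (Fin 4) (Fin 4) R) (i j) : (A * B) i j = A i 0 * B 0 j + A i 1 * B 1 j + A i 2 * B 2 j + A i 3 * B 3 j := by
  rw [Matrix.mul_apply, Fin.sum_univ_four]

lemma dl_L {R : Type*} [CommRing R] (m : Fin 3) {A : Matrix (Fin 4) (Fin 4) R} (hA : ∀ i j, i < j → A i j = 0) (x : Matrix (Fin 4) (Fin 4) R) :
    dl m (A * x) = dl m A * dl m x := by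
  have h1 := hA 0 1 (by decide)
  have h2 := hA 0 2 (by decide)
  have h3 := hA 0 3 (by decide)
  have h4 := hA 1 2 (by decide)
  have h5 := hA 1 3 (by decide)
  have h6 := hA 2 3 (by decide)
  rcases fin3 m with rfl | rfl | rfl <;> simp only [dl, mul4', h1, h2, h3, h4, h5, h6] <;> ring

lemma dl_T {R : Type*} [CommRing R] (m : Fin 3) (x : Matrix (Fin 4) (Fin 4) R) : dl m xᵀ = dl m x := by
  rcases fin3 m with rfl | rfl | rfl <;> simp only [dl, Matrix.transpose_apply] <;> ring

lemma ff_L {R : Type*} [CommRing R] (n : Fin 3 → ℕ) {A : Matrix (Fin 4) (Fin 4) R} (hA : ∀ i j, i < j → A i j = 0) (x : Matrix (Fin 4) (Fin 4) R) :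
    ff n (A * x) = ff n A * ff n x := by
  simp only [ff, dl_L _ hA, mul_pow]; ring

lemma ff_T {R : Type*} [CommRing R] (n : Fin 3 → ℕ) (x : Matrix (Fin 4) (Fin 4) R) : ff n xᵀ = ff n x := by
  simp only [ff, dl_T]

lemma ff_U {R : Type*} [CommRing R] (n : Fin 3 → ℕ) {A : Matrix (Fin 4) (Fin 4) R} (hA : ∀ i j, j < i → A i j = 0) (x : Matrix (Fin 4) (Fin 4) R) :
    ff n (x * A) = ff n x * ff n A := by
  rw [← ff_T n (x * A), Matrix.transpose_mul, ff_L n (A := Aᵀ) (fun i j h => hA j i h), ff_T, ff_T, mul_comm]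

variable [Fintype F]

structure RC (n : Fin 3 → ℕ) (f : S4 F → F) : Prop where
  U : ∀ u, IsU u → ∀ x, f (x * u) = f x
  H : ∀ i (c : Fˣ) x, f (x * iota i (sh c)) = (c : F) ^ n i * f x
  T : ∀ i x, ∑ y, f (x * aw i y) = (if n i = Fintype.card F - 1 then -1 else 0) * f x

lemma sum_lin (n : ℕ) (hn : n ≤ Fintype.card F - 1) (A B : F) :
    ∑ y : F, (-(y * A + B)) ^ n = (if n = Fintype.card F - 1 then -1 else 0) * A ^ n := by
  have hq : 1 < Fintype.card F := Fintype.one_lt_card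
  by_cases hA : A = 0
  · subst hA
    have : (∑ y : F, (-(y * 0 + B)) ^ n) = 0 := by
      simp
    rw [this]
    by_cases h : n = Fintype.card F - 1
    · rw [zero_pow (by omega), mul_zero]
    · rw [if_neg h, zero_mul]
  · have : ∑ y : F, (-(y * A + B)) ^ n = ∑ z : F, z ^ n :=
      Fintype.sum_equiv (((Equiv.mulRight₀ A hA).trans (Equiv.addRight B)).trans (Equiv.neg F)) _ _ fun y => rfl
    rw [this]
    by_cases h : n = Fintype.card F - 1
    · classical
      rw [if_pos h, h, FiniteField.pow_card_sub_one_eq_one A hA, sum_zero_units, zero_pow (by omega), FiniteField.sum_pow_units]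
      simp
    · rw [if_neg h, zero_mul]
      exact FiniteField.sum_pow_lt_card_sub_one F _ (by omega)

lemma RC_ff (n : Fin 3 → ℕ) (hn : ∀ i, n i ≤ Fintype.card F - 1) : RC n (fun x : S4 F => ff n (mx x)) := by
  constructor
  · intro u hu x
    rw [mx_mul, ff_U n hu.1]
    have : ff n (mx u) = 1 := by
      simp [ff, dl, hu.2, hu.1]
    rw [this, mul_one]
  · intro i c x
    rw [mx_mul, iota_coe]
    have hc : (c : F) ≠ 0 := c.ne_zero
    rw [ff_U n (by
      intro a b
      fin_cases i <;> fin_cases a <;> fin_cases b <;> simp [emb4, sh]), mul_comm]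
    congr 1
    rcases fin3 i with rfl | rfl | rfl <;> simp [ff, dl, emb4, sh]
  · intro i x
    have h0 := sum_lin (n 0) (hn 0)
    have h1 := sum_lin (n 1) (hn 1)
    have h2 := sum_lin (n 2) (hn 2)
    rcases fin3 i with rfl | rfl | rfl
    · have : ∀ y, ff n (mx (x * aw 0 y)) = (-(y * dl 0 (mx x) + mx x 0 1)) ^ n 0 * (dl 1 (mx x) ^ n 1 * dl 2 (mx x) ^ n 2) := by
        intro y
        rw [mx_mul, mx_aw, mul_emb0, ff, ← mul_assoc]
        congr 1; congr 1
        all_goals congr 1; simp [dl]; ring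
      simp only [this]
      rw [← Finset.sum_mul, h0, ff]; ring
    · have : ∀ y, ff n (mx (x * aw 1 y)) = (-(y * dl 1 (mx x) + (mx x 0 0 * mx x 1 2 - mx x 0 2 * mx x 1 0))) ^ n 1 * (dl 0 (mx x) ^ n 0 * dl 2 (mx x) ^ n 2) := by
        intro y
        rw [mx_mul, mx_aw, mul_emb1, ff, ← mul_assoc, mul_comm (_ ^ n 1)]
        congr 1; congr 1
        all_goals congr 1; simp [dl]; try ring
      simp only [this]
      rw [← Finset.sum_mul, h1, ff]; ring
    · have : ∀ y, ff n (mx (x * aw 2 y)) = (-(y * dl 2 (mx x) + (mx x 0 0 * (mx x 1 1 * mx x 2 3 - mx x 1 3 * mx x 2 1) - mx x 0 1 * (mx x 1 0 * mx x 2 3 - mx x 1 3 * mx x 2 0) + mx x 0 3 * (mx x 1 0 * mx x 2 1 - mx x 1 1 * mx x 2 0)))) ^ n 2 * (dl 0 (mx x) ^ n 0 * dl 1 (mx x) ^ n 1) := by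
        intro y
        rw [mx_mul, mx_aw, mul_emb2, ff, mul_comm]
        congr 1; congr 1
        all_goals try congr 1
        all_goals simp [dl]; try ring
      simp only [this]
      rw [← Finset.sum_mul, h2, ff]; ring

end five

set_option linter.unusedSimpArgs false
set_option linter.unusedSectionVars false

lemma hecke_abs {M : Type*} [AddCommGroup M] (A B C : M →+ M) (P : M → Prop)
    (PA : ∀ v, P v → P (A v)) (PB : ∀ v, P v → P (B v)) (PC : ∀ v, P v → P (C v))
    (qA : ∀ v, P v → A (A v) = 0 ∨ A (A v) = - A v)
    (qB : ∀ v, P v → B (B v) = 0 ∨ B (B v) = - B v)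
    (qC : ∀ v, P v → C (C v) = 0 ∨ C (C v) = - C v)
    (bAB : ∀ v, A (B (A v)) = B (A (B v))) (bBC : ∀ v, B (C (B v)) = C (B (C v)))
    (cAC : ∀ v, A (C v) = C (A v)) (v : M) (hv : P v) (h0 : v ≠ 0) :
    ∃ w, P w ∧ w ≠ 0 ∧ (A w = 0 ∨ A w = -w) ∧ (B w = 0 ∨ B w = -w) ∧ (C w = 0 ∨ C w = -w) := by
  have s1 : ∃ w, P w ∧ w ≠ 0 ∧ (A w = 0 ∨ A w = -w) ∧ (B w = 0 ∨ B w = -w) := by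
    by_cases h1 : A (B (A v)) = 0
    · by_cases h2 : A (B v) = 0
      · by_cases h3 : B (A v) = 0
        · by_cases h4 : A v = 0
          · by_cases h5 : B v = 0
            · exact ⟨v, hv, h0, Or.inl h4, Or.inl h5⟩
            · exact ⟨_, PB _ hv, h5, Or.inl h2, qB _ hv⟩
          · exact ⟨_, PA _ hv, h4, qA _ hv, Or.inl h3⟩
        · exact ⟨_, PB _ (PA _ hv), h3, Or.inl h1, qB _ (PA _ hv)⟩
      · exact ⟨_, PA _ (PB _ hv), h2, qA _ (PB _ hv), Or.inl (by rw [← bAB, h1])⟩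
    · exact ⟨_, PA _ (PB _ (PA _ hv)), h1, qA _ (PB _ (PA _ hv)), by
        rw [bAB]; exact qB _ (PA _ (PB _ hv))⟩
  obtain ⟨v, hv, h0, hA, hB⟩ := s1
  by_cases h1 : A (B (C v)) = 0
  · by_cases h2 : B (C v) = 0
    · by_cases h3 : C v = 0
      · exact ⟨v, hv, h0, hA, hB, Or.inl h3⟩
      · refine ⟨_, PC _ hv, h3, ?_, Or.inl h2, qC _ hv⟩
        rw [cAC]; rcases hA with h | h <;> simp [h]
    · refine ⟨_, PB _ (PC _ hv), h2, Or.inl h1, qB _ (PC _ hv), ?_⟩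
      rw [← bBC]; rcases hB with h | h <;> simp [h]
  · refine ⟨_, PA _ (PB _ (PC _ hv)), h1, qA _ (PB _ (PC _ hv)), ?_, ?_⟩
    · rw [← bAB, cAC]; rcases hA with h | h <;> simp [h]
    · rw [← cAC, ← bBC]; rcases hB with h | h <;> simp [h]

section five
variable {F : Type} [Field F] [Fintype F]

def rTh (i : Fin 3) : (S4 F → F) →+ (S4 F → F) where
  toFun := rT i
  map_zero' := by funext x; simp [rT]
  map_add' f g := by funext x; simp [rT, Finset.sum_add_distrib]

lemma RC.left {n : Fin 3 → ℕ} {f : S4 F → F} (h : RC n f) (k : S4 F) : RC n (fun x => f (k * x)) := by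
  constructor
  · intro u hu x; simp only [← mul_assoc]; exact h.U u hu _
  · intro i c x; simp only [← mul_assoc]; exact h.H i c _
  · intro i x; simp only [← mul_assoc]; exact h.T i _

lemma IsD.one : IsD (1 : S4 F) := fun _ _ h => Matrix.one_apply_ne h

lemma IsD.conj {t u : S4 F} (ht : IsD t) (hu : IsU u) : ∃ u', IsU u' ∧ u * t = t * u' := by
  have hd := ht.det
  have e := mx_D ht
  have eu := mx_U hu
  have n0 : mx t 0 0 ≠ 0 := by intro h0; simp [h0] at hd
  have n1 : mx t 1 1 ≠ 0 := by intro h0; simp [h0] at hd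
  have n2 : mx t 2 2 ≠ 0 := by intro h0; simp [h0] at hd
  have n3 : mx t 3 3 ≠ 0 := by intro h0; simp [h0] at hd
  generalize mx t 0 0 = a, mx t 1 1 = b, mx t 2 2 = c, mx t 3 3 = d at *
  have key : u * t = t * (t⁻¹ * u * t) := by simp [mul_assoc]
  refine ⟨t⁻¹ * u * t, ?_, key⟩
  have k2 : mx u * mx t = mx t * mx (t⁻¹ * u * t) := by rw [← mx_mul, ← mx_mul, ← key]
  generalize t⁻¹ * u * t = w at *
  have ent : ∀ i j, (mx u * mx t) i j = (mx t * mx w) i j := fun i j => by rw [k2]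
  simp only [mul4'] at ent
  rw [e] at ent
  constructor
  · intro i j hij
    have := ent i j
    fin_cases i <;> fin_cases j <;> first | exact absurd hij (by decide) | simpa [hu.1, hu.2, n0, n1, n2, n3] using this.symm
  · intro i
    have := ent i i
    fin_cases i <;> simp [hu.1, hu.2, n0, n1, n2, n3] at this
    all_goals exact this

lemma sh_comm (i j : Fin 3) (c d : Fˣ) : iota (F := F) i (sh c) * iota j (sh d) = iota j (sh d) * iota i (sh c) := by
  apply mx_inj
  rw [mx_mul, mx_mul, iota_coe, iota_coe]
  rcases fin3 i with rfl | rfl | rfl <;> rcases fin3 j with rfl | rfl | rfl <;>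
    simp only [emb4, mul4] <;> apply ext4 <;> simp [sh, mul_comm]

lemma proj_wt (X : Submodule F (S4 F → F)) (hX : ∀ a, ∀ f ∈ X, (fun x => f (x * a)) ∈ X)
    (i : Fin 3) (f : S4 F → F) (hf : f ∈ X) (h0 : f ≠ 0) (hU : ∀ u, IsU u → ∀ x, f (x * u) = f x) :
    ∃ g ∈ X, g ≠ 0 ∧ (∀ u, IsU u → ∀ x, g (x * u) = g x) ∧
      (∀ d : Fˣ, ∃ c, ∀ x, g (x * iota i (sh d)) = c * g x) ∧
      ∀ j (d : Fˣ) (c : F), (∀ x, f (x * iota j (sh d)) = c * f x) → ∀ x, g (x * iota j (sh d)) = c * g x := by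
  classical
  let g : ℕ → S4 F → F := fun n x => ∑ c : Fˣ, ((c⁻¹ : Fˣ) : F) ^ n * f (x * iota i (sh c))
  have hex : ∃ n, g n ≠ 0 := by
    by_contra hall
    push Not at hall
    apply h0
    funext x
    have h1 : ∑ n ∈ Finset.range (Fintype.card F - 1), g n x = 0 := by
      simp [hall]
    rw [Finset.sum_comm] at h1
    have h2 : ∀ c : Fˣ, ∑ n ∈ Finset.range (Fintype.card F - 1), ((c⁻¹ : Fˣ) : F) ^ n * f (x * iota i (sh c)) =
        if c = 1 then -f x else 0 := by
      intro c
      rw [← Finset.sum_mul]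
      split_ifs with hc
      · subst hc
        have : (sh 1 : S2 F) = 1 := by
          apply mx_inj; ext a b; fin_cases a <;> fin_cases b <;> simp [sh, Matrix.one_apply]
        rw [this]
        simp [Nat.cast_sub (Fintype.card_pos (α := F))]
      · have h3 := geom_sum_mul ((c⁻¹ : Fˣ) : F) (Fintype.card F - 1)
        rw [FiniteField.pow_card_sub_one_eq_one _ (Units.ne_zero _), sub_self] at h3
        rcases mul_eq_zero.1 h3 with h | h
        · rw [h, zero_mul]
        · exfalso; apply hc
          rw [sub_eq_zero] at h
          have : c⁻¹ = 1 := Units.ext h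
          simpa using this
    rw [Finset.sum_congr rfl (fun c _ => h2 c)] at h1
    simpa using h1
  obtain ⟨n, hn⟩ := hex
  refine ⟨g n, ?_, hn, ?_, ?_, ?_⟩
  · have : g n = ∑ c : Fˣ, ((c⁻¹ : Fˣ) : F) ^ n • (fun x => f (x * iota i (sh c))) := by
      funext x; simp [g]
    rw [this]
    exact Submodule.sum_mem _ fun c _ => Submodule.smul_mem _ _ (hX _ _ hf)
  · intro u hu x
    refine Finset.sum_congr rfl fun c _ => ?_
    obtain ⟨u', hu', e⟩ := IsD.conj (isD_sh i c) hu
    rw [mul_assoc, e, ← mul_assoc, hU _ hu']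
  · intro d
    refine ⟨(d : F) ^ n, fun x => ?_⟩
    simp only [g]
    rw [Finset.mul_sum]
    refine Fintype.sum_equiv (Equiv.mulLeft d) _ _ fun c => ?_
    simp only [Equiv.coe_mulLeft]
    rw [sh_mul, map_mul, mul_assoc, ← mul_assoc, ← mul_assoc, ← mul_pow]
    congr 2
    simp [mul_comm (d : F)]
  · intro j d c h x
    simp only [g]
    rw [Finset.mul_sum]
    refine Finset.sum_congr rfl fun e _ => ?_
    rw [mul_assoc, sh_comm, ← mul_assoc x, h]; ring

lemma exists_wt (p : ℕ) [Fact p.Prime] [CharP F p] (X : Submodule F (S4 F → F)) (hX : ∀ a, ∀ f ∈ X, (fun x => f (x * a)) ∈ X)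
    (hne : X ≠ ⊥) : ∃ f ∈ X, f ≠ 0 ∧ IsWt f := by
  obtain ⟨f, hf, h0, hU⟩ := fixpt p (usub_pgroup (F := F) p) (fun (a : Usub F) x => x * (a : S4 F)) (fun x => by simp)
    (fun a b x => by simp [mul_assoc]) X (fun a f hf => hX a f hf) hne
  have hU : ∀ u, IsU u → ∀ x, f (x * u) = f x := fun u hu x => hU ⟨u, hu⟩ x
  obtain ⟨f0, m0, z0, u0, c0, -⟩ := proj_wt X hX 0 f hf h0 hU
  obtain ⟨f1, m1, z1, u1, c1, p1⟩ := proj_wt X hX 1 f0 m0 z0 u0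
  obtain ⟨f2, m2, z2, u2, c2, p2⟩ := proj_wt X hX 2 f1 m1 z1 u1
  refine ⟨f2, m2, z2, u2, fun t ht => ?_⟩
  obtain ⟨a, b, c, rfl⟩ := diag_sh ht
  obtain ⟨k0, e0⟩ := c0 a
  have e0 := p2 0 a k0 (p1 0 a k0 e0)
  obtain ⟨k1, e1⟩ := c1 b
  have e1 := p2 1 b k1 e1
  obtain ⟨k2, e2⟩ := c2 c
  refine ⟨k2 * (k1 * k0), fun x => ?_⟩
  rw [← mul_assoc, ← mul_assoc, e2, e1, e0]; ring

lemma exists_RC (p : ℕ) [Fact p.Prime] [CharP F p] (X : Submodule F (S4 F → F)) (hX : ∀ a, ∀ f ∈ X, (fun x => f (x * a)) ∈ X)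
    (hne : X ≠ ⊥) : ∃ n : Fin 3 → ℕ, (∀ i, n i ≤ Fintype.card F - 1) ∧ ∃ f ∈ X, f ≠ 0 ∧ RC n f := by
  obtain ⟨f, hf, h0, hw⟩ := exists_wt p X hX hne
  have hP : ∀ i v, (v ∈ X ∧ IsWt v) → (rTh i v ∈ X ∧ IsWt (rTh i v)) := by
    rintro i v ⟨hv, hv2⟩
    refine ⟨?_, rT_wt i hv2⟩
    have : rTh i v = ∑ y : F, (fun x => v (x * aw i y)) := by
      funext x; simp [rTh, rT]
    rw [this]
    exact Submodule.sum_mem _ fun y _ => hX _ _ hv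
  have hQ : ∀ i v, (v ∈ X ∧ IsWt v) → rTh i (rTh i v) = 0 ∨ rTh i (rTh i v) = - rTh i v := by
    rintro i v ⟨hv, hv2⟩
    by_cases hz : v = 0
    · left; simp [hz]
    obtain ⟨n, hn, h⟩ := wt_char hv2 hz i
    have := rT_quad i hv2 hn h
    change rT i (rT i v) = 0 ∨ rT i (rT i v) = - rT i v
    rw [this]
    split_ifs <;> simp
  obtain ⟨w, ⟨hw1, hw2⟩, hw0, hA, hB, hC⟩ := hecke_abs (rTh 0) (rTh 1) (rTh 2) (fun v => v ∈ X ∧ IsWt v)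
    (hP 0) (hP 1) (hP 2) (hQ 0) (hQ 1) (hQ 2) (fun v => rT_braid 0 1 (by simp) v)
    (fun v => rT_braid 1 2 (by simp) v) (fun v => rT_comm v) f ⟨hf, hw⟩ h0
  have hi : ∀ i, rT i w = 0 ∨ rT i w = -w := by
    intro i
    rcases fin3 i with rfl | rfl | rfl
    exacts [hA, hB, hC]
  have key : ∀ i, ∃ m ≤ Fintype.card F - 1, (∀ (c : Fˣ) x, w (x * iota i (sh c)) = (c : F) ^ m * w x) ∧
      ∀ x, ∑ y, w (x * aw i y) = (if m = Fintype.card F - 1 then -1 else 0) * w x := by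
    intro i
    obtain ⟨m, hm, h⟩ := wt_char hw2 hw0 i
    rcases hi i with h1 | h1
    · refine ⟨m, hm.le, h, fun x => ?_⟩
      rw [if_neg hm.ne, zero_mul]
      exact congrFun h1 x
    · refine ⟨Fintype.card F - 1, le_rfl, fun c x => ?_, fun x => ?_⟩
      · have := rT_quad i hw2 hm h
        by_cases hm0 : m = 0
        · subst hm0
          rw [h, FiniteField.pow_card_sub_one_eq_one _ (Units.ne_zero _), pow_zero]
        · rw [if_neg hm0, zero_smul, h1] at this
          have h2 : rT i (-w) = -rT i w := (rTh i).map_neg w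
          rw [h2, h1, neg_neg] at this
          exact absurd this hw0
      · rw [if_pos rfl, neg_one_mul]
        exact congrFun h1 x
  choose n hn h1 h2 using key
  exact ⟨n, hn, w, hw1, hw0, hw2.1, h1, h2⟩

end five

set_option linter.unusedSimpArgs false
set_option linter.unusedSectionVars false
section five
variable {F : Type} [Field F] [Fintype F]

lemma mul_su_L {g : S4 F} {i : Fin 3} (hg : ∀ a b, a < b → ¬ (a = i.castSucc ∧ b = i.succ) → mx g a b = 0)
    (h0 : mx g i.castSucc i.castSucc ≠ 0) : IsL (g * iota i (su (-(mx g i.castSucc i.succ / mx g i.castSucc i.castSucc)))) := by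
  intro a b hab
  rw [mx_mul, iota_coe]
  have hh := hg a b hab
  rcases fin3 i with rfl | rfl | rfl
  · have z0 := hg 0 2 (by decide) (by decide)
    have z1 := hg 0 3 (by decide) (by decide)
    have z2 := hg 1 2 (by decide) (by decide)
    have z3 := hg 1 3 (by decide) (by decide)
    have z4 := hg 2 3 (by decide) (by decide)
    have h0 : mx g 0 0 ≠ 0 := h0
    rw [mul_emb0]
    fin_cases a <;> fin_cases b <;> first | exact absurd hab (by decide) | simp [z0, z1, z2, z3, z4, su]
    field_simp; ring
  · have z0 := hg 0 2 (by decide) (by decide)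
    have z1 := hg 0 3 (by decide) (by decide)
    have z2 := hg 0 1 (by decide) (by decide)
    have z3 := hg 1 3 (by decide) (by decide)
    have z4 := hg 2 3 (by decide) (by decide)
    have h0 : mx g 1 1 ≠ 0 := h0
    rw [mul_emb1]
    fin_cases a <;> fin_cases b <;> first | exact absurd hab (by decide) | simp [z0, z1, z2, z3, z4, su]
    field_simp; ring
  · have z0 := hg 0 2 (by decide) (by decide)
    have z1 := hg 0 3 (by decide) (by decide)
    have z2 := hg 1 2 (by decide) (by decide)
    have z3 := hg 1 3 (by decide) (by decide)
    have z4 := hg 0 1 (by decide) (by decide)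
    have h0 : mx g 2 2 ≠ 0 := h0
    rw [mul_emb2]
    fin_cases a <;> fin_cases b <;> first | exact absurd hab (by decide) | simp [z0, z1, z2, z3, z4, su]
    field_simp; ring

/-- lower triangular except for the entry `(i,i+1)` -/
def IsP (i : Fin 3) (g : S4 F) : Prop := ∀ a b, a < b → ¬ (a = i.castSucc ∧ b = i.succ) → mx g a b = 0

lemma IsP.mul_sl {g : S4 F} {i : Fin 3} (hg : IsP i g) (m : S2 F) : IsP i (g * iota i m) ∧
    mx (g * iota i m) i.castSucc i.castSucc = mx g i.castSucc i.castSucc * mx m 0 0 + mx g i.castSucc i.succ * mx m 1 0 ∧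
    mx (g * iota i m) i.castSucc i.succ = mx g i.castSucc i.castSucc * mx m 0 1 + mx g i.castSucc i.succ * mx m 1 1 := by
  rw [IsP, mx_mul, iota_coe]
  rcases fin3 i with rfl | rfl | rfl
  · have z0 := hg 0 2 (by decide) (by decide)
    have z1 := hg 0 3 (by decide) (by decide)
    have z2 := hg 1 2 (by decide) (by decide)
    have z3 := hg 1 3 (by decide) (by decide)
    have z4 := hg 2 3 (by decide) (by decide)
    rw [mul_emb0]
    refine ⟨?_, rfl, rfl⟩
    intro a b hab hn
    fin_cases a <;> fin_cases b <;> first | exact absurd hab (by decide) | exact absurd (by decide) hn | simp [z0, z1, z2, z3, z4]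
  · have z0 := hg 0 2 (by decide) (by decide)
    have z1 := hg 0 3 (by decide) (by decide)
    have z2 := hg 0 1 (by decide) (by decide)
    have z3 := hg 1 3 (by decide) (by decide)
    have z4 := hg 2 3 (by decide) (by decide)
    rw [mul_emb1]
    refine ⟨?_, rfl, rfl⟩
    intro a b hab hn
    fin_cases a <;> fin_cases b <;> first | exact absurd hab (by decide) | exact absurd (by decide) hn | simp [z0, z1, z2, z3, z4]
  · have z0 := hg 0 2 (by decide) (by decide)
    have z1 := hg 0 3 (by decide) (by decide)
    have z2 := hg 1 2 (by decide) (by decide)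
    have z3 := hg 1 3 (by decide) (by decide)
    have z4 := hg 0 1 (by decide) (by decide)
    rw [mul_emb2]
    refine ⟨?_, rfl, rfl⟩
    intro a b hab hn
    fin_cases a <;> fin_cases b <;> first | exact absurd hab (by decide) | exact absurd (by decide) hn | simp [z0, z1, z2, z3, z4]

lemma IsP.isL {g : S4 F} {i : Fin 3} (hg : IsP i g) (h : mx g i.castSucc i.succ = 0) : IsL g := by
  intro a b hab
  by_cases hh : a = i.castSucc ∧ b = i.succ
  · rw [hh.1, hh.2]; exact h
  · exact hg a b hab hh

lemma van_P {n : Fin 3 → ℕ} {D : S4 F → F} (hD : RC n D) (hv : ∀ b, IsL b → D b = 0) (i : Fin 3)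
    (g : S4 F) (hg : IsP i g) : D g = 0 := by
  have h1 : ∀ g, IsP i g → mx g i.castSucc i.castSucc ≠ 0 → D g = 0 := by
    intro g hg h0
    rw [← hD.U _ (isU_su i (-(mx g i.castSucc i.succ / mx g i.castSucc i.castSucc)))]
    exact hv _ (mul_su_L hg h0)
  by_cases h0 : mx g i.castSucc i.castSucc = 0
  · by_cases h00 : mx g i.castSucc i.succ = 0
    · exact hv _ (hg.isL h00)
    have e : ∀ y, g * iota i sw⁻¹ * aw i y = g * iota i (sl (-y)) := by
      intro y
      rw [aw, mul_assoc, ← map_mul, ← mul_assoc, sw_conj]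
    have hT := hD.T i (g * iota i sw⁻¹)
    simp only [e] at hT
    rw [Fintype.sum_eq_single 0, hv (g * iota i sw⁻¹), mul_zero] at hT
    · have : (sl (-0) : S2 F) = 1 := by
        apply mx_inj; ext a b; fin_cases a <;> fin_cases b <;> simp [sl, Matrix.one_apply]
      rwa [this, map_one, mul_one] at hT
    · obtain ⟨h2, h3, h4⟩ := hg.mul_sl sw⁻¹
      apply h2.isL
      rw [h4, h0, sw_inv]
      simp [sw, sh]
    · intro y hy
      obtain ⟨h2, h3, h4⟩ := hg.mul_sl (sl (-y))
      apply h1 _ h2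
      rw [h3, h0]
      simp [sl, hy, h00]
  · exact h1 g hg h0

lemma iota_L_P (i : Fin 3) (m : S2 F) {b : S4 F} (hb : IsL b) : IsP i (iota i m * b) := by
  intro a c hac hn
  have z0 := hb 0 2 (by decide)
  have z1 := hb 0 3 (by decide)
  have z2 := hb 1 2 (by decide)
  have z3 := hb 1 3 (by decide)
  have z4 := hb 0 1 (by decide)
  have z5 := hb 2 3 (by decide)
  rw [mx_mul, mul4', iota_coe]
  rcases fin3 i with rfl | rfl | rfl <;>
    fin_cases a <;> fin_cases c <;> first | exact absurd hac (by decide) | exact absurd (by decide) hn | simp [emb4, z0, z1, z2, z3, z4, z5]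

lemma D_zero {n : Fin 3 → ℕ} {D : S4 F → F} (hD : RC n D) (hv : ∀ b, IsL b → D b = 0) : D = 0 := by
  let N : Submonoid (S4 F) :=
    { carrier := {k | ∀ D : S4 F → F, RC n D → (∀ b, IsL b → D b = 0) → ∀ b, IsL b → D (k * b) = 0}
      one_mem' := by
        intro D _ h b hb
        rw [one_mul]; exact h b hb
      mul_mem' := by
        intro k l hk hl D hD h b hb
        rw [mul_assoc]
        exact hl (fun x => D (k * x)) (hD.left k) (hk D hD h) b hb }
  have hN : KK F ≤ subOfMon N := by
    refine iSup_le fun i => ?_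
    rintro _ ⟨m, rfl⟩
    intro D hD h b hb
    exact van_P hD h i _ (iota_L_P i m hb)
  funext g
  obtain ⟨k, hk, hl⟩ := LQ (mx g)
  have h1 : g = (g * k) * k⁻¹ := by simp
  have h2 : g * k ∈ subOfMon N := by
    intro D hD h b hb
    exact h _ (IsL.mul hl hb)
  have h3 : g ∈ subOfMon N := by
    rw [h1]; exact mul_mem h2 (inv_mem (hN hk))
  have := h3 D hD hv 1 (fun i j h => Matrix.one_apply_ne h.ne)
  rwa [mul_one] at this

lemma IsL_decomp {b : S4 F} (hb : IsL b) : ∃ l t, l ∈ Lsub F ∧ IsD t ∧ b = l * t := by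
  have hd : mx b 0 0 * mx b 1 1 * mx b 2 2 * mx b 3 3 = 1 := by
    rw [← mx_det b, Matrix.det_of_isLowerTriangular (mx b) (fun i j h => hb i j h), Fin.prod_univ_four]
  have n0 : ∀ i, mx b i i ≠ 0 := by
    intro i h
    have : mx b 0 0 * mx b 1 1 * mx b 2 2 * mx b 3 3 = 0 := by fin_cases i <;> simp at h <;> simp [h]
    rw [hd] at this; exact one_ne_zero this
  let t : S4 F := mkS (Matrix.diagonal fun i => mx b i i) (by rw [Matrix.det_diagonal, Fin.prod_univ_four, hd])
  let t' : S4 F := mkS (Matrix.diagonal fun i => (mx b i i)⁻¹) (by rw [Matrix.det_diagonal, Fin.prod_univ_four, ← mul_inv, ← mul_inv, ← mul_inv, hd, inv_one])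
  have ht : t' * t = 1 := by
    apply mx_inj
    simp only [t, t', mx_mul, mx_mkS, Matrix.diagonal_mul_diagonal, mx_one]
    rw [← Matrix.diagonal_one]; congr 1; funext i; exact inv_mul_cancel₀ (n0 i)
  refine ⟨b * t', t, ?_, ?_, by rw [mul_assoc, ht, mul_one]⟩
  · have e : ∀ i j, mx (b * t') i j = mx b i j * (mx b j j)⁻¹ := by
      intro i j
      simp only [t', mx_mul, mx_mkS, Matrix.mul_diagonal]
    change IsU (trS (b * t'))
    constructor
    · intro i j h
      change mx (b * t') j i = 0
      rw [e, hb j i h, zero_mul]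
    · intro i
      change mx (b * t') i i = 1
      rw [e, mul_inv_cancel₀ (n0 i)]
  · intro i j h
    exact Matrix.diagonal_apply_ne _ h

theorem P5 (p : ℕ) [Fact p.Prime] [CharP F p] (X : Submodule F (S4 F → F))
    (hR : ∀ a, ∀ f ∈ X, (fun x => f (x * a)) ∈ X) (hL : ∀ a, ∀ f ∈ X, (fun x => f (a * x)) ∈ X)
    (hne : X ≠ ⊥) : ∃ n : Fin 3 → ℕ, (∀ i, n i ≤ Fintype.card F - 1) ∧ (fun x : S4 F => ff n (mx x)) ∈ X := by
  obtain ⟨n, hn, f, hf, h0, hRC⟩ := exists_RC p X hR hne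
  refine ⟨n, hn, ?_⟩
  let Y : Submodule F (S4 F → F) :=
    { carrier := {f | f ∈ X ∧ RC n f}
      zero_mem' := ⟨X.zero_mem, by constructor <;> simp⟩
      add_mem' := by
        rintro a b ⟨ha, ha'⟩ ⟨hb, hb'⟩
        refine ⟨X.add_mem ha hb, ?_, ?_, ?_⟩
        · intro u hu x; simp [ha'.U u hu, hb'.U u hu]
        · intro i c x; simp [ha'.H, hb'.H, mul_add]
        · intro i x; simp only [Pi.add_apply, Finset.sum_add_distrib, ha'.T, hb'.T, mul_add]
      smul_mem' := by
        rintro k a ⟨ha, ha'⟩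
        refine ⟨X.smul_mem k ha, ?_, ?_, ?_⟩
        · intro u hu x; simp [ha'.U u hu]
        · intro i c x; simp [ha'.H, mul_left_comm]
        · intro i x; simp only [Pi.smul_apply, smul_eq_mul]; rw [← Finset.mul_sum, ha'.T, mul_left_comm] }
  obtain ⟨D, ⟨hDX, hD⟩, hD0, hDL⟩ := fixpt p (lsub_pgroup (F := F) p) (fun (a : Lsub F) x => (a : S4 F)⁻¹ * x) (fun x => by simp)
    (fun a b x => by simp [mul_assoc]) Y (fun a f hf => ⟨hL _ f hf.1, hf.2.left _⟩) (by
      intro h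
      have : f ∈ Y := ⟨hf, hRC⟩
      rw [h] at this
      exact h0 ((Submodule.mem_bot F).1 this))
  have hff := RC_ff n hn
  have hDl : ∀ l ∈ Lsub F, ∀ x, D (l * x) = D x := by
    intro l hl x
    have := hDL ⟨l, hl⟩ (l * x)
    simpa using this.symm
  have hfl : ∀ l ∈ Lsub F, ∀ x : S4 F, ff n (mx (l * x)) = ff n (mx x) := by
    intro l hl x
    have hl : IsU (trS l) := hl
    have h1 : ∀ i j, i < j → mx l i j = 0 := fun i j h => hl.1 j i h
    have h2 : ∀ i, mx l i i = 1 := hl.2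
    rw [mx_mul, ff_L n h1]
    have : ff n (mx l) = 1 := by simp [ff, dl, h1, h2]
    rw [this, one_mul]
  have hf1 : ff n (mx (1 : S4 F)) = 1 := by simp [ff, dl]
  have hz : D - D 1 • (fun x : S4 F => ff n (mx x)) = 0 := by
    apply D_zero (n := n)
    · constructor
      · intro u hu x
        have := hff.U u hu x
        simp only [Pi.sub_apply, Pi.smul_apply, hD.U u hu, this]
      · intro i c x
        have := hff.H i c x
        simp only [Pi.sub_apply, Pi.smul_apply, hD.H, this, smul_eq_mul]; ring
      · intro i x
        have := hff.T i x
        simp only [Pi.sub_apply, Pi.smul_apply, Finset.sum_sub_distrib, hD.T, smul_eq_mul]; rw [← Finset.mul_sum, this]; ring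
    · intro b hb
      obtain ⟨l, t, hl, ht, rfl⟩ := IsL_decomp hb
      obtain ⟨a, b, c, rfl⟩ := diag_sh ht
      have e : ∀ E : S4 F → F, RC n E → E (iota 0 (sh a) * iota 1 (sh b) * iota 2 (sh c)) = (c : F) ^ n 2 * ((b : F) ^ n 1 * ((a : F) ^ n 0 * E 1)) := by
        intro E hE
        rw [hE.H, hE.H, ← one_mul (iota 0 (sh a)), hE.H]
      simp only [Pi.sub_apply, Pi.smul_apply, hfl l hl, hDl l hl, smul_eq_mul]
      have e1 := e _ hff
      simp only [hf1] at e1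
      rw [e D hD, e1]; ring
  have hD1 : D 1 ≠ 0 := by
    intro h
    rw [h, zero_smul, sub_zero] at hz
    exact hD0 hz
  have : (fun x : S4 F => ff n (mx x)) = (D 1)⁻¹ • D := by
    rw [sub_eq_zero] at hz
    funext x
    have h := congrFun hz x
    simp only [Pi.smul_apply, smul_eq_mul] at h ⊢
    rw [h, inv_mul_cancel_left₀ hD1]
  rw [this]
  exact X.smul_mem _ hDX

end five

set_option linter.unusedSimpArgs false
set_option linter.unusedSectionVars false
section three
variable {F : Type} [Field F] [Fintype F]

noncomputable def io (g : S4 F) : ℕ := orderOf (QuotientGroup.mk g : S4 F ⧸ Subgroup.center (S4 F))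

lemma io_mem {k : ℕ} : k ∈ elementOrders (S4 F ⧸ Subgroup.center (S4 F)) ↔ ∃ g : S4 F, io g = k := by
  constructor
  · rintro ⟨x, rfl⟩
    obtain ⟨g, rfl⟩ := QuotientGroup.mk_surjective x
    exact ⟨g, rfl⟩
  · rintro ⟨g, rfl⟩
    exact ⟨_, rfl⟩

lemma io_dvd_iff (g : S4 F) (k : ℕ) : io g ∣ k ↔ ∃ r : F, mx g ^ k = Matrix.scalar (Fin 4) r := by
  rw [io, orderOf_dvd_iff_pow_eq_one, ← QuotientGroup.mk_pow, QuotientGroup.eq_one_iff, Matrix.SpecialLinearGroup.mem_center_iff]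
  constructor
  · rintro ⟨r, -, h⟩
    refine ⟨r, ?_⟩
    rw [h, ← mx_pow]; rfl
  · rintro ⟨r, h⟩
    refine ⟨r, ?_, ?_⟩
    · have := mx_det (g ^ k)
      rw [mx_pow, h] at this
      simpa using this
    · rw [← h, ← mx_pow]; rfl

variable {K : Type} [Field K] [Algebra F K]

lemma io_dvd_of (g : S4 F) (k : ℕ) (l : K) (h : (mx g).map (algebraMap F K) ^ k = Matrix.scalar (Fin 4) l) : io g ∣ k := by
  rw [io_dvd_iff]
  have h1 : ((mx g) ^ k).map (algebraMap F K) = Matrix.scalar (Fin 4) l := by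
    rw [← h]; exact map_pow (algebraMap F K).mapMatrix (mx g) k
  have h2 : ∀ i j, algebraMap F K ((mx g ^ k) i j) = if i = j then l else 0 := by
    intro i j
    have := congrFun (congrFun h1 i) j
    rw [Matrix.map_apply, Matrix.scalar_apply, Matrix.diagonal_apply] at this
    exact this
  refine ⟨(mx g ^ k) 0 0, ?_⟩
  ext i j
  rw [Matrix.scalar_apply, Matrix.diagonal_apply]
  apply (algebraMap F K).injective
  rw [h2, apply_ite (algebraMap F K), h2, map_zero, if_pos rfl]

lemma map_perm {α : Type*} (f g : Fin 4 → α) (h : Finset.univ.val.map f = Finset.univ.val.map g) :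
    ∃ σ : Equiv.Perm (Fin 4), ∀ i, f i = g (σ i) := by
  classical
  have key : ∀ c : α, Nonempty ({a // f a = c} ≃ {b // g b = c}) := by
    intro c
    refine Fintype.card_eq.1 ?_
    have := congrArg (Multiset.count c) h
    rw [Multiset.count_map, Multiset.count_map] at this
    rw [Fintype.card_subtype, Fintype.card_subtype]
    simpa [Finset.card, eq_comm] using this
  have e := fun c => (key c).some
  refine ⟨Equiv.ofFiberEquiv e, fun i => ?_⟩
  exact (Equiv.ofFiberEquiv_map e i).symm

open Polynomial in
lemma roots_data [IsAlgClosed K] (g : S4 F) : ∃ r : Fin 4 → K, (mx g).charpoly.map (algebraMap F K) = ∏ i, (X - C (r i)) ∧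
    (∃ σ : Equiv.Perm (Fin 4), ∀ i, r i ^ Fintype.card F = r (σ i)) ∧ ∏ i, r i = 1 := by
  set P := (mx g).charpoly.map (algebraMap F K) with hP
  have hs : P.Splits := IsAlgClosed.splits P
  have hm : P.Monic := (Matrix.charpoly_monic _).map _
  have hc : P.roots.card = 4 := by
    rw [← hs.natDegree_eq_card_roots, hP, (Matrix.charpoly_monic _).natDegree_map, Matrix.charpoly_natDegree_eq_dim]; rfl
  obtain ⟨L, hL⟩ := Quot.exists_rep P.roots
  have hL : (L : Multiset K) = P.roots := hL
  have hlen : L.length = 4 := by rw [← hc, ← hL]; rfl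
  let r : Fin 4 → K := fun i => L.get (i.cast hlen.symm)
  have hr : Finset.univ.val.map r = P.roots := by
    rw [← hL, Fin.univ_val_map]
    congr 1
    apply List.ext_getElem
    · simp [hlen]
    · intro n h1 h2
      simp only [List.getElem_ofFn, r, List.get_eq_getElem, Fin.val_cast]
  refine ⟨r, ?_, ?_, ?_⟩
  · have := hs.eq_prod_roots_of_monic hm
    rw [← hr, Multiset.map_map] at this
    exact this
  · have hf : P.map (FiniteField.frobeniusAlgHom F K : K →+* K) = P := by
      rw [hP, Polynomial.map_map]
      congr 1
      ext x
      exact (FiniteField.frobeniusAlgHom F K).commutes x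
    have h2 := hs.roots_map (FiniteField.frobeniusAlgHom F K : K →+* K)
    rw [hf, ← hr, Multiset.map_map] at h2
    exact map_perm _ _ h2.symm
  · have := Matrix.det_eq_prod_roots_charpoly ((mx g).map (algebraMap F K))
    rw [Matrix.charpoly_map, ← hP, ← hr] at this
    have h3 : ((mx g).map (algebraMap F K)).det = 1 := by
      have := RingHom.map_det (algebraMap F K) (mx g)
      rw [mx_det, map_one] at this; exact this.symm
    rw [h3] at this
    exact this.symm

open Polynomial in
lemma ord_lemma (g : S4 F) (r : Fin 4 → K) (h : (mx g).charpoly.map (algebraMap F K) = ∏ i, (X - C (r i)))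
    (p : ℕ) [Fact p.Prime] [CharP K p] (e k : ℕ) (hk : ∀ i j, r i ^ k = r j ^ k)
    (hm : ∀ i : Fin 4, ({j | r j = r i} : Set (Fin 4)).ncard ≤ p ^ e) : io g ∣ k * p ^ e := by
  classical
  have hd : (∏ i, (X - C (r i))) ∣ (X ^ k - C (r 0 ^ k)) ^ (p ^ e) := by
    have h1 : (∏ i, (X - C (r i))) = ∏ b ∈ Finset.univ.image r, (X - C b) ^ (Finset.univ.filter (fun j => r j = b)).card := by
      rw [Finset.prod_comp (fun b => X - C b) r]
    have h2 : (∏ b ∈ Finset.univ.image r, (X - C b) ^ (Finset.univ.filter (fun j => r j = b)).card) ∣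
        ∏ b ∈ Finset.univ.image r, (X - C b) ^ (p ^ e) := by
      refine Finset.prod_dvd_prod_of_dvd _ _ fun b hb => pow_dvd_pow _ ?_
      obtain ⟨i, -, rfl⟩ := Finset.mem_image.1 hb
      refine le_trans (le_of_eq ?_) (hm i)
      rw [← Set.ncard_coe_finset]; congr 1; ext; simp
    rw [h1]
    refine h2.trans ?_
    rw [Finset.prod_pow]
    refine pow_dvd_pow_of_dvd (Finset.prod_dvd_of_coprime ?_ ?_) _
    · intro a _ b _ hab
      exact Polynomial.isCoprime_X_sub_C_of_isUnit_sub (sub_ne_zero.2 hab).isUnit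
    · intro b hb
      obtain ⟨i, -, rfl⟩ := Finset.mem_image.1 hb
      rw [Polynomial.dvd_iff_isRoot]
      simp [hk i 0]
  rw [← h] at hd
  obtain ⟨Q, hQ⟩ := hd
  have h3 := congrArg (aeval ((mx g).map (algebraMap F K))) hQ
  rw [map_mul, ← Matrix.charpoly_map, Matrix.aeval_self_charpoly, zero_mul] at h3
  rw [map_pow, map_sub, aeval_C, map_pow (aeval ((mx g).map (algebraMap F K))), aeval_X] at h3
  rw [sub_pow_char_pow_of_commute (p := p) _ (Algebra.commutes _ _).symm, sub_eq_zero, ← pow_mul] at h3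
  apply io_dvd_of g (k * p ^ e) ((r 0 ^ k) ^ p ^ e)
  rw [h3, ← map_pow]
  rfl

end three

set_option linter.unusedSimpArgs false
set_option linter.unusedSectionVars false
set_option linter.unusedVariables false
section three
variable {F : Type} [Field F] [Fintype F]
variable {K : Type} [Field K] [Algebra F K]

lemma perm_class : ∀ σ : Equiv.Perm (Fin 4), ∃ τ : Equiv.Perm (Fin 4),
    (σ (τ 0) = τ 0 ∧ σ (τ 1) = τ 1 ∧ σ (τ 2) = τ 2 ∧ σ (τ 3) = τ 3) ∨
    (σ (τ 0) = τ 1 ∧ σ (τ 1) = τ 0 ∧ σ (τ 2) = τ 2 ∧ σ (τ 3) = τ 3) ∨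
    (σ (τ 0) = τ 1 ∧ σ (τ 1) = τ 0 ∧ σ (τ 2) = τ 3 ∧ σ (τ 3) = τ 2) ∨
    (σ (τ 0) = τ 1 ∧ σ (τ 1) = τ 2 ∧ σ (τ 2) = τ 0 ∧ σ (τ 3) = τ 3) ∨
    (σ (τ 0) = τ 1 ∧ σ (τ 1) = τ 2 ∧ σ (τ 2) = τ 3 ∧ σ (τ 3) = τ 0) := by
  decide +kernel

def Pat (q : ℕ) (r : Fin 4 → K) : Prop :=
    (r 0 ^ q = r 0 ∧ r 1 ^ q = r 1 ∧ r 2 ^ q = r 2 ∧ r 3 ^ q = r 3) ∨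
    (r 0 ^ q = r 1 ∧ r 1 ^ q = r 0 ∧ r 2 ^ q = r 2 ∧ r 3 ^ q = r 3) ∨
    (r 0 ^ q = r 1 ∧ r 1 ^ q = r 0 ∧ r 2 ^ q = r 3 ∧ r 3 ^ q = r 2) ∨
    (r 0 ^ q = r 1 ∧ r 1 ^ q = r 2 ∧ r 2 ^ q = r 0 ∧ r 3 ^ q = r 3) ∨
    (r 0 ^ q = r 1 ∧ r 1 ^ q = r 2 ∧ r 2 ^ q = r 3 ∧ r 3 ^ q = r 0)

open Polynomial in
lemma roots_pat [IsAlgClosed K] (g : S4 F) : ∃ r : Fin 4 → K, (mx g).charpoly.map (algebraMap F K) = ∏ i, (X - C (r i)) ∧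
    Pat (Fintype.card F) r ∧ r 0 * r 1 * r 2 * r 3 = 1 := by
  obtain ⟨r, h1, ⟨σ, hσ⟩, h3⟩ := roots_data (K := K) g
  obtain ⟨τ, hτ⟩ := perm_class σ
  refine ⟨r ∘ τ, ?_, ?_, ?_⟩
  · rw [h1]; exact (Equiv.prod_comp τ (fun i => X - C (r i))).symm
  · simp only [Pat, Function.comp, hσ]
    rcases hτ with h | h | h | h | h <;> obtain ⟨a, b, c, d⟩ := h <;> simp only [a, b, c, d, true_and, and_self, true_or, or_true]
  · rw [← Equiv.prod_comp τ, Fin.prod_univ_four] at h3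
    exact h3

def Eqk (r : Fin 4 → K) (k : ℕ) : Prop := r 0 ^ k = r 1 ^ k ∧ r 0 ^ k = r 2 ^ k ∧ r 0 ^ k = r 3 ^ k

lemma Eqk.all {r : Fin 4 → K} {k : ℕ} (h : Eqk r k) : ∀ i j, r i ^ k = r j ^ k := by
  obtain ⟨a, b, c⟩ := h
  have : ∀ i, r i ^ k = r 0 ^ k := by
    intro i; fin_cases i
    · rfl
    · exact a.symm
    · exact b.symm
    · exact c.symm
  intro i j; rw [this i, this j]

lemma pat_rep {q m d : ℕ} (hq : 0 < q) (hm : m * d = q - 1) (hd : d ∣ 4) {r : Fin 4 → K} (h : Pat q r) (h1 : r 0 * r 1 * r 2 * r 3 = 1)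
    (hr : ¬ Function.Injective r) : Eqk r (q - 1) ∨ Eqk r (q + 1) ∨ Eqk r ((q + 1) * m) := by
  have hne : r 0 ≠ 0 ∧ r 1 ≠ 0 ∧ r 2 ≠ 0 ∧ r 3 ≠ 0 := by
    refine ⟨?_, ?_, ?_, ?_⟩ <;> (intro h; rw [h] at h1; simp at h1)
  obtain ⟨n0, n1, n2, n3⟩ := hne
  have fx : ∀ x : K, x ≠ 0 → x ^ q = x → x ^ (q - 1) = 1 := by
    intro x hx h
    have : x ^ (q - 1) * x = 1 * x := by rw [← pow_succ, Nat.sub_add_cancel hq, h, one_mul]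
    exact mul_right_cancel₀ hx this
  have k2 : ∀ a c : K, a ≠ 0 → a ^ q = a → a * a * (c * c ^ q) = 1 → a ^ ((q + 1) * m) = c ^ ((q + 1) * m) := by
    intro a c ha h h'
    have e1 : c ^ (q + 1) * (a ^ 2) = 1 := by rw [← h']; ring
    have e2 : a ^ (q + 1) = a ^ 2 := by rw [pow_succ, h, sq]
    have e3 : a ^ (4 * m) = 1 := by
      obtain ⟨e, he⟩ := hd
      rw [he, mul_comm d e, mul_assoc, mul_comm d m, hm, mul_comm, pow_mul, fx a ha h, one_pow]
    have e4 : c ^ ((q + 1) * m) * (a ^ (2 * m)) = a ^ (2 * m) * a ^ (2 * m) := by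
      rw [pow_mul c, pow_mul a 2, ← mul_pow, e1, one_pow, ← pow_mul, ← pow_add, ← e3]; congr 1; ring
    rw [pow_mul a, e2, ← pow_mul]
    exact (mul_right_cancel₀ (pow_ne_zero _ ha) e4).symm
  have hcases : r 0 = r 1 ∨ r 0 = r 2 ∨ r 0 = r 3 ∨ r 1 = r 2 ∨ r 1 = r 3 ∨ r 2 = r 3 := by
    by_contra hc
    push Not at hc
    obtain ⟨a, b, c, d, e, f⟩ := hc
    apply hr
    intro i j hij
    fin_cases i <;> fin_cases j <;> simp_all
  have F1 : r 0 ^ q = r 0 → r 1 ^ q = r 1 → r 2 ^ q = r 2 → r 3 ^ q = r 3 → Eqk r (q - 1) := by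
    intro a b c d
    simp only [Eqk, fx _ n0 a, fx _ n1 b, fx _ n2 c, fx _ n3 d, and_self]
  rcases h with ⟨a, b, c, d⟩ | ⟨a, b, c, d⟩ | ⟨a, b, c, d⟩ | ⟨a, b, c, d⟩ | ⟨a, b, c, d⟩
  · exact Or.inl (F1 a b c d)
  · by_cases h0 : r 0 = r 1
    · exact Or.inl (F1 (a.trans h0.symm) (b.trans h0) c d)
    have h0' : r 0 ^ q ≠ r 0 := fun h => h0 (h.symm.trans a)
    have h1' : r 1 ^ q ≠ r 1 := fun h => h0 (b.symm.trans h)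
    have h23 : r 2 = r 3 := by
      rcases hcases with h | h | h | h | h | h
      · exact absurd h h0
      · rw [h] at h0'; exact absurd c h0'
      · rw [h] at h0'; exact absurd d h0'
      · rw [h] at h1'; exact absurd c h1'
      · rw [h] at h1'; exact absurd d h1'
      · exact h
    right; right
    have e1 := k2 (r 2) (r 0) n2 c (by rw [a]; nth_rewrite 2 [h23]; rw [← h1]; ring)
    have e2 := k2 (r 2) (r 1) n2 c (by rw [b]; nth_rewrite 2 [h23]; rw [← h1]; ring)
    exact ⟨e1.symm.trans e2, e1.symm, by rw [← h23, e1]⟩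
  · have cs : (r 0 = r 1) ∨ (r 2 = r 3) ∨ (r 0 = r 2 ∧ r 1 = r 3) ∨ (r 0 = r 3 ∧ r 1 = r 2) := by
      rcases hcases with h | h | h | h | h | h
      · exact Or.inl h
      · exact Or.inr (Or.inr (Or.inl ⟨h, by rw [← a, ← c, h]⟩))
      · exact Or.inr (Or.inr (Or.inr ⟨h, by rw [← a, ← d, h]⟩))
      · exact Or.inr (Or.inr (Or.inr ⟨by rw [← b, ← c, h], h⟩))
      · exact Or.inr (Or.inr (Or.inl ⟨by rw [← b, ← d, h], h⟩))
      · exact Or.inr (Or.inl h)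
    rcases cs with h | h | ⟨h, h'⟩ | ⟨h, h'⟩
    · right; right
      have a' := a.trans h.symm
      have e1 := k2 (r 0) (r 2) n0 a' (by rw [c]; nth_rewrite 2 [h]; rw [← h1]; ring)
      have e2 := k2 (r 0) (r 3) n0 a' (by rw [d]; nth_rewrite 2 [h]; rw [← h1]; ring)
      exact ⟨by rw [← h], e1, e2⟩
    · right; right
      have c' := c.trans h.symm
      have e1 := k2 (r 2) (r 0) n2 c' (by rw [a]; nth_rewrite 2 [h]; rw [← h1]; ring)
      have e2 := k2 (r 2) (r 1) n2 c' (by rw [b]; nth_rewrite 2 [h]; rw [← h1]; ring)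
      exact ⟨e1.symm.trans e2, e1.symm, by rw [← h, e1]⟩
    · right; left
      simp only [Eqk, pow_succ, a, b, c, d, h, h']
      exact ⟨mul_comm _ _, trivial, mul_comm _ _⟩
    · right; left
      simp only [Eqk, pow_succ, a, b, c, d, h, h']
      exact ⟨mul_comm _ _, mul_comm _ _, trivial⟩
  · left
    have cs : r 0 = r 1 ∧ r 1 = r 2 := by
      clear fx k2 F1 hr hm
      rcases hcases with h | h | h | h | h | h <;> grind
    obtain ⟨x, y⟩ := cs
    exact F1 (a.trans x.symm) (b.trans y.symm) (c.trans (x.trans y)) d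
  · have cs : (r 0 = r 1 ∧ r 1 = r 2 ∧ r 2 = r 3) ∨ (r 0 = r 2 ∧ r 1 = r 3) := by
      clear fx k2 F1 hr hm
      rcases hcases with h | h | h | h | h | h <;> grind
    rcases cs with ⟨h, h', h''⟩ | ⟨h, h'⟩
    · left
      exact F1 (a.trans h.symm) (b.trans h'.symm) (c.trans h''.symm) (d.trans (h.trans (h'.trans h'')))
    · right; left
      rw [← h] at b
      simp only [Eqk, pow_succ, ← h, ← h', a, b]
      exact ⟨mul_comm _ _, trivial, mul_comm _ _⟩

lemma pat_12 {q : ℕ} (hq : 0 < q) {r : Fin 4 → K} (h : Pat q r) (h1 : r 0 * r 1 * r 2 * r 3 = 1) : Eqk r (q ^ 12 - 1) := by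
  have key : ∀ x : K, x ≠ 0 → x ^ q ^ 12 = x → x ^ (q ^ 12 - 1) = 1 := by
    intro x hx h
    have : x ^ (q ^ 12 - 1) * x = 1 * x := by rw [← pow_succ, Nat.sub_add_cancel (Nat.pos_of_ne_zero (by positivity)), h, one_mul]
    exact mul_right_cancel₀ hx this
  have hne : r 0 ≠ 0 ∧ r 1 ≠ 0 ∧ r 2 ≠ 0 ∧ r 3 ≠ 0 := by
    refine ⟨?_, ?_, ?_, ?_⟩ <;> (intro h; rw [h] at h1; simp at h1)
  obtain ⟨n0, n1, n2, n3⟩ := hne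
  have e : q ^ 12 = q * q * q * q * q * q * q * q * q * q * q * q := by ring
  have : r 0 ^ q ^ 12 = r 0 ∧ r 1 ^ q ^ 12 = r 1 ∧ r 2 ^ q ^ 12 = r 2 ∧ r 3 ^ q ^ 12 = r 3 := by
    simp only [e, pow_mul]
    rcases h with ⟨a, b, c, d⟩ | ⟨a, b, c, d⟩ | ⟨a, b, c, d⟩ | ⟨a, b, c, d⟩ | ⟨a, b, c, d⟩ <;> simp only [a, b, c, d, and_self]
  obtain ⟨a, b, c, d⟩ := this
  rw [Eqk, key _ n0 a, key _ n1 b, key _ n2 c, key _ n3 d]; simp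

lemma fiber4 (r : Fin 4 → K) (i : Fin 4) : ({j | r j = r i} : Set (Fin 4)).ncard ≤ 4 := by
  have := Set.ncard_le_ncard (Set.subset_univ {j | r j = r i})
  simpa [Set.ncard_univ] using this

lemma io_PS (p : ℕ) [Fact p.Prime] [CharP F p] (hp : 3 ≤ p) {m d : ℕ} (hm : m * d = Fintype.card F - 1) (hd : d ∣ 4) (g : S4 F) :
    ¬ p ∣ io g ∨ io g ∣ p * (Fintype.card F - 1) ∨ io g ∣ p * (Fintype.card F + 1) ∨ io g ∣ p * ((Fintype.card F + 1) * m) ∨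
      io g ∣ p ^ 2 ∧ (5 ≤ p → io g ∣ p) := by
  obtain ⟨r, h, hp1, hp2⟩ := roots_pat (K := AlgebraicClosure F) g
  have : CharP (AlgebraicClosure F) p := charP_of_injective_algebraMap (algebraMap F _).injective p
  have hq : 0 < Fintype.card F := Fintype.card_pos
  by_cases hi : Function.Injective r
  · left
    have := ord_lemma g r h p 0 _ (pat_12 hq hp1 hp2).all (by
      intro i
      have : {j | r j = r i} = {i} := by ext j; simp [hi.eq_iff]
      rw [this]; simp)
    intro hpd
    have h3 := hpd.trans this
    rw [pow_zero, mul_one] at h3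
    obtain ⟨n, hn⟩ := FiniteField.card F p
    have h4 : p ∣ Fintype.card F ^ 12 := by
      rw [hn.2]; exact dvd_pow (dvd_pow_self p n.2.ne') (by norm_num)
    have h5 := Nat.dvd_sub h4 h3
    rw [Nat.sub_sub_self (Nat.one_le_pow _ _ hq)] at h5
    have := Nat.le_of_dvd one_pos h5
    omega
  right
  by_cases he : Eqk r 1
  · right; right; right
    refine ⟨?_, fun h5 => ?_⟩
    · have := ord_lemma g r h p 2 1 he.all (fun i => (fiber4 r i).trans (by nlinarith))
      simpa using this
    · have := ord_lemma g r h p 1 1 he.all (fun i => (fiber4 r i).trans (by rw [pow_one]; omega))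
      simpa using this
  have h3 : ∀ k, Eqk r k → io g ∣ p * k := by
    intro k hk
    have := ord_lemma g r h p 1 k hk.all (by
      intro i
      have h4 := fiber4 r i
      rcases h4.lt_or_eq with h5 | h5
      · rw [pow_one]; omega
      · exfalso
        have : {j | r j = r i} = Set.univ := Set.eq_of_subset_of_ncard_le (Set.subset_univ _) (by rw [h5]; simp [Set.ncard_univ])
        have h6 : ∀ j, r j = r i := fun j => by
          have : j ∈ {j | r j = r i} := by rw [this]; trivial
          exact this
        apply he
        simp only [Eqk, pow_one, h6, and_self])
    rwa [pow_one, mul_comm] at this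
  rcases pat_rep hq hm hd hp1 hp2 hi with h4 | h4 | h4
  · exact Or.inl (h3 _ h4)
  · exact Or.inr (Or.inl (h3 _ h4))
  · exact Or.inr (Or.inr (Or.inl (h3 _ h4)))

lemma io_NS (p : ℕ) [Fact p.Prime] [CharP F p] (hp : 3 ≤ p) {m d' M : ℕ} (hm : m * d' = Fintype.card F - 1) 
    (hM : M * d' = Fintype.card F ^ 3 - 1) (hd : d' ∣ Fintype.card F ^ 2 + Fintype.card F + 2) (hd2 : d' ∣ (Fintype.card F ^ 2 + 1) * (Fintype.card F + 1)) (g : S4 F) :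
    io g ∣ p ^ 2 * (Fintype.card F ^ 2 - 1) ∨ io g ∣ p ^ 2 * M ∨ (∃ k, k * d' = (Fintype.card F ^ 2 + 1) * (Fintype.card F + 1) ∧ io g ∣ p ^ 2 * k) := by
  obtain ⟨r, h, hp1, h1⟩ := roots_pat (K := AlgebraicClosure F) g
  have : CharP (AlgebraicClosure F) p := charP_of_injective_algebraMap (algebraMap F _).injective p
  have hq : 0 < Fintype.card F := Fintype.card_pos
  have h3 : ∀ k, Eqk r k → io g ∣ p ^ 2 * k := by
    intro k hk
    have := ord_lemma g r h p 2 k hk.all (fun i => (fiber4 r i).trans (by nlinarith))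
    rwa [mul_comm] at this
  have hne : r 0 ≠ 0 ∧ r 1 ≠ 0 ∧ r 2 ≠ 0 ∧ r 3 ≠ 0 := by
    refine ⟨?_, ?_, ?_, ?_⟩ <;> (intro h; rw [h] at h1; simp at h1)
  clear h
  obtain ⟨n0, n1, n2, n3⟩ := hne
  generalize Fintype.card F = q at *
  have fx : ∀ n, ∀ x : AlgebraicClosure F, x ≠ 0 → x ^ q ^ n = x → x ^ (q ^ n - 1) = 1 := by
    intro n x hx h
    have : x ^ (q ^ n - 1) * x = 1 * x := by rw [← pow_succ, Nat.sub_add_cancel (Nat.one_le_pow _ _ hq), h, one_mul]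
    exact mul_right_cancel₀ hx this
  have A : r 0 ^ q ^ 2 = r 0 → r 1 ^ q ^ 2 = r 1 → r 2 ^ q ^ 2 = r 2 → r 3 ^ q ^ 2 = r 3 → Eqk r (q ^ 2 - 1) := by
    intro a b c d
    simp only [Eqk, fx 2 _ n0 a, fx 2 _ n1 b, fx 2 _ n2 c, fx 2 _ n3 d, and_self]
  rcases hp1 with ⟨a, b, c, d⟩ | ⟨a, b, c, d⟩ | ⟨a, b, c, d⟩ | ⟨a, b, c, d⟩ | ⟨a, b, c, d⟩
  · left; apply h3; apply A <;> simp only [sq, pow_mul, a, b, c, d]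
  · left; apply h3; apply A <;> simp only [sq, pow_mul, a, b, c, d]
  · left; apply h3; apply A <;> simp only [sq, pow_mul, a, b, c, d]
  · right; left; apply h3
    obtain ⟨e, he⟩ := hd
    have key : ∀ x, x ≠ 0 → x ^ q ^ 3 = x → x * x ^ q * x ^ q ^ 2 * r 3 = 1 → r 3 ^ M = x ^ M := by
      intro x hx h hh
      have e1 : x ^ (q ^ 2 + q + 2) * r 3 = x := by
        calc _ = (x * x ^ q * x ^ q ^ 2 * r 3) * x := by ring
          _ = x := by rw [hh, one_mul]
      have e2 : x ^ ((q ^ 2 + q + 2) * M) = 1 := by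
        have : (q ^ 2 + q + 2) * M = (q ^ 3 - 1) * e := by rw [he, ← hM]; ring
        rw [this, pow_mul, fx 3 x hx h, one_pow]
      calc r 3 ^ M = x ^ ((q ^ 2 + q + 2) * M) * r 3 ^ M := by rw [e2, one_mul]
        _ = x ^ M := by rw [pow_mul, ← mul_pow, e1]
    have l3 : q ^ 3 = q * q * q := by ring
    have k0 := key (r 0) n0 (by simp only [l3, pow_mul, a, b, c]) (by simp only [sq, pow_mul, a, b, c]; exact h1)
    have k1 := key (r 1) n1 (by simp only [l3, pow_mul, a, b, c]) (by simp only [sq, pow_mul, a, b, c]; rw [← h1]; ring)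
    have k2 := key (r 2) n2 (by simp only [l3, pow_mul, a, b, c]) (by simp only [sq, pow_mul, a, b, c]; rw [← h1]; ring)
    exact ⟨k0.symm.trans k1, k0.symm.trans k2, k0.symm⟩
  · right; right
    obtain ⟨k, hk⟩ := hd2
    refine ⟨k, by rw [hk, mul_comm], h3 _ ?_⟩
    have key : ∀ x : AlgebraicClosure F, x ≠ 0 → x * x ^ q * x ^ q ^ 2 * x ^ q ^ 3 = 1 → (x ^ q) ^ k = x ^ k := by
      intro x hx hh
      have e2 : x ^ ((q - 1) * k) = 1 := by
        have : (q - 1) * k = (1 + q + q ^ 2 + q ^ 3) * m := by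
          rw [← hm, mul_assoc, ← hk]; ring
        rw [this, pow_mul]
        have : x ^ (1 + q + q ^ 2 + q ^ 3) = 1 := by simp only [pow_add, pow_one]; exact hh
        rw [this, one_pow]
      rw [← pow_mul]
      have : q * k = (q - 1) * k + k := by
        nth_rewrite 1 [← Nat.sub_add_cancel hq]; ring
      rw [this, pow_add, e2, one_mul]
    have l3 : q ^ 3 = q * q * q := by ring
    have k0 := key (r 0) n0 (by simp only [l3, sq, pow_mul, a, b, c]; exact h1)
    have k1 := key (r 1) n1 (by simp only [l3, sq, pow_mul, a, b, c, d]; rw [← h1]; ring)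
    have k2 := key (r 2) n2 (by simp only [l3, sq, pow_mul, a, b, c, d]; rw [← h1]; ring)
    rw [a] at k0
    rw [b] at k1
    rw [c] at k2
    exact ⟨k0.symm, (k1.trans k0).symm, (k2.trans (k1.trans k0)).symm⟩
end three

set_option linter.unusedSimpArgs false
set_option linter.unusedSectionVars false
set_option linter.unusedVariables false
section three
variable {F : Type} [Field F] [Fintype F]
variable {K : Type} [Field K] [Algebra F K]

open Polynomial in
lemma fix_mem (x : K) (h : x ^ Fintype.card F = x) : ∃ a : F, algebraMap F K a = x := by
  classical
  have h1 : 1 < Fintype.card F := Fintype.one_lt_card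
  have hne : (X ^ Fintype.card F - X : K[X]) ≠ 0 := FiniteField.X_pow_card_sub_X_ne_zero K h1
  have hs : Finset.univ.image (algebraMap F K) ⊆ (X ^ Fintype.card F - X : K[X]).roots.toFinset := by
    intro y hy
    obtain ⟨a, -, rfl⟩ := Finset.mem_image.1 hy
    rw [Multiset.mem_toFinset, Polynomial.mem_roots hne]
    simp [← map_pow, FiniteField.pow_card]
  have he := Finset.eq_of_subset_of_card_le hs (by
    rw [Finset.card_image_of_injective _ (algebraMap F K).injective, Finset.card_univ]
    refine (Multiset.toFinset_card_le _).trans ((Polynomial.card_roots' _).trans ?_)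
    rw [FiniteField.X_pow_card_sub_X_natDegree_eq K h1])
  have hx : x ∈ (X ^ Fintype.card F - X : K[X]).roots.toFinset := by
    rw [Multiset.mem_toFinset, Polynomial.mem_roots hne]
    simp [h]
  rw [← he] at hx
  obtain ⟨a, -, ha⟩ := Finset.mem_image.1 hx
  exact ⟨a, ha⟩

open Polynomial in
lemma companion (t : Fin 4 → K) (hinj : Function.Injective t) (hσ : ∃ σ : Equiv.Perm (Fin 4), ∀ i, t i ^ Fintype.card F = t (σ i))
    (hprod : t 0 * t 1 * t 2 * t 3 = 1) :
    ∃ (s : S4 F) (V W : Matrix (Fin 4) (Fin 4) K), V * W = 1 ∧ W * V = 1 ∧ (mx s).map (algebraMap F K) = W * diagonal t * V := by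
  obtain ⟨σ, hσ⟩ := hσ
  set P : K[X] := ∏ i, (X - C (t i)) with hP
  have hf : P.map (FiniteField.frobeniusAlgHom F K : K →+* K) = P := by
    rw [hP, Polynomial.map_prod, ← Equiv.prod_comp σ (fun i => X - C (t i))]
    refine Finset.prod_congr rfl fun i _ => ?_
    rw [Polynomial.map_sub, Polynomial.map_X, Polynomial.map_C, ← hσ i]; rfl
  have hc : ∀ n, ∃ a : F, algebraMap F K a = P.coeff n := by
    intro n
    apply fix_mem
    conv_rhs => rw [← hf, Polynomial.coeff_map]
    rfl
  choose c hc using hc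
  have hm : P.Monic := Polynomial.monic_prod_of_monic _ _ fun i _ => monic_X_sub_C _
  have hn : P.natDegree = 4 := by
    rw [hP, Polynomial.natDegree_prod_of_monic _ _ fun i _ => monic_X_sub_C _]; simp
  have hc0 : c 0 = 1 := by
    apply (algebraMap F K).injective
    rw [hc, coeff_zero_eq_eval_zero, hP, Polynomial.eval_prod, Fin.prod_univ_four, map_one, ← hprod]
    simp
  have hroot : ∀ i, t i ^ 4 = -(P.coeff 0 + P.coeff 1 * t i + P.coeff 2 * t i ^ 2 + P.coeff 3 * t i ^ 3) := by
    intro i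
    have h1 : P.eval (t i) = 0 := by
      rw [hP, Polynomial.eval_prod]
      exact Finset.prod_eq_zero (Finset.mem_univ i) (by simp)
    have h4 : P.coeff 4 = 1 := by rw [← hn]; exact hm
    rw [Polynomial.eval_eq_sum_range, hn] at h1
    simp only [Finset.sum_range_succ, Finset.sum_range_zero, h4] at h1
    linear_combination h1
  refine ⟨mkS !![0, 0, 0, -c 0; 1, 0, 0, -c 1; 0, 1, 0, -c 2; 0, 0, 1, -c 3] ?_, vandermonde t, (vandermonde t)⁻¹, ?_, ?_, ?_⟩
  · rw [hc0]; simp [Matrix.det_succ_row_zero, Fin.sum_univ_succ, Fin.succAbove]; norm_num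
  · exact Matrix.mul_nonsing_inv _ (det_vandermonde_ne_zero_iff.2 hinj).isUnit
  · exact Matrix.nonsing_inv_mul _ (det_vandermonde_ne_zero_iff.2 hinj).isUnit
  · have hu : IsUnit (vandermonde t).det := (det_vandermonde_ne_zero_iff.2 hinj).isUnit
    have : vandermonde t * ((mx (mkS !![0, 0, 0, -c 0; 1, 0, 0, -c 1; 0, 1, 0, -c 2; 0, 0, 1, -c 3] (by rw [hc0]; simp [Matrix.det_succ_row_zero, Fin.sum_univ_succ, Fin.succAbove]; norm_num) : S4 F)).map (algebraMap F K)) = diagonal t * vandermonde t := by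
      ext i j
      rw [Matrix.mul_apply, Matrix.diagonal_mul, Fin.sum_univ_four]
      simp only [vandermonde_apply, mx_mkS, Matrix.map_apply]
      fin_cases j <;> simp [hc, hroot]
      · ring
      · ring
      · linear_combination -hroot i
    rw [Matrix.mul_assoc, ← this, ← Matrix.mul_assoc, Matrix.nonsing_inv_mul _ hu, Matrix.one_mul]

lemma cj_pow {V W D : Matrix (Fin 4) (Fin 4) K} (h : V * W = 1) (h' : W * V = 1) (k : ℕ) : (W * D * V) ^ k = W * D ^ k * V := by
  induction k with
  | zero => simp [h']
  | succ k ih =>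
    rw [pow_succ, ih, pow_succ]
    calc W * D ^ k * V * (W * D * V) = W * D ^ k * (V * W) * D * V := by simp only [Matrix.mul_assoc]
      _ = _ := by rw [h]; simp only [Matrix.mul_assoc, Matrix.mul_one]

lemma io_comp {s : S4 F} {V W : Matrix (Fin 4) (Fin 4) K} {t : Fin 4 → K} (h : V * W = 1) (h' : W * V = 1)
    (hs : (mx s).map (algebraMap F K) = W * diagonal t * V) (k : ℕ) : io s ∣ k ↔ ∀ i j, t i ^ k = t j ^ k := by
  constructor
  · intro hk
    obtain ⟨r, hr⟩ := (io_dvd_iff s k).1 hk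
    have h1 : ((mx s).map (algebraMap F K)) ^ k = Matrix.scalar (Fin 4) (algebraMap F K r) := by
      have := congrArg (algebraMap F K).mapMatrix hr
      rw [map_pow] at this
      refine this.trans ?_
      ext i j
      simp [Matrix.scalar_apply, Matrix.diagonal_apply, apply_ite (algebraMap F K)]
    rw [hs, cj_pow h h', Matrix.diagonal_pow] at h1
    have h2 : diagonal (t ^ k) = Matrix.scalar (Fin 4) (algebraMap F K r) := by
      calc diagonal (t ^ k) = (V * W) * diagonal (t ^ k) * (V * W) := by rw [h]; simp
        _ = V * (W * diagonal (t ^ k) * V) * W := by simp only [Matrix.mul_assoc]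
        _ = _ := by rw [h1, ← (Matrix.scalar_commute _ (fun _ => Commute.all _ _) V).eq, Matrix.mul_assoc, h, Matrix.mul_one]
    have h3 : ∀ i, t i ^ k = algebraMap F K r := by
      intro i
      have := congrFun (congrFun h2 i) i
      simpa using this
    intro i j; rw [h3, h3]
  · intro ht
    apply io_dvd_of s k (t 0 ^ k)
    rw [hs, cj_pow h h', Matrix.diagonal_pow]
    have : diagonal (t ^ k) = Matrix.scalar (Fin 4) (t 0 ^ k) := by
      ext i j
      simp [Matrix.scalar_apply, Matrix.diagonal_apply, ht i 0]
    rw [this, ← (Matrix.scalar_commute _ (fun _ => Commute.all _ _) W).eq, Matrix.mul_assoc, h', Matrix.mul_one]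

end three

set_option linter.unusedSimpArgs false
set_option linter.unusedSectionVars false
set_option linter.unusedVariables false
section four
variable {F : Type} [Field F]

def col0 (x : Fin 3 → F) : S4 F := mkS !![1,0,0,0; x 0,1,0,0; x 1,0,1,0; x 2,0,0,1]
  (by simp [Matrix.det_succ_row_zero, Fin.sum_univ_succ])

lemma col0_add (x y : Fin 3 → F) : col0 (x + y) = col0 x * col0 y := by
  apply mx_inj
  simp only [mx_mul, col0, mx_mkS, mul4]
  apply ext4 <;> simp

def Xc : S4 F := mkS !![0,0,0,-1;1,0,0,0;0,1,0,0;0,0,1,0]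
  (by simp [Matrix.det_succ_row_zero, Fin.sum_univ_succ, Fin.succAbove]; norm_num)
def col1 (a b : F) : S4 F := mkS !![1,0,0,0; 0,1,0,0; 0,a,1,0; 0,b,0,1]
  (by simp [Matrix.det_succ_row_zero, Fin.sum_univ_succ])

lemma conj_mem {G : Type*} [Group G] {N : Subgroup G} [N.Normal] {x y g : G} (h : g * x = y * g) (hx : x ∈ N) : y ∈ N := by
  have : y = g * x * g⁻¹ := by rw [h, mul_inv_cancel_right]
  rw [this]; exact Subgroup.Normal.conj_mem inferInstance x hx g

lemma normal_top [Fintype F] (N : Subgroup (S4 F)) [N.Normal] (h : ∀ x, col0 x ∈ N) : N = ⊤ := by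
  have hl0 : ∀ y : F, iota 0 (sl y) ∈ N := by
    intro y
    have : iota 0 (sl y) = col0 ![y, 0, 0] := by
      apply mx_inj
      simp only [iota_coe, col0, sl, mx_mkS, emb4]
      apply ext4 <;> simp
    rw [this]; exact h _
  have hl1 : ∀ y : F, iota 1 (sl y) ∈ N := by
    intro y
    refine conj_mem (g := Xc) ?_ (hl0 y)
    apply mx_inj
    simp only [mx_mul, iota_coe, Xc, sl, mx_mkS, emb4, mul4]
    apply ext4 <;> simp
  have hl2 : ∀ y : F, iota 2 (sl y) ∈ N := by
    intro y
    refine conj_mem (g := Xc) ?_ (hl1 y)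
    apply mx_inj
    simp only [mx_mul, iota_coe, Xc, sl, mx_mkS, emb4, mul4]
    apply ext4 <;> simp
  have hl : ∀ i, ∀ y : F, iota i (sl y) ∈ N := by
    intro i
    rcases fin3 i with rfl | rfl | rfl
    · exact hl0
    · exact hl1
    · exact hl2
  have hu : ∀ i, ∀ y : F, iota i (su y) ∈ N := by
    intro i y
    refine conj_mem (g := iota i sw) ?_ (hl i (-y))
    rw [← map_mul, ← map_mul, ← sw_conj]; congr 1; group
  have h2' : ∀ i, ∀ m : S2 F, mx m 1 0 ≠ 0 → iota i m ∈ N := by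
    intro i m h10
    have hd := mx_det m
    rw [Matrix.det_fin_two] at hd
    have : m = su ((mx m 0 0 - 1) / mx m 1 0) * sl (mx m 1 0) * su ((mx m 1 1 - 1) / mx m 1 0) := by
      apply mx_inj
      simp only [mx_mul, su, sl, mx_mkS]
      ext a b
      fin_cases a <;> fin_cases b <;> simp [Matrix.mul_apply, Fin.sum_univ_two]
      · field_simp; ring
      · field_simp; linear_combination -hd
      · field_simp; ring
    rw [this, map_mul, map_mul]
    exact N.mul_mem (N.mul_mem (hu _ _) (hl _ _)) (hu _ _)
  have h2 : ∀ i, ∀ m : S2 F, iota i m ∈ N := by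
    intro i m
    by_cases h10 : mx m 1 0 = 0
    · have : iota i m = (iota i (sl 1))⁻¹ * iota i (sl 1 * m) := by rw [map_mul]; group
      rw [this]
      refine N.mul_mem (N.inv_mem (hl _ _)) (h2' i _ ?_)
      have hd := mx_det m
      rw [Matrix.det_fin_two, h10, mul_zero, sub_zero] at hd
      have : mx (sl 1 * m) 1 0 = mx m 0 0 + mx m 1 0 := by
        simp [sl, Matrix.mul_apply, Fin.sum_univ_two]
      rw [this, h10, add_zero]
      exact left_ne_zero_of_mul_eq_one hd
    · exact h2' i m h10
  have hK : KK F ≤ N := by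
    refine iSup_le fun i => ?_
    rintro _ ⟨m, rfl⟩
    exact h2 i m
  have hc1 : ∀ a b : F, col1 a b ∈ N := by
    intro a b
    refine conj_mem (g := Xc) ?_ (h ![a, b, 0])
    apply mx_inj
    simp only [mx_mul, Xc, col0, col1, mx_mkS, mul4]
    apply ext4 <;> simp
  rw [eq_top_iff]
  rintro g -
  obtain ⟨k, hk, hkl⟩ := LQ (mx g)
  have hb : IsL (g * k) := fun i j hij => hkl i j hij
  obtain ⟨l, t, hl', ht, e⟩ := IsL_decomp hb
  obtain ⟨c0, c1, c2, rfl⟩ := diag_sh ht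
  have hlN : l ∈ N := by
    have hlu : IsU (trS l) := hl'
    have e1 : ∀ i j, i < j → mx l i j = 0 := fun i j hij => hlu.1 j i hij
    have e2 : ∀ i, mx l i i = 1 := hlu.2
    have : l = col0 ![mx l 1 0, mx l 2 0, mx l 3 0] * col1 (mx l 2 1) (mx l 3 1) * iota 2 (sl (mx l 3 2)) := by
      apply mx_inj
      conv_lhs => rw [eta4 (mx l)]
      simp only [mx_mul, iota_coe, col0, col1, sl, mx_mkS, emb4, mul4, e2, e1 0 1 (by decide), e1 0 2 (by decide), e1 0 3 (by decide), e1 1 2 (by decide), e1 1 3 (by decide), e1 2 3 (by decide)]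
      apply ext4 <;> simp
    rw [this]
    exact N.mul_mem (N.mul_mem (h _) (hc1 _ _)) (hl _ _)
  have : g = (l * (iota 0 (sh c0) * iota 1 (sh c1) * iota 2 (sh c2))) * k⁻¹ := by rw [← e]; group
  rw [this]
  exact N.mul_mem (N.mul_mem hlN (N.mul_mem (N.mul_mem (h2 _ _) (h2 _ _)) (h2 _ _))) (N.inv_mem (hK hk))

end four

set_option linter.unusedSimpArgs false
set_option linter.unusedSectionVars false
set_option linter.unusedVariables false
section four
variable {F : Type} [Field F] [Fintype F]

lemma smul_coprime {V : Type} [AddCommGroup V] {r n : ℕ} (h : Nat.Coprime r n) (z : V) (h1 : r • z = 0) (h2 : n • z = 0) : z = 0 := by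
  have a := addOrderOf_dvd_of_nsmul_eq_zero h1
  have b := addOrderOf_dvd_of_nsmul_eq_zero h2
  have := Nat.dvd_gcd a b
  rw [h] at this
  exact AddMonoid.addOrderOf_eq_one_iff.1 (Nat.dvd_one.1 this)

lemma Q_triv (c : S4 F) (N : ℕ) (hN : 0 < N) (hrow : ∀ j, j ≠ 0 → mx c 0 j = 0)
    (hker : ∀ i, 0 < i → i < N → ∀ w : Fin 4 → F, w 0 = 0 → mx (c ^ i) *ᵥ w = mx (c ^ i) 0 0 • w → w = 0)
    {V : Type} [AddCommGroup V] (ρ : S4 F →* AddMonoid.End V) {r : ℕ} (hr : Nat.Coprime r (Fintype.card F)) (hV : ∀ v : V, r • v = 0)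
    (hsum : ∀ x : Fin 3 → F, ∀ v, ∑ i ∈ Finset.range N, ρ ((col0 x * c * (col0 x)⁻¹) ^ i) v = 0) : ∀ x v, ρ (col0 x) v = v := by
  classical
  have hrow' : ∀ i, ∀ j, j ≠ 0 → mx (c ^ i) 0 j = 0 := by
    intro i
    induction i with
    | zero => intro j hj; simp [Matrix.one_apply, hj.symm]
    | succ i ih =>
      intro j hj
      rw [pow_succ', mx_mul, Matrix.mul_apply, Fin.sum_univ_four, hrow 1 (by decide), hrow 2 (by decide), hrow 3 (by decide), ih j hj]
      simp
  have hE : ∀ y v, ρ (col0 y) (∑ x, ρ (col0 x) v) = ∑ x, ρ (col0 x) v := by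
    intro y v
    rw [map_sum, ← Equiv.sum_comp (Equiv.addLeft y) (fun x => ρ (col0 x) v)]
    refine Finset.sum_congr rfl fun x _ => ?_
    rw [Equiv.coe_addLeft, col0_add, map_mul]; rfl
  have hcj : ∀ i, 0 < i → i < N → ∀ v, ∑ x, ρ ((col0 x * c * (col0 x)⁻¹) ^ i) v = ∑ x, ρ (col0 x) (ρ (c ^ i) v) := by
    intro i hi hiN v
    set A := c ^ i with hA
    have h0 : ∀ j, j ≠ 0 → mx A 0 j = 0 := hrow' i
    have h1 := h0 1 (by decide)
    have h2 := h0 2 (by decide)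
    have h3 := h0 3 (by decide)
    have ha : mx A 0 0 ≠ 0 := by
      intro h
      have := mx_det A
      rw [Matrix.det_eq_zero_of_row_eq_zero 0 (by intro j; by_cases hj : j = 0; · rw [hj, h]
                                                  · exact h0 j hj)] at this
      exact zero_ne_one this
    let D : (Fin 3 → F) → (Fin 3 → F) := fun x j => (mx A j.succ 1 * x 0 + mx A j.succ 2 * x 1 + mx A j.succ 3 * x 2) / mx A 0 0
    have e1 : ∀ x, A * col0 x = col0 (D x) * A := by
      intro x
      apply mx_inj
      simp only [mx_mul, col0, mx_mkS]
      rw [eta4 (mx A)]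
      simp only [mul4, h1, h2, h3, D]
      apply ext4 <;> simp <;> field_simp <;> ring_nf <;> rfl
    have hinj : Function.Injective (fun x => x - D x) := by
      intro x y hxy
      have hD : D (x - y) = x - y := by
        have : D (x - y) = D x - D y := by
          ext j; simp only [D, Pi.sub_apply]; ring
        rw [this]
        have hxy : x - D x = y - D y := hxy
        have := sub_eq_sub_iff_sub_eq_sub.1 hxy
        exact this.symm
      have := hker i hi hiN (Fin.cons 0 (x - y)) rfl (by
        ext j
        have e : ∀ j : Fin 3, mx A j.succ 1 * (x - y) 0 + mx A j.succ 2 * (x - y) 1 + mx A j.succ 3 * (x - y) 2 = mx A 0 0 * (x - y) j := by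
          intro j
          have := congrFun hD j
          simp only [D] at this
          rw [div_eq_iff ha] at this
          rw [this, mul_comm]
        rw [← hA]
        refine Fin.cases ?_ (fun j => ?_) j
        · simp [Matrix.mulVec, dotProduct, Fin.sum_univ_succ, h0]
        · have := e j
          simpa [Matrix.mulVec, dotProduct, Fin.sum_univ_succ, add_assoc] using this)
      have h4 : x - y = 0 := by
        ext j
        have := congrFun this j.succ
        simpa using this
      exact sub_eq_zero.1 h4
    have hbij : Function.Bijective (fun x => x - D x) := Finite.injective_iff_bijective.1 hinj
    rw [← (Equiv.ofBijective _ hbij).sum_comp (fun x => ρ (col0 x) (ρ A v))]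
    refine Finset.sum_congr rfl fun x _ => ?_
    have e2 : (col0 x * c * (col0 x)⁻¹) ^ i = col0 (x - D x) * A := by
      rw [_root_.conj_pow, ← hA, mul_inv_eq_iff_eq_mul, mul_assoc, e1, ← mul_assoc, ← col0_add, sub_add_cancel]
    rw [e2, map_mul]; rfl
  intro y v
  have key : (Fintype.card (Fin 3 → F)) • v = - ∑ x, ρ (col0 x) (∑ i ∈ Finset.Ico 1 N, ρ (c ^ i) v) := by
    have h1 : ∑ x : Fin 3 → F, ∑ i ∈ Finset.range N, ρ ((col0 x * c * (col0 x)⁻¹) ^ i) v = 0 :=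
      Finset.sum_eq_zero fun x _ => hsum x v
    rw [Finset.sum_comm, Finset.range_eq_Ico, Finset.sum_eq_sum_Ico_succ_bot hN] at h1
    have h2 : ∑ x : Fin 3 → F, ρ ((col0 x * c * (col0 x)⁻¹) ^ 0) v = Fintype.card (Fin 3 → F) • v := by
      simp only [pow_zero, map_one, AddMonoid.End.coe_one, id, Finset.sum_const, Finset.card_univ]
    rw [h2, zero_add] at h1
    rw [eq_neg_iff_add_eq_zero, ← h1]
    congr 1
    simp only [map_sum]
    rw [Finset.sum_comm]
    refine Finset.sum_congr rfl fun i hi => ?_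
    rw [Finset.mem_Ico] at hi
    exact (hcj i (by omega) hi.2 v).symm
  have h3 : (Fintype.card (Fin 3 → F)) • (ρ (col0 y) v - v) = 0 := by
    rw [smul_sub, ← map_nsmul, key, map_neg, hE, sub_self]
  rw [Fintype.card_fun] at h3
  exact sub_eq_zero.1 (smul_coprime (Nat.Coprime.pow_right _ hr) _ (hV _) h3)

end four

set_option linter.unusedSimpArgs false
set_option linter.unusedSectionVars false
set_option linter.unusedVariables false
section four
variable {F : Type} [Field F] [Fintype F]
variable {K : Type} [Field K] [Algebra F K]

lemma exists_prim (p : ℕ) [Fact p.Prime] [CharP F p] (n : ℕ) (hn : ¬ p ∣ n) : ∃ z : AlgebraicClosure F, IsPrimitiveRoot z n := by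
  have : CharP (AlgebraicClosure F) p := charP_of_injective_algebraMap (algebraMap F _).injective p
  have : NeZero (n : AlgebraicClosure F) := ⟨by rw [Ne, CharP.cast_eq_zero_iff (AlgebraicClosure F) p]; exact hn⟩
  exact HasEnoughRootsOfUnity.exists_primitiveRoot _ n

lemma io_conj (g c : S4 F) : io (g * c * g⁻¹) = io c := by
  have := orderOf_injective (MulAut.conj (QuotientGroup.mk g : S4 F ⧸ Subgroup.center (S4 F))).toMonoidHom (MulAut.conj _).injective (QuotientGroup.mk c)
  rw [io, io, ← this]; rfl

lemma p_ndvd (p : ℕ) [Fact p.Prime] [CharP F p] {n k : ℕ} (e : Fintype.card F * k = n + 1 ∨ Fintype.card F * k + 1 = n) : ¬ p ∣ n := by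
  intro h
  obtain ⟨a, ha⟩ := FiniteField.card F p
  have h4 : p ∣ Fintype.card F * k := by
    rw [ha.2]; exact Dvd.dvd.mul_right (dvd_pow_self p a.2.ne') k
  have h1 : p ∣ 1 := by
    rcases e with e | e
    · rw [e] at h4; exact (Nat.dvd_add_right h).1 h4
    · rw [← e] at h; exact (Nat.dvd_add_right h4).1 h
  have := (Fact.out : p.Prime).two_le
  have := Nat.le_of_dvd one_pos h1
  omega

lemma T4ex (p : ℕ) [Fact p.Prime] [CharP F p] {B : ℕ} (hB : 2 * B = Fintype.card F ^ 2 + 1) (hq : 3 ≤ Fintype.card F) :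
    ∃ (z : AlgebraicClosure F) (s : S4 F) (V W : Matrix (Fin 4) (Fin 4) (AlgebraicClosure F)), IsPrimitiveRoot z B ∧ V * W = 1 ∧ W * V = 1 ∧
      (mx s).map (algebraMap F _) = W * diagonal ![z ^ Fintype.card F, z⁻¹ ^ Fintype.card F, z, z⁻¹] * V ∧ io s = B := by
  have hB' : ¬ p ∣ B := fun h => p_ndvd (F := F) p (k := Fintype.card F) (Or.inr (by rw [hB, sq])) (Dvd.dvd.mul_left h 2)
  obtain ⟨z, hz⟩ := exists_prim (F := F) p B hB'
  set q := Fintype.card F with hqq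
  have hz0 : z ≠ 0 := hz.ne_zero (by nlinarith)
  have hsq : (z ^ q) ^ q = z⁻¹ := by
    apply eq_inv_of_mul_eq_one_left
    rw [← pow_mul, ← pow_succ, ← sq, ← hB, mul_comm, pow_mul, hz.pow_eq_one, one_pow]
  have hsq' : (z⁻¹ ^ q) ^ q = z := by rw [inv_pow, inv_pow, hsq, inv_inv]
  have hodd : B % 2 = 1 := by
    have : q % 4 = 0 ∨ q % 4 = 1 ∨ q % 4 = 2 ∨ q % 4 = 3 := by omega
    have h4 : q ^ 2 % 4 = (q % 4) ^ 2 % 4 := Nat.pow_mod q 2 4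
    rcases this with h | h | h | h <;> rw [h] at h4 <;> omega
  have cop : ∀ k, B ∣ 2 * k → B ∣ k := fun k h => (Nat.Coprime.dvd_of_dvd_mul_left (Nat.coprime_two_right.2 (Nat.odd_iff.2 hodd)) h)
  have hBq : q + 1 < B := by nlinarith
  have hne : z ≠ z⁻¹ := by
    intro h
    have : z ^ 2 = 1 := by rw [sq]; nth_rewrite 2 [h]; exact mul_inv_cancel₀ hz0
    have := Nat.le_of_dvd (by norm_num) ((hz.pow_eq_one_iff_dvd 2).1 this)
    omega
  have hne2 : z ^ q ≠ z := by
    intro h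
    apply hne
    have := hsq
    rw [h, h] at this; exact this
  have hne3 : z ^ q ≠ z⁻¹ := by
    intro h
    have : z ^ (q + 1) = 1 := by rw [pow_succ, h, inv_mul_cancel₀ hz0]
    have := Nat.le_of_dvd (by omega) ((hz.pow_eq_one_iff_dvd _).1 this)
    omega
  have hne4 : z ^ q ≠ z⁻¹ ^ q := by
    intro h
    rw [← hsq] at hne
    apply hne
    rw [h, hsq']
  obtain ⟨s, V, W, h1, h2, h3⟩ := companion (F := F) (K := AlgebraicClosure F) ![z ^ q, z⁻¹ ^ q, z, z⁻¹] (by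
      have a1 : z⁻¹ ^ q ≠ z := by rw [inv_pow]; intro h; apply hne3; rw [← inv_inv (z ^ q), h]
      have a2 : z⁻¹ ^ q ≠ z⁻¹ := by rw [inv_pow]; intro h; apply hne2; exact inv_injective h
      intro i j hij
      fin_cases i <;> fin_cases j <;> first | rfl | exact absurd hij hne4 | exact absurd hij hne4.symm | exact absurd hij hne | exact absurd hij hne.symm | exact absurd hij hne2 | exact absurd hij hne2.symm | exact absurd hij hne3 | exact absurd hij hne3.symm | exact absurd hij a1 | exact absurd hij a1.symm | exact absurd hij a2 | exact absurd hij a2.symm)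
    ⟨Equiv.swap 0 3 * Equiv.swap 3 1 * Equiv.swap 1 2, by
      intro i
      have : ∀ i, (Equiv.swap 0 3 * Equiv.swap 3 1 * Equiv.swap 1 2 : Equiv.Perm (Fin 4)) i = ![3, 2, 0, 1] i := by decide
      rw [this]
      fin_cases i
      · exact hsq
      · exact hsq'
      · rfl
      · rfl⟩ (by
      change z ^ q * z⁻¹ ^ q * z * z⁻¹ = 1
      rw [inv_pow, mul_assoc, mul_inv_cancel₀ hz0, mul_one, mul_inv_cancel₀ (pow_ne_zero _ hz0)])
  refine ⟨z, s, V, W, hz, h1, h2, h3, ?_⟩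
  apply Nat.dvd_antisymm
  · rw [io_comp h1 h2 h3]
    have : ∀ i, ![z ^ q, z⁻¹ ^ q, z, z⁻¹] i ^ B = 1 := by
      have e := hz.pow_eq_one
      have e' : z⁻¹ ^ B = 1 := by rw [inv_pow, e, inv_one]
      intro i; fin_cases i
      · change (z ^ q) ^ B = 1; rw [← pow_mul, mul_comm, pow_mul, e, one_pow]
      · change (z⁻¹ ^ q) ^ B = 1; rw [← pow_mul, mul_comm, pow_mul, e', one_pow]
      · exact e
      · exact e'
    intro i j; rw [this, this]
  · have := (io_comp h1 h2 h3 (io s)).1 dvd_rfl 2 3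
    have h5 : z ^ io s = z⁻¹ ^ io s := this
    apply cop
    rw [← hz.pow_eq_one_iff_dvd, two_mul, pow_add]
    nth_rewrite 2 [h5]
    rw [inv_pow, mul_inv_cancel₀ (pow_ne_zero _ hz0)]

lemma gcd_lem {q m d M k : ℕ} (hq : q = m * d + 1) (hd : d = 4 ∨ d = 2 ∧ m % 2 = 1) (hM : M * d = q ^ 3 - 1) (h : q ^ 3 - 1 ∣ (q ^ 2 + q + 2) * k) : M ∣ k := by
  have hd0 : 0 < d := by omega
  have h1 : q ^ 3 - 1 ∣ (q - 1) * k := by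
    have e : (q - 1) * ((q ^ 2 + q + 2) * k) = (q ^ 3 - 1) * k + (q - 1) * k := by
      obtain ⟨a, rfl⟩ : ∃ a, q = a + 1 := ⟨m * d, hq⟩
      have : (a + 1) ^ 3 - 1 = a ^ 3 + 3 * a ^ 2 + 3 * a := by
        rw [show (a + 1) ^ 3 = a ^ 3 + 3 * a ^ 2 + 3 * a + 1 by ring]; rfl
      rw [this, Nat.add_sub_cancel]; ring
    have := Dvd.dvd.mul_left h (q - 1)
    rw [e] at this
    exact (Nat.dvd_add_right (Dvd.intro k rfl)).1 this
  have h2 : q ^ 3 - 1 ∣ 4 * k := by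
    have e : (q ^ 2 + q + 2) * k = (q + 2) * ((q - 1) * k) + 4 * k := by
      obtain ⟨a, rfl⟩ : ∃ a, q = a + 1 := ⟨m * d, hq⟩
      rw [Nat.add_sub_cancel]; ring
    rw [e] at h
    exact (Nat.dvd_add_right (Dvd.dvd.mul_left h1 (q + 2))).1 h
  have h3 : q ^ 3 - 1 ∣ d * k := by
    rcases hd with rfl | ⟨rfl, hm⟩
    · exact h2
    · obtain ⟨b, hb⟩ : ∃ b, m = 2 * b + 1 := ⟨m / 2, by omega⟩
      have e : (q - 1) * k = b * (4 * k) + 2 * k := by rw [hq, hb, Nat.add_sub_cancel]; ring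
      rw [e] at h1
      exact (Nat.dvd_add_right (Dvd.dvd.mul_left h2 b)).1 h1
  rw [← hM, mul_comm d k] at h3
  exact Nat.dvd_of_mul_dvd_mul_right hd0 h3

end four

set_option linter.unusedSimpArgs false
set_option linter.unusedSectionVars false
set_option linter.unusedVariables false
section four
variable {F : Type} [Field F] [Fintype F]
variable {K : Type} [Field K] [Algebra F K]

lemma hker_lem (c : S4 F) {V W : Matrix (Fin 4) (Fin 4) K} {t : Fin 4 → K} (h : V * W = 1) (h' : W * V = 1)
    (hs : (mx c).map (algebraMap F K) = W * diagonal t * V) (hrow : ∀ j, j ≠ 0 → mx c 0 j = 0)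
    (ht : ∀ l, l ≠ 3 → t l ^ Fintype.card F ≠ t l) (i : ℕ) (hi : ∀ l, l ≠ 3 → t l ^ i ≠ t 3 ^ i)
    (w : Fin 4 → F) (hw : w 0 = 0) (he : mx (c ^ i) *ᵥ w = mx (c ^ i) 0 0 • w) : w = 0 := by
  have hcW : (mx c).map (algebraMap F K) * W = W * diagonal t := by
    rw [hs, Matrix.mul_assoc, h, Matrix.mul_one]
  have r0 : ∀ l, W 0 l * (t l - algebraMap F K (mx c 0 0)) = 0 := by
    intro l
    have := congrFun (congrFun hcW 0) l
    rw [Matrix.mul_apply, Matrix.mul_diagonal, Fin.sum_univ_four] at this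
    simp only [Matrix.map_apply, hrow 1 (by decide), hrow 2 (by decide), hrow 3 (by decide), map_zero, zero_mul, add_zero] at this
    linear_combination -this
  have W0 : ∀ l, l ≠ 3 → W 0 l = 0 := by
    intro l hl
    rcases mul_eq_zero.1 (r0 l) with h | h
    · exact h
    · exfalso
      apply ht l hl
      rw [sub_eq_zero.1 h, ← map_pow, FiniteField.pow_card]
  have hWV : W 0 3 * V 3 0 = 1 := by
    have := congrFun (congrFun h' 0) 0
    rw [Matrix.mul_apply, Fin.sum_univ_four, W0 0 (by decide), W0 1 (by decide), W0 2 (by decide)] at this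
    simpa using this
  have hW3 : W 0 3 ≠ 0 := left_ne_zero_of_mul_eq_one hWV
  have hc00 : algebraMap F K (mx c 0 0) = t 3 := by
    rcases mul_eq_zero.1 (r0 3) with h | h
    · exact absurd h hW3
    · exact (sub_eq_zero.1 h).symm
  have hpow : ∀ n, mx (c ^ n) 0 0 = mx c 0 0 ^ n := by
    intro n
    induction n with
    | zero => simp
    | succ n ih =>
      rw [pow_succ', mx_mul, Matrix.mul_apply, Fin.sum_univ_four, hrow 1 (by decide), hrow 2 (by decide), hrow 3 (by decide), ih, pow_succ']
      ring
  have hci : (mx (c ^ i)).map (algebraMap F K) = W * diagonal (t ^ i) * V := by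
    rw [← Matrix.diagonal_pow, ← cj_pow h h', ← hs, mx_pow]
    exact map_pow (algebraMap F K).mapMatrix (mx c) i
  set w' : Fin 4 → K := fun j => algebraMap F K (w j) with hw'
  have he' : (mx (c ^ i)).map (algebraMap F K) *ᵥ w' = (t 3 ^ i) • w' := by
    ext j
    have := congrArg (algebraMap F K) (congrFun he j)
    rw [hpow, Pi.smul_apply, smul_eq_mul, map_mul, map_pow, hc00] at this
    rw [Pi.smul_apply, smul_eq_mul, ← this]
    simp [Matrix.mulVec, dotProduct, map_sum, hw']
  set y := V *ᵥ w' with hy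
  have hwy : w' = W *ᵥ y := by rw [hy, Matrix.mulVec_mulVec, h', Matrix.one_mulVec]
  have hy' : ∀ l, t l ^ i * y l = t 3 ^ i * y l := by
    intro l
    have := congrArg (fun u => V *ᵥ u) he'
    simp only [hci, Matrix.mulVec_mulVec, Matrix.mulVec_smul] at this
    rw [← Matrix.mul_assoc, ← Matrix.mul_assoc, h, Matrix.one_mul, ← Matrix.mulVec_mulVec, ← hy] at this
    have := congrFun this l
    rw [Matrix.mulVec_diagonal] at this
    exact this
  have y0 : ∀ l, l ≠ 3 → y l = 0 := by
    intro l hl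
    have := hy' l
    rw [← sub_eq_zero, ← sub_mul] at this
    exact (mul_eq_zero.1 this).resolve_left (sub_ne_zero.2 (hi l hl))
  have y3 : y 3 = 0 := by
    have := congrFun hwy 0
    rw [hw'] at this
    simp only [hw, map_zero, Matrix.mulVec, dotProduct, Fin.sum_univ_four, W0 0 (by decide), W0 1 (by decide), W0 2 (by decide), zero_mul, zero_add] at this
    exact (mul_eq_zero.1 this.symm).resolve_left hW3
  have hyz : y = 0 := by
    ext l; by_cases hl : l = 3
    · rw [hl, y3]; rfl
    · exact y0 l hl
  rw [hyz, Matrix.mulVec_zero] at hwy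
  ext j
  apply (algebraMap F K).injective
  rw [Pi.zero_apply, map_zero]
  exact congrFun hwy j

lemma T3ex (p : ℕ) [Fact p.Prime] [CharP F p] {m d M : ℕ} (hm : Fintype.card F = m * d + 1) (hd : d = 4 ∨ d = 2 ∧ m % 2 = 1)
    (hM : M * d = Fintype.card F ^ 3 - 1) (hq : 3 ≤ Fintype.card F) :
    ∃ c : S4 F, io c = M ∧ (∀ j, j ≠ 0 → mx c 0 j = 0) ∧
    (∀ i, 0 < i → i < M → ∀ w : Fin 4 → F, w 0 = 0 → mx (c ^ i) *ᵥ w = mx (c ^ i) 0 0 • w → w = 0) := by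
  have hB' : ¬ p ∣ Fintype.card F ^ 3 - 1 := p_ndvd (F := F) p (k := Fintype.card F ^ 2) (Or.inl (by
    rw [Nat.sub_add_cancel (Nat.one_le_pow _ _ (by omega))]; ring))
  obtain ⟨z, hz⟩ := exists_prim (F := F) p _ hB'
  set q := Fintype.card F with hqq
  have h27 : q ^ 2 < q ^ 3 := Nat.pow_lt_pow_right (by omega) (by norm_num)
  have h9 : q * q = q ^ 2 := by ring
  have h99 : 3 * q ≤ q ^ 2 := by nlinarith
  have hz0 : z ≠ 0 := hz.ne_zero (by omega)
  have hz3 : z ^ (q ^ 3) = z := by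
    have : q ^ 3 = (q ^ 3 - 1) + 1 := by omega
    rw [this, pow_succ, hz.pow_eq_one, one_mul]
  set t : Fin 4 → AlgebraicClosure F := ![z, z ^ q, z ^ (q * q), (z * z ^ q * z ^ (q * q))⁻¹] with ht
  have c0 : t 0 ^ q = t 1 := rfl
  have c1 : t 1 ^ q = t 2 := by change (z ^ q) ^ q = z ^ (q * q); rw [← pow_mul]
  have c2 : t 2 ^ q = t 0 := by
    change (z ^ (q * q)) ^ q = z
    rw [← pow_mul, show q * q * q = q ^ 3 by ring]; exact hz3
  have c3 : t 3 ^ q = t 3 := by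
    change (t 0 * t 1 * t 2)⁻¹ ^ q = (t 0 * t 1 * t 2)⁻¹
    rw [inv_pow, mul_pow, mul_pow, c0, c1, c2]; congr 1; ring
  have h01 : t 0 ≠ t 1 := by
    intro h
    have h : z = z ^ q := h
    have : z ^ (q - 1) = 1 := by
      have : z ^ (q - 1) * z = 1 * z := by rw [← pow_succ, Nat.sub_add_cancel (by omega), ← h, one_mul]
      exact mul_right_cancel₀ hz0 this
    have := Nat.le_of_dvd (by omega) ((hz.pow_eq_one_iff_dvd _).1 this)
    omega
  have tprod : t 0 * t 1 * t 2 * t 3 = 1 := by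
    have : t 0 * t 1 * t 2 ≠ 0 := mul_ne_zero (mul_ne_zero hz0 (pow_ne_zero _ hz0)) (pow_ne_zero _ hz0)
    exact mul_inv_cancel₀ this
  have d12 : t 1 ≠ t 2 := by grind
  have d02 : t 0 ≠ t 2 := by grind
  have d03 : t 0 ≠ t 3 := by grind
  have d13 : t 1 ≠ t 3 := by grind
  have d23 : t 2 ≠ t 3 := by grind
  obtain ⟨s, V, W, h1, h2, h3⟩ := companion (F := F) t (by
      intro i j hij
      fin_cases i <;> fin_cases j <;> first | rfl | exact absurd hij h01 | exact absurd hij h01.symm | exact absurd hij d12 | exact absurd hij d12.symm | exact absurd hij d02 | exact absurd hij d02.symm | exact absurd hij d03 | exact absurd hij d03.symm | exact absurd hij d13 | exact absurd hij d13.symm | exact absurd hij d23 | exact absurd hij d23.symm)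
    ⟨Equiv.swap 0 1 * Equiv.swap 1 2, by
      intro i
      have : ∀ i, (Equiv.swap 0 1 * Equiv.swap 1 2 : Equiv.Perm (Fin 4)) i = ![1, 2, 0, 3] i := by decide
      rw [this]
      fin_cases i
      · exact c0
      · exact c1
      · exact c2
      · exact c3⟩ tprod
  have hd2 : d ∣ q ^ 2 + q + 2 := by
    rcases hd with rfl | ⟨rfl, hmm⟩
    · exact ⟨4 * m ^ 2 + 3 * m + 1, by rw [hm]; ring⟩
    · exact ⟨2 * m ^ 2 + 3 * m + 2, by rw [hm]; ring⟩
  have all_of : ∀ k, (∃ l, l ≠ 3 ∧ t l ^ k = t 3 ^ k) → M ∣ k := by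
    intro k hk
    have e0 : t 0 ^ k = t 3 ^ k := by
      obtain ⟨l, hl, e⟩ := hk
      have st : ∀ a b : AlgebraicClosure F, a ^ q = b → a ^ k = t 3 ^ k → b ^ k = t 3 ^ k := by
        intro a b hab h
        rw [← hab, ← pow_mul, mul_comm, pow_mul, h, ← pow_mul, mul_comm, pow_mul, c3]
      fin_cases l
      · exact e
      · exact st _ _ c2 (st _ _ c1 e)
      · exact st _ _ c2 e
      · exact absurd rfl hl
    have e1 : z ^ ((q ^ 2 + q + 2) * k) = 1 := by
      have e2 : z ^ (q ^ 2 + q + 2) = (t 0 * t 1 * t 2) * t 0 := by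
        change _ = (z * z ^ q * z ^ (q * q)) * z
        ring
      have e3 : t 3 ^ k ≠ 0 := pow_ne_zero _ (right_ne_zero_of_mul_eq_one tprod)
      apply mul_right_cancel₀ e3
      rw [pow_mul, e2, mul_pow, mul_right_comm, ← mul_pow, tprod, one_pow, one_mul, one_mul, e0]
    exact gcd_lem hm hd hM ((hz.pow_eq_one_iff_dvd _).1 e1)
  have hio : io s = M := by
    apply Nat.dvd_antisymm
    · rw [io_comp h1 h2 h3]
      obtain ⟨e, he⟩ := hd2
      have st : ∀ x : AlgebraicClosure F, x ≠ 0 → x ^ (q ^ 3) = x → x * x ^ q * x ^ (q * q) * t 3 = 1 → x ^ M = t 3 ^ M := by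
        intro x hx h hh
        have e1 : x ^ (q ^ 2 + q + 2) * t 3 = x := by
          calc _ = (x * x ^ q * x ^ (q * q) * t 3) * x := by ring
            _ = x := by rw [hh, one_mul]
        have e3 : x ^ (q ^ 3 - 1) = 1 := by
          have : x ^ (q ^ 3 - 1) * x = 1 * x := by rw [← pow_succ, Nat.sub_add_cancel (by omega), h, one_mul]
          exact mul_right_cancel₀ hx this
        have e2 : x ^ ((q ^ 2 + q + 2) * M) = 1 := by
          have : (q ^ 2 + q + 2) * M = (q ^ 3 - 1) * e := by rw [he, ← hM]; ring
          rw [this, pow_mul, e3, one_pow]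
        calc x ^ M = (x ^ (q ^ 2 + q + 2) * t 3) ^ M := by rw [e1]
          _ = t 3 ^ M := by rw [mul_pow, ← pow_mul, e2, one_mul]
      have l3 : q ^ 3 = q * q * q := by ring
      have s0 := st (t 0) hz0 (by simp only [l3, pow_mul, c0, c1, c2]) (by simp only [pow_mul, c0, c1, c2]; exact tprod)
      have s1 := st (t 1) (pow_ne_zero _ hz0) (by simp only [l3, pow_mul, c0, c1, c2]) (by simp only [pow_mul, c0, c1, c2]; rw [← tprod]; ring)
      have s2 := st (t 2) (pow_ne_zero _ hz0) (by simp only [l3, pow_mul, c0, c1, c2]) (by simp only [pow_mul, c0, c1, c2]; rw [← tprod]; ring)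
      have : ∀ i, t i ^ M = t 3 ^ M := by
        intro i; fin_cases i
        · exact s0
        · exact s1
        · exact s2
        · rfl
      intro i j; rw [this i, this j]
    · exact all_of _ ⟨0, by decide, (io_comp h1 h2 h3 (io s)).1 dvd_rfl 0 3⟩
  obtain ⟨nu, hnu⟩ := fix_mem (F := F) (t 3) c3
  have hdet : (mx s - Matrix.scalar (Fin 4) nu).det = 0 := by
    apply (algebraMap F (AlgebraicClosure F)).injective
    rw [RingHom.map_det, map_sub, RingHom.mapMatrix_apply, h3]
    have : (algebraMap F (AlgebraicClosure F)).mapMatrix (Matrix.scalar (Fin 4) nu) = W * diagonal (fun _ => t 3) * V := by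
      have e : (diagonal fun _ : Fin 4 => t 3) = Matrix.scalar (Fin 4) (t 3) := rfl
      rw [e, ← (Matrix.scalar_commute _ (fun _ => Commute.all _ _) W).eq, Matrix.mul_assoc, h2, Matrix.mul_one, ← hnu]
      ext i j
      simp [Matrix.diagonal_apply, apply_ite (algebraMap F (AlgebraicClosure F))]
    rw [this, ← Matrix.sub_mul, ← Matrix.mul_sub, Matrix.diagonal_sub, Matrix.det_mul, Matrix.det_mul, Matrix.det_diagonal, Fin.prod_univ_four]
    simp
  obtain ⟨f, hf0, hf⟩ := Matrix.exists_vecMul_eq_zero_iff.2 hdet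
  obtain ⟨k, -, hk⟩ := LQ (Matrix.of fun _ => f : Matrix (Fin 4) (Fin 4) F)
  have hfk : ∀ j, j ≠ 0 → (f ᵥ* mx k) j = 0 := by
    intro j hj
    exact hk 0 j (Fin.pos_of_ne_zero hj)
  have hfs : f ᵥ* mx s = nu • f := by
    rw [Matrix.vecMul_sub, sub_eq_zero] at hf
    rw [hf]
    ext j; simp [mul_comm]
  have hx : (f ᵥ* mx k) 0 ≠ 0 := by
    intro h
    apply hf0
    have : f ᵥ* mx k = 0 := by
      ext j; by_cases hj : j = 0
      · rw [hj, h]; rfl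
      · exact hfk j hj
    have := congrArg (fun u => u ᵥ* mx k⁻¹) this
    simp only [Matrix.vecMul_vecMul, ← mx_mul, mul_inv_cancel, mx_one, Matrix.vecMul_one, Matrix.zero_vecMul] at this
    exact this
  have hrow : ∀ j, j ≠ 0 → mx (k⁻¹ * s * k⁻¹⁻¹) 0 j = 0 := by
    intro j hj
    have e : (f ᵥ* mx k) ᵥ* mx (k⁻¹ * s * k⁻¹⁻¹) = nu • (f ᵥ* mx k) := by
      rw [Matrix.vecMul_vecMul, ← mx_mul]
      have : k * (k⁻¹ * s * k⁻¹⁻¹) = s * k := by group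
      rw [this, mx_mul, ← Matrix.vecMul_vecMul, hfs, Matrix.smul_vecMul]
    have := congrFun e j
    rw [Pi.smul_apply, hfk j hj, smul_zero] at this
    simp only [Matrix.vecMul, dotProduct, Fin.sum_univ_four] at this hfk hx
    rw [hfk 1 (by decide), hfk 2 (by decide), hfk 3 (by decide)] at this
    simp only [zero_mul, add_zero] at this
    exact (mul_eq_zero.1 this).resolve_left hx
  refine ⟨k⁻¹ * s * k⁻¹⁻¹, by rw [io_conj, hio], hrow, ?_⟩
  have mm : ∀ a b : S4 F, (mx (a * b)).map (algebraMap F (AlgebraicClosure F)) = (mx a).map (algebraMap F _) * (mx b).map (algebraMap F _) :=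
    fun a b => map_mul (algebraMap F (AlgebraicClosure F)).mapMatrix (mx a) (mx b)
  have m1 : (mx (1 : S4 F)).map (algebraMap F (AlgebraicClosure F)) = 1 := map_one (algebraMap F (AlgebraicClosure F)).mapMatrix
  intro i hi hiM w hw hww
  refine hker_lem (K := AlgebraicClosure F) (k⁻¹ * s * k⁻¹⁻¹) (V := V * (mx k).map (algebraMap F _)) (W := (mx k⁻¹).map (algebraMap F _) * W) (t := t) ?_ ?_ ?_ hrow ?_ i ?_ w hw hww
  · rw [Matrix.mul_assoc, ← Matrix.mul_assoc _ _ W, ← mm, mul_inv_cancel, m1, Matrix.one_mul, h1]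
  · rw [Matrix.mul_assoc, ← Matrix.mul_assoc W, h2, Matrix.one_mul, ← mm, inv_mul_cancel, m1]
  · rw [mm, mm, h3, inv_inv]; simp only [Matrix.mul_assoc]
  · intro l hl
    fin_cases l
    · exact fun h => h01 (h.symm.trans c0)
    · exact fun h => d12 (h.symm.trans c1)
    · exact fun h => d02 (c2.symm.trans h)
    · exact absurd rfl hl
  · intro l hl he
    have := Nat.le_of_dvd hi (all_of i ⟨l, hl, he⟩)
    omega

end four

set_option linter.unusedSimpArgs false
set_option linter.unusedSectionVars false
set_option linter.unusedVariables false
section four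
variable {F : Type} [Field F] [Fintype F]

lemma ndvd_r2 {q r : ℕ} (hr : r.Prime) (h1 : r ∣ q ^ 3 - 1) (h2 : r ∣ q + 1) (hq : 3 ≤ q) : r = 2 := by
  have hq3 : 1 ≤ q ^ 3 := Nat.one_le_pow _ _ (by omega)
  have h3 : r ∣ q ^ 3 + 1 := h2.trans ⟨q ^ 2 - q + 1, by
    have : q ≤ q ^ 2 := by nlinarith
    zify [this]; ring⟩
  have : r ∣ 2 := by
    have := Nat.dvd_sub h3 h1
    rwa [show q ^ 3 + 1 - (q ^ 3 - 1) = 2 by omega] at this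
  exact (Nat.prime_dvd_prime_iff_eq hr Nat.prime_two).1 this

lemma rM_notin (p : ℕ) [Fact p.Prime] [CharP F p] (hp : 3 ≤ p) {m d M r : ℕ} (hm : Fintype.card F = m * d + 1) (hd : d = 4 ∨ d = 2 ∧ m % 2 = 1)
    (hM : M * d = Fintype.card F ^ 3 - 1) (hq : 3 ≤ Fintype.card F) (hr : r.Prime) (hrp : r ≠ p) :
    r * M ∉ elementOrders (S4 F ⧸ Subgroup.center (S4 F)) := by
  have hp' : p.Prime := Fact.out
  set q := Fintype.card F with hqd
  intro h
  obtain ⟨g, hg⟩ := io_mem.1 h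
  have hq3 : 1 ≤ q ^ 3 := Nat.one_le_pow _ _ (by omega)
  have hpM : Nat.Coprime M (p ^ 2) := by
    apply Nat.Coprime.pow_right
    apply Nat.Coprime.symm
    rw [hp'.coprime_iff_not_dvd]
    intro hh
    exact p_ndvd (F := F) p (n := q ^ 3 - 1) (k := q ^ 2) (Or.inl (by rw [← hqd, Nat.sub_add_cancel hq3]; ring)) (hM ▸ hh.mul_right d)
  have h5 : 3 * q ^ 2 ≤ q ^ 3 := by nlinarith [sq_nonneg q]
  have h6 : 3 * q ≤ q ^ 2 := by nlinarith
  have M0 : 0 < M := by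
    rcases Nat.eq_zero_or_pos M with h | h
    · subst h; omega
    · exact h
  have hd2 : d ∣ q ^ 2 + q + 2 := by
    rcases hd with rfl | ⟨rfl, hmm⟩
    · exact ⟨4 * m ^ 2 + 3 * m + 1, by rw [hm]; ring⟩
    · exact ⟨2 * m ^ 2 + 3 * m + 2, by rw [hm]; ring⟩
  have hd3 : d ∣ (q ^ 2 + 1) * (q + 1) := by
    rcases hd with rfl | ⟨rfl, hmm⟩
    · exact ⟨(8 * m ^ 2 + 4 * m + 1) * (2 * m + 1), by rw [hm]; ring⟩
    · exact ⟨(4 * m ^ 2 + 4 * m + 2) * (m + 1), by rw [hm]; ring⟩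
  rcases io_NS (F := F) p hp (m := m) (d' := d) (M := M) (by omega) hM hd2 hd3 g with h1 | h1 | ⟨k, hk, h1⟩
  · rw [hg] at h1
    have h2 : M ∣ q ^ 2 - 1 := hpM.dvd_of_dvd_mul_left ((Dvd.intro_left r rfl).trans h1)
    have h3 := Nat.le_of_dvd (by omega) h2
    have h4 := Nat.mul_le_mul_right d h3
    rw [hM] at h4
    rcases hd with rfl | ⟨rfl, hmm⟩
    · have : 5 ≤ q := by omega
      have : 5 * q ^ 2 ≤ q ^ 3 := by nlinarith [sq_nonneg q]
      omega
    · omega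
  · rw [hg] at h1
    have := Nat.dvd_of_mul_dvd_mul_right M0 h1
    exact hrp ((Nat.prime_dvd_prime_iff_eq hr hp').1 (hr.dvd_of_dvd_pow this))
  · rw [hg] at h1
    have h2 : M ∣ k := hpM.dvd_of_dvd_mul_left ((Dvd.intro_left r rfl).trans h1)
    have h3 := Nat.mul_dvd_mul_right h2 d
    rw [hM, hk] at h3
    have h4 := Nat.dvd_sub h3 dvd_rfl
    have h7 : (q ^ 2 + 1) * (q + 1) = q ^ 3 + q ^ 2 + q + 1 := by ring
    rw [h7] at h4
    have := Nat.le_of_dvd (by omega) h4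
    omega

lemma rB_notin (p : ℕ) [Fact p.Prime] [CharP F p] (hp : 3 ≤ p) {m d M r B : ℕ} (hm : Fintype.card F = m * d + 1) (hd : d = 4 ∨ d = 2 ∧ m % 2 = 1)
    (hM : M * d = Fintype.card F ^ 3 - 1) (hq : 3 ≤ Fintype.card F) (hr : r.Prime) (hrp : r ≠ p) (hB : 2 * B = Fintype.card F ^ 2 + 1) (hrM : r ∣ M) :
    r * B ∉ elementOrders (S4 F ⧸ Subgroup.center (S4 F)) := by
  have hp' : p.Prime := Fact.out
  set q := Fintype.card F with hqd
  intro h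
  obtain ⟨g, hg⟩ := io_mem.1 h
  have hq3 : 1 ≤ q ^ 3 := Nat.one_le_pow _ _ (by omega)
  have hpM : Nat.Coprime B (p ^ 2) := by
    apply Nat.Coprime.pow_right
    apply Nat.Coprime.symm
    rw [hp'.coprime_iff_not_dvd]
    intro hh
    exact p_ndvd (F := F) p (n := q ^ 2 + 1) (k := q) (Or.inr (by rw [← hqd]; ring)) (hB ▸ hh.mul_left 2)
  have h5 : 3 * q ^ 2 ≤ q ^ 3 := by nlinarith [sq_nonneg q]
  have h6 : 3 * q ≤ q ^ 2 := by nlinarith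
  have hd2 : d ∣ q ^ 2 + q + 2 := by
    rcases hd with rfl | ⟨rfl, hmm⟩
    · exact ⟨4 * m ^ 2 + 3 * m + 1, by rw [hm]; ring⟩
    · exact ⟨2 * m ^ 2 + 3 * m + 2, by rw [hm]; ring⟩
  have hd3 : d ∣ (q ^ 2 + 1) * (q + 1) := by
    rcases hd with rfl | ⟨rfl, hmm⟩
    · exact ⟨(8 * m ^ 2 + 4 * m + 1) * (2 * m + 1), by rw [hm]; ring⟩
    · exact ⟨(4 * m ^ 2 + 4 * m + 2) * (m + 1), by rw [hm]; ring⟩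
  have hBq : B ∣ q ^ 2 + 1 := hB ▸ Dvd.intro_left 2 rfl
  rcases io_NS (F := F) p hp (m := m) (d' := d) (M := M) (by omega) hM hd2 hd3 g with h1 | h1 | ⟨k, hk, h1⟩
  · rw [hg] at h1
    have h2 : B ∣ q ^ 2 - 1 := hpM.dvd_of_dvd_mul_left ((Dvd.intro_left r rfl).trans h1)
    have h3 := Nat.le_of_dvd (by omega) (Nat.dvd_sub hBq h2)
    omega
  · rw [hg] at h1
    have h2 : B ∣ M := hpM.dvd_of_dvd_mul_left ((Dvd.intro_left r rfl).trans h1)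
    have h3 := Nat.dvd_sub (hBq.mul_left q) (hM ▸ h2.mul_right d : B ∣ q ^ 3 - 1)
    have h4 : q * (q ^ 2 + 1) = q ^ 3 + q := by ring
    rw [h4] at h3
    have h3 := Nat.le_of_dvd (by omega) h3
    omega
  · rw [hg] at h1
    have h2 : B * (r * d) ∣ B * (p ^ 2 * (2 * (q + 1))) := by
      have := Nat.mul_dvd_mul_right h1 d
      rw [show B * (r * d) = r * B * d by ring]
      refine this.trans (dvd_of_eq ?_)
      rw [mul_assoc, hk, ← hB]; ring
    have h3 := Nat.dvd_of_mul_dvd_mul_left (by omega) h2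
    have hrp2 : Nat.Coprime r (p ^ 2) := Nat.Coprime.pow_right _ ((Nat.coprime_primes hr hp').2 hrp)
    have h4 : r ∣ q ^ 3 - 1 := hM ▸ hrM.mul_right d
    rcases hd with rfl | ⟨rfl, hmm⟩
    · have h7 : 2 * r ∣ p ^ 2 * (q + 1) := by
        apply Nat.dvd_of_mul_dvd_mul_left (k := 2) (by omega)
        convert h3 using 1 <;> ring
      have h8 : r ∣ q + 1 := hrp2.dvd_of_dvd_mul_left ((Dvd.intro_left 2 rfl).trans h7)
      have h9 := ndvd_r2 hr h4 h8 hq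
      subst h9
      have : Nat.Coprime (2 * 2) (p ^ 2) := Nat.Coprime.mul_left hrp2 hrp2
      have := this.dvd_of_dvd_mul_left h7
      omega
    · have h7 : r ∣ p ^ 2 * (q + 1) := by
        apply Nat.dvd_of_mul_dvd_mul_left (k := 2) (by omega)
        convert h3 using 1 <;> ring
      have h8 : r ∣ q + 1 := hrp2.dvd_of_dvd_mul_left h7
      have h9 := ndvd_r2 hr h4 h8 hq
      subst h9
      have e : M = m * (4 * m ^ 2 + 6 * m + 3) := by
        apply Nat.eq_of_mul_eq_mul_right (show 0 < 2 by omega)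
        rw [hM, hm]
        have : (m * 2 + 1) ^ 3 = m * (4 * m ^ 2 + 6 * m + 3) * 2 + 1 := by ring
        omega
      rw [e] at hrM
      rcases (Nat.Prime.dvd_mul Nat.prime_two).1 hrM with h | h <;> omega

theorem P4 (p : ℕ) [Fact p.Prime] [CharP F p] (hp : 3 ≤ p) (r : ℕ) (hr : r.Prime) (hrp : r ≠ p) (V : Type) [AddCommGroup V] [Nontrivial V]
    (ρ : S4 F ⧸ Subgroup.center (S4 F) →* AddMonoid.End V) (hV : ∀ v : V, r • v = 0)
    (hsum : ∀ l, r * orderOf l ∉ elementOrders (S4 F ⧸ Subgroup.center (S4 F)) → ∀ v, ∑ i ∈ Finset.range (orderOf l), ρ (l ^ i) v = 0) : False := by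
  have hp' : p.Prime := Fact.out
  obtain ⟨a, -, ha⟩ := FiniteField.card F p
  have hodd : Fintype.card F % 2 = 1 := by
    rw [ha, ← Nat.odd_iff]; exact Odd.pow (hp'.odd_of_ne_two (by omega))
  have hq : 3 ≤ Fintype.card F := by
    rw [ha]; exact hp.trans (Nat.le_self_pow a.2.ne' p)
  obtain ⟨m, d, hm, hd⟩ : ∃ m d, Fintype.card F = m * d + 1 ∧ (d = 4 ∨ d = 2 ∧ m % 2 = 1) := by
    by_cases h : Fintype.card F % 4 = 1
    · exact ⟨(Fintype.card F - 1) / 4, 4, by omega, Or.inl rfl⟩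
    · exact ⟨(Fintype.card F - 1) / 2, 2, by omega, Or.inr ⟨rfl, by omega⟩⟩
  set q := Fintype.card F with hqd
  obtain ⟨M, hM⟩ : ∃ M, M * d = q ^ 3 - 1 := ⟨m * (q ^ 2 + q + 1), by
    have : q ^ 3 = m * (q ^ 2 + q + 1) * d + 1 := by rw [hm]; ring
    omega⟩
  obtain ⟨B, hB⟩ : ∃ B, 2 * B = q ^ 2 + 1 := ⟨(q ^ 2 + 1) / 2, by
    have : q ^ 2 % 2 = 1 := by rw [Nat.pow_mod, hodd]
    omega⟩
  have hbadM := rM_notin (F := F) p hp hm hd hM hq hr hrp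
  set ρ' : S4 F →* AddMonoid.End V := ρ.comp (QuotientGroup.mk' _) with hρ'
  have hs' : ∀ s : S4 F, r * io s ∉ elementOrders (S4 F ⧸ Subgroup.center (S4 F)) → ∀ v, ∑ i ∈ Finset.range (io s), ρ' (s ^ i) v = 0 := by
    intro s h v
    rw [← hsum (QuotientGroup.mk s) h v]
    rfl
  obtain ⟨c, hc, hrow, hker⟩ := T3ex (F := F) p hm hd hM hq
  have M0 : 0 < M := by
    rcases Nat.eq_zero_or_pos M with h | h
    · subst h
      have : q ^ 1 ≤ q ^ 3 := Nat.pow_le_pow_right (by omega) (by omega)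
      rw [pow_one] at this
      omega
    · exact h
  have hcop : Nat.Coprime r q := by
    rw [ha]; exact Nat.Coprime.pow_right _ ((Nat.coprime_primes hr hp').2 hrp)
  have key := Q_triv c M M0 hrow hker ρ' hcop hV (by
    intro x v
    have e : io (col0 x * c * (col0 x)⁻¹) = M := by rw [io_conj, hc]
    have := hs' (col0 x * c * (col0 x)⁻¹) (by rw [e]; exact hbadM) v
    rwa [e] at this)
  have htop : ρ'.ker = ⊤ := normal_top _ (by
    intro x
    rw [MonoidHom.mem_ker]
    ext v
    exact key x v)
  have htriv : ∀ s v, ρ' s v = v := by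
    intro s v
    have : s ∈ ρ'.ker := htop ▸ Subgroup.mem_top s
    rw [MonoidHom.mem_ker] at this
    rw [this]; rfl
  obtain ⟨v, hv⟩ := exists_ne (0 : V)
  have hdv : ∀ s : S4 F, r * io s ∉ elementOrders (S4 F ⧸ Subgroup.center (S4 F)) → r ∣ io s := by
    intro s h
    have := hs' s h v
    simp only [htriv, Finset.sum_const, Finset.card_range] at this
    by_contra h2
    exact hv (smul_coprime ((Nat.Prime.coprime_iff_not_dvd hr).2 h2) v (hV v) this)
  have hrM : r ∣ M := hc ▸ hdv c (by rw [hc]; exact hbadM)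
  have hbadB := rB_notin (F := F) p hp hm hd hM hq hr hrp hB hrM
  obtain ⟨z, s, _, _, -, -, -, -, hs⟩ := T4ex (F := F) p hB hq
  have hrB : r ∣ B := hs ▸ hdv s (by rw [hs]; exact hbadB)
  have h1 : r ∣ q ^ 3 - 1 := hM ▸ hrM.mul_right d
  have h2 : r ∣ q ^ 2 + 1 := hB ▸ hrB.mul_left 2
  have h3 := Nat.dvd_sub (h2.mul_left q) h1
  have h4 : q * (q ^ 2 + 1) = q ^ 3 + q := by ring
  have hq3 : 1 ≤ q ^ 3 := Nat.one_le_pow _ _ (by omega)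
  rw [h4, show q ^ 3 + q - (q ^ 3 - 1) = q + 1 by omega] at h3
  have h5 := ndvd_r2 hr h1 h3 hq
  subst h5
  have : q ^ 2 % 4 = 1 := by
    rcases (by omega : q % 4 = 1 ∨ q % 4 = 3) with h | h <;> rw [Nat.pow_mod, h]
  omega

end four

set_option linter.unusedSimpArgs false
set_option linter.unusedSectionVars false
set_option linter.unusedVariables false
section six

lemma lucas (p : ℕ) [Fact p.Prime] {a b c d : ℕ} (hc : c < p) (hd : d < p) (h1 : ¬ p ∣ a.choose b) (h2 : ¬ p ∣ c.choose d) :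
    ¬ p ∣ (p * a + c).choose (p * b + d) := by
  have hp : p.Prime := Fact.out
  have h := Choose.choose_modEq_choose_mod_mul_choose_div_nat (n := p * a + c) (k := p * b + d) (p := p)
  rw [Nat.mul_add_mod, Nat.mul_add_mod, Nat.mod_eq_of_lt hc, Nat.mod_eq_of_lt hd, Nat.mul_add_div hp.pos, Nat.mul_add_div hp.pos,
    Nat.div_eq_of_lt hc, Nat.div_eq_of_lt hd, add_zero, add_zero] at h
  rw [h.dvd_iff dvd_rfl, hp.dvd_mul]
  tauto

lemma choose_small (p : ℕ) [Fact p.Prime] {c d : ℕ} (hc : c < p) (hd : d ≤ c) : ¬ p ∣ c.choose d := by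
  have hp : p.Prime := Fact.out
  intro h
  have : p ∣ c.factorial := by
    rw [← Nat.choose_mul_factorial_mul_factorial hd, mul_assoc]; exact h.mul_right _
  have := (hp.dvd_factorial).1 this
  omega

lemma lemD (p : ℕ) [Fact p.Prime] (hp3 : 3 ≤ p) : ∀ h : ℕ, ¬ p ∣ (2 * h).choose h ∨ ∃ l, l % 2 = 1 ∧ l ≤ 2 * h ∧ ¬ p ∣ (2 * h).choose l := by
  have hp : p.Prime := Fact.out
  have hodd : p % 2 = 1 := by
    rcases hp.eq_two_or_odd with h | h <;> omega
  intro h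
  induction h using Nat.strong_induction_on with
  | _ h ih =>
    rcases Nat.eq_zero_or_pos h with rfl | h0
    · left; simp; omega
    have hdm := Nat.div_add_mod (2 * h) p
    have hlt : 2 * h % p < p := Nat.mod_lt _ hp.pos
    set c := 2 * h % p with hc
    set a := 2 * h / p with ha
    by_cases hc2 : c % 2 = 1
    · right
      refine ⟨1, rfl, by omega, ?_⟩
      rw [Nat.choose_one_right, Nat.dvd_iff_mod_eq_zero]; omega
    · have ha2 : a % 2 = 0 := by
        have : (p * a + c) % 2 = 0 := by omega
        rw [Nat.add_mod, Nat.mul_mod, hodd] at this; omega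
      obtain ⟨a', ha'⟩ : ∃ a', a = 2 * a' := ⟨a / 2, by omega⟩
      obtain ⟨c', hc'⟩ : ∃ c', c = 2 * c' := ⟨c / 2, by omega⟩
      have hh : h = p * a' + c' := by
        have : p * a = 2 * (p * a') := by rw [ha']; ring
        omega
      have hlt' : a' < h := by
        rcases Nat.eq_zero_or_pos a' with h | h
        · omega
        · nlinarith
      rcases ih a' hlt' with h1 | ⟨l, hl, hl1, hl2⟩
      · left
        rw [← hdm, ha', hc']
        conv => rhs; rhs; rw [hh]
        exact lucas p (by omega) (by omega) h1 (choose_small p (by omega) (by omega))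
      · right
        refine ⟨p * l + 0, ?_, ?_, ?_⟩
        · rw [add_zero, Nat.mul_mod, hodd, hl]
        · have := Nat.mul_le_mul_left p hl1
          rw [← hdm, ha']; omega
        · rw [← hdm, ha']
          exact lucas p hlt hp.pos hl2 (choose_small p hlt (by omega))

lemma lemO (p : ℕ) [Fact p.Prime] (hp3 : 3 ≤ p) : ∀ n : ℕ, 0 < n → ∃ l, l % 2 = 1 ∧ l ≤ n ∧ ¬ p ∣ n.choose l := by
  have hp : p.Prime := Fact.out
  have hodd : p % 2 = 1 := by
    rcases hp.eq_two_or_odd with h | h <;> omega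
  intro h
  induction h using Nat.strong_induction_on with
  | _ h ih =>
    intro h0
    have hdm := Nat.div_add_mod h p
    have hlt : h % p < p := Nat.mod_lt _ hp.pos
    by_cases hc2 : h % p = 0
    · have h1 : 0 < h / p := by
        rcases Nat.eq_zero_or_pos (h / p) with h | h
        · rw [h, hc2] at hdm; omega
        · exact h
      obtain ⟨l, hl, hl1, hl2⟩ := ih (h / p) (Nat.div_lt_self h0 (by omega)) h1
      refine ⟨p * l + 0, ?_, ?_, ?_⟩
      · rw [add_zero, Nat.mul_mod, hodd, hl]
      · have := Nat.mul_le_mul_left p hl1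
        omega
      · rw [← hdm]
        exact lucas p hlt hp.pos hl2 (choose_small p hlt (by omega))
    · refine ⟨1, rfl, by omega, ?_⟩
      rw [Nat.choose_one_right, Nat.dvd_iff_mod_eq_zero]; omega

noncomputable def ds (p n : ℕ) : ℕ := (Nat.digits p n).sum

lemma ds_add (p a c : ℕ) (hp : 2 ≤ p) (hc : c < p) : ds p (p * a + c) = c + ds p a := by
  by_cases h : c = 0 ∧ a = 0
  · obtain ⟨rfl, rfl⟩ := h; simp [ds]
  · rw [ds, add_comm, Nat.digits_add p (by omega) c a hc (by tauto)]; simp [ds]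

lemma ds_exists (p : ℕ) [Fact p.Prime] : ∀ n t : ℕ, t ≤ ds p n → ∃ l, l ≤ n ∧ ¬ p ∣ n.choose l ∧ ds p l = t := by
  have hp : p.Prime := Fact.out
  intro h
  induction h using Nat.strong_induction_on with
  | _ h ih =>
    intro t ht
    rcases Nat.eq_zero_or_pos h with rfl | h0
    · refine ⟨0, le_rfl, by simpa using hp.ne_one, ?_⟩
      have : ds p 0 = 0 := by simp [ds]
      omega
    have hdm := Nat.div_add_mod h p
    have hlt : h % p < p := Nat.mod_lt _ hp.pos
    have e := ds_add p (h / p) (h % p) hp.two_le hlt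
    rw [hdm] at e
    obtain ⟨l, hl1, hl2, hl3⟩ := ih (h / p) (Nat.div_lt_self h0 hp.one_lt) (t - min t (h % p)) (by omega)
    refine ⟨p * l + min t (h % p), ?_, ?_, ?_⟩
    · have := Nat.mul_le_mul_left p hl1
      omega
    · rw [← hdm, Nat.mul_add_mod, Nat.mod_eq_of_lt hlt]
      exact lucas p hlt (by omega) hl2 (choose_small p hlt (by omega))
    · rw [ds_add p _ _ hp.two_le (by omega), hl3]; omega

lemma ds_mod (p n : ℕ) (hp : 3 ≤ p) : n ≡ ds p n [MOD (p - 1)] := by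
  refine Nat.modEq_digits_sum (p - 1) p ?_ n
  conv_lhs => rw [show p = 1 + (p - 1) by omega]
  rw [show 1 + (p - 1) - 1 = p - 1 by omega, Nat.add_mod_right, Nat.mod_eq_of_lt (by omega)]

lemma ds_pos (p n : ℕ) (h : ds p n = 0) (hp : 2 ≤ p): n = 0 := by
  induction n using Nat.strong_induction_on with
  | _ n ih =>
    rcases Nat.eq_zero_or_pos n with rfl | h0
    · rfl
    have hdm := Nat.div_add_mod n p
    have hlt : n % p < p := Nat.mod_lt _ (by omega)
    have e := ds_add p (n / p) (n % p) hp hlt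
    rw [hdm] at e
    have := ih (n / p) (Nat.div_lt_self h0 (by omega)) (by omega)
    rw [this] at hdm; omega

lemma ds_le (p : ℕ) (hp : 2 ≤ p) : ∀ a n, n < p ^ (a + 1) → n ≤ p ^ a * ds p n := by
  intro a
  induction a with
  | zero =>
    intro n hn
    have := ds_add p 0 n hp (by simpa using hn)
    rw [mul_zero, zero_add] at this
    rw [this, pow_zero, one_mul]; omega
  | succ a ih =>
    intro n hn
    have hdm := Nat.div_add_mod n p
    have hlt : n % p < p := Nat.mod_lt _ (by omega)
    have e := ds_add p (n / p) (n % p) hp hlt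
    rw [hdm] at e
    have h1 := ih (n / p) (Nat.div_lt_of_lt_mul (by rw [← pow_succ']; exact hn))
    have h2 : 1 ≤ p ^ (a + 1) := Nat.one_le_pow _ _ (by omega)
    calc n = p * (n / p) + n % p := hdm.symm
      _ ≤ p * (p ^ a * ds p (n / p)) + p ^ (a + 1) * (n % p) := by
        have := Nat.mul_le_mul_left p h1
        have := Nat.le_mul_of_pos_left (n % p) h2
        omega
      _ = p ^ (a + 1) * ds p n := by rw [e]; ring

open Polynomial in
lemma extract {E : Type*} [Field E] (p : ℕ) [CharP E p] {ι : Type*} (I : Finset ι) (c a b : ι → E) (n l : ℕ) (T : Finset E) (hT : n < T.card)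
    (h : ∀ τ ∈ T, ∑ i ∈ I, c i * (a i + τ * b i) ^ n = 0) (hl : ¬ p ∣ n.choose l) (hln : l ≤ n) : ∑ i ∈ I, c i * (a i ^ (n - l) * b i ^ l) = 0 := by
  set P : E[X] := ∑ i ∈ I, C (c i) * (C (b i) * X + C (a i)) ^ n with hP
  have hP0 : P = 0 := by
    apply Polynomial.eq_zero_of_natDegree_lt_card_of_eval_eq_zero' P T
    · intro τ hτ
      rw [← h τ hτ, hP, Polynomial.eval_finsetSum]
      apply Finset.sum_congr rfl
      intro i _
      simp only [eval_mul, eval_pow, eval_add, eval_C, eval_X]; ring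
    · refine lt_of_le_of_lt ?_ hT
      apply Polynomial.natDegree_sum_le_of_forall_le
      intro i _
      refine (Polynomial.natDegree_C_mul_le _ _).trans ((Polynomial.natDegree_pow_le).trans ?_)
      calc _ ≤ n * 1 := Nat.mul_le_mul_left _ (Polynomial.natDegree_linear_le)
        _ = n := mul_one n
  have h1 : P.coeff l = (n.choose l : E) * ∑ i ∈ I, c i * (a i ^ (n - l) * b i ^ l) := by
    rw [hP, Polynomial.finsetSum_coeff, Finset.mul_sum]
    apply Finset.sum_congr rfl
    intro i _
    have key : ∀ k, (C (b i) * X) ^ k * C (a i) ^ (n - k) * (n.choose k : E[X]) = C (b i ^ k * a i ^ (n - k) * n.choose k) * X ^ k := by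
      intro k
      simp only [C_mul, C_pow, map_natCast]; ring
    rw [Polynomial.coeff_C_mul, add_pow, Polynomial.finsetSum_coeff, Finset.sum_eq_single l]
    · rw [key, coeff_C_mul_X_pow, if_pos rfl]
      ring
    · intro k _ hk
      rw [key, coeff_C_mul_X_pow, if_neg hk.symm]
    · intro hh
      exact absurd (Finset.mem_range.2 (by omega)) hh
  rw [hP0, coeff_zero] at h1
  rcases mul_eq_zero.1 h1.symm with h2 | h2
  · exact absurd ((CharP.cast_eq_zero_iff E p _).1 h2) hl
  · exact h2

lemma lemE {F : Type} [Field F] [Fintype F] (p : ℕ) [Fact p.Prime] [CharP F p] (hp3 : 3 ≤ p) (n : Fin 3 → ℕ) (hn : ∀ i, n i ≤ Fintype.card F - 1)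
    (h : ∀ x y z : F, ∑ j ∈ Finset.range p, (1 + x * (j : F)) ^ n 0 * ((1 + y * (j : F)) ^ n 1 * (1 + z * (j : F)) ^ n 2) = 0) :
    ds p (n 0) + ds p (n 1) + ds p (n 2) < p - 1 := by
  by_contra hc
  have hp : p.Prime := Fact.out
  have hq : 0 < Fintype.card F := Fintype.card_pos
  obtain ⟨l0, a0, b0, c0⟩ := ds_exists p (n 0) (min (ds p (n 0)) (p - 1)) (by omega)
  obtain ⟨l1, a1, b1, c1⟩ := ds_exists p (n 1) (min (ds p (n 1)) (p - 1 - ds p l0)) (by omega)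
  obtain ⟨l2, a2, b2, c2⟩ := ds_exists p (n 2) (p - 1 - ds p l0 - ds p l1) (by omega)
  have hs : ds p l0 + ds p l1 + ds p l2 = p - 1 := by omega
  have cd : ∀ i, n i < (Finset.univ : Finset F).card := by
    intro i; rw [Finset.card_univ]; have := hn i; omega
  have s1 : ∀ y z : F, ∑ j ∈ Finset.range p, ((1 + y * (j : F)) ^ n 1 * (1 + z * (j : F)) ^ n 2) * ((1 : F) ^ (n 0 - l0) * (j : F) ^ l0) = 0 := fun y z =>
    extract p (Finset.range p) (fun j => (1 + y * (j : F)) ^ n 1 * (1 + z * (j : F)) ^ n 2) (fun _ => 1) (fun j => (j : F)) (n 0) l0 Finset.univ (cd 0)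
      (fun x _ => by rw [← h x y z]; exact Finset.sum_congr rfl fun j _ => mul_comm _ _) b0 a0
  have s2 : ∀ z : F, ∑ j ∈ Finset.range p, ((1 + z * (j : F)) ^ n 2 * (j : F) ^ l0) * ((1 : F) ^ (n 1 - l1) * (j : F) ^ l1) = 0 := fun z =>
    extract p (Finset.range p) (fun j => (1 + z * (j : F)) ^ n 2 * (j : F) ^ l0) (fun _ => 1) (fun j => (j : F)) (n 1) l1 Finset.univ (cd 1)
      (fun x _ => by rw [← s1 x z]; exact Finset.sum_congr rfl fun j _ => by ring) b1 a1
  have s3 : ∑ j ∈ Finset.range p, ((j : F) ^ l0 * (j : F) ^ l1) * ((1 : F) ^ (n 2 - l2) * (j : F) ^ l2) = 0 :=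
    extract p (Finset.range p) (fun j => (j : F) ^ l0 * (j : F) ^ l1) (fun _ => 1) (fun j => (j : F)) (n 2) l2 Finset.univ (cd 2)
      (fun x _ => by rw [← s2 x]; exact Finset.sum_congr rfl fun j _ => by ring) b2 a2
  have hm : l0 + l1 + l2 ≡ 0 [MOD (p - 1)] := by
    have := ((ds_mod p l0 hp3).add (ds_mod p l1 hp3)).add (ds_mod p l2 hp3)
    rw [hs] at this
    exact this.trans (by simp [Nat.ModEq])
  obtain ⟨k, hk⟩ := (Nat.modEq_zero_iff_dvd).1 hm
  have hpos : l0 + l1 + l2 ≠ 0 := by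
    intro h0
    have e0 : ds p 0 = 0 := by simp [ds]
    rw [show l0 = 0 by omega, show l1 = 0 by omega, show l2 = 0 by omega, e0] at hs
    have := hp.two_le
    omega
  have s4 : ∑ j ∈ Finset.range p, (j : F) ^ (l0 + l1 + l2) = 0 := by
    rw [← s3]; exact Finset.sum_congr rfl fun j _ => by ring
  have : p = (p - 1) + 1 := by have := hp.two_le; omega
  rw [this, Finset.sum_range_succ', Nat.cast_zero, zero_pow hpos, add_zero, Finset.sum_congr rfl (g := fun _ => (1 : F))] at s4
  · rw [Finset.sum_const, Finset.card_range, nsmul_eq_mul, mul_one, CharP.cast_eq_zero_iff F p] at s4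
    have := Nat.le_of_dvd (by have := hp.two_le; omega) s4
    have := hp.two_le
    omega
  · intro j hj
    have hj := Finset.mem_range.1 hj
    rw [hk, pow_mul]
    have : ((j + 1 : ℕ) : F) ^ (p - 1) = 1 := by
      have h1 : ((j + 1 : ℕ) : ZMod p) ≠ 0 := by
        rw [Ne, ZMod.natCast_eq_zero_iff]
        intro h; have := Nat.le_of_dvd (by omega) h; omega
      have h2 := ZMod.pow_card_sub_one_eq_one h1
      have h3 := congrArg (ZMod.castHom (dvd_refl p) F) h2
      simpa using h3
    rw [this, one_pow]
end six

set_option linter.unusedSimpArgs false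
set_option linter.unusedSectionVars false
set_option linter.unusedVariables false
section six
variable {F : Type} [Field F] [Fintype F]

def Good (F : Type) [Field F] [Fintype F] (p : ℕ) (n : Fin 3 → ℕ) : Prop :=
  (∀ z ∈ Subgroup.center (S4 F), ∀ x : S4 F, ff n (mx (z * x)) = ff n (mx x)) ∧
  ∀ s : S4 F, p * io s ∉ elementOrders (S4 F ⧸ Subgroup.center (S4 F)) → ∀ h g : S4 F, ∑ i ∈ Finset.range (io s), ff n (mx (h * s ^ i * g)) = 0

lemma exists_fun0 (p : ℕ) [Fact p.Prime] (V : Type) [AddCommGroup V] [Module (ZMod p) V] {v : V} (hv : v ≠ 0) : ∃ ξ : V →+ ZMod p, ξ v ≠ 0 := by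
  by_contra hc
  push Not at hc
  have : Module.Projective (ZMod p) V := inferInstance
  exact hv ((Module.forall_dual_apply_eq_zero_iff (ZMod p) v).1 (fun φ => hc φ.toAddMonoidHom))
lemma exists_fun (p : ℕ) [Fact p.Prime] (V : Type) [AddCommGroup V] (hV : ∀ v : V, p • v = 0) {v : V} (hv : v ≠ 0) : ∃ ξ : V →+ ZMod p, ξ v ≠ 0 := by
  let i : Module (ZMod p) V := AddCommGroup.zmodModule hV
  exact exists_fun0 p V hv

lemma exists_good (p : ℕ) [Fact p.Prime] [CharP F p] (V : Type) [AddCommGroup V] [Nontrivial V]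
    (ρ : S4 F ⧸ Subgroup.center (S4 F) →* AddMonoid.End V) (hV : ∀ v : V, p • v = 0)
    (hsum : ∀ l, p * orderOf l ∉ elementOrders (S4 F ⧸ Subgroup.center (S4 F)) → ∀ v, ∑ i ∈ Finset.range (orderOf l), ρ (l ^ i) v = 0) :
    ∃ n : Fin 3 → ℕ, (∀ i, n i ≤ Fintype.card F - 1) ∧ Good F p n := by
  let X : Submodule F (S4 F → F) :=
    { carrier := {f | (∀ z ∈ Subgroup.center (S4 F), ∀ x : S4 F, f (z * x) = f x) ∧
        ∀ s : S4 F, p * io s ∉ elementOrders (S4 F ⧸ Subgroup.center (S4 F)) → ∀ h g : S4 F, ∑ i ∈ Finset.range (io s), f (h * s ^ i * g) = 0}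
      add_mem' := by
        rintro a b ⟨h1, h2⟩ ⟨h3, h4⟩
        refine ⟨fun z hz x => ?_, fun s hs h g => ?_⟩
        · simp only [Pi.add_apply, h1 z hz, h3 z hz]
        · simp only [Pi.add_apply, Finset.sum_add_distrib, h2 s hs, h4 s hs, add_zero]
      zero_mem' := ⟨fun _ _ _ => rfl, fun _ _ _ _ => Finset.sum_const_zero⟩
      smul_mem' := by
        rintro c a ⟨h1, h2⟩
        refine ⟨fun z hz x => ?_, fun s hs h g => ?_⟩
        · simp only [Pi.smul_apply, h1 z hz]
        · simp only [Pi.smul_apply, ← Finset.smul_sum, h2 s hs, smul_zero] }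
  have hR : ∀ a, ∀ f ∈ X, (fun x => f (x * a)) ∈ X := by
    rintro a f ⟨h1, h2⟩
    refine ⟨fun z hz x => ?_, fun s hs h g => ?_⟩
    · simp only [mul_assoc, h1 z hz]
    · rw [← h2 s hs h (g * a)]; simp only [mul_assoc]
  have hL : ∀ a, ∀ f ∈ X, (fun x => f (a * x)) ∈ X := by
    rintro a f ⟨h1, h2⟩
    refine ⟨fun z hz x => ?_, fun s hs h g => ?_⟩
    · have := (Subgroup.mem_center_iff.1 hz a)
      simp only [← mul_assoc]
      rw [this, mul_assoc, h1 z hz]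
    · rw [← h2 s hs (a * h) g]; simp only [mul_assoc]
  have hne : X ≠ ⊥ := by
    obtain ⟨v, hv⟩ := exists_ne (0 : V)
    obtain ⟨ξ, hξ⟩ := exists_fun p V hV hv
    let f : S4 F → F := fun g => ZMod.castHom (dvd_refl p) F (ξ (ρ (QuotientGroup.mk g) v))
    have hf : f ∈ X := by
      refine ⟨fun z hz x => ?_, fun s hs h g => ?_⟩
      · simp only [f, QuotientGroup.mk_mul, (QuotientGroup.eq_one_iff z).2 hz, one_mul]
      · simp only [f, QuotientGroup.mk_mul, QuotientGroup.mk_pow, map_mul, AddMonoid.End.coe_mul, Function.comp_apply, ← map_sum]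
        have := hsum (QuotientGroup.mk s) hs (ρ (QuotientGroup.mk g) v)
        change _ = 0
        rw [show io s = orderOf (QuotientGroup.mk s : S4 F ⧸ Subgroup.center (S4 F)) from rfl, this, map_zero, map_zero, map_zero]
    intro h
    rw [h, Submodule.mem_bot] at hf
    have h1 := congrFun hf 1
    simp only [f, QuotientGroup.mk_one, map_one, AddMonoid.End.coe_one, id_eq, Pi.zero_apply, map_eq_zero] at h1
    exact hξ h1
  obtain ⟨n, hn, h⟩ := P5 p X hR hL hne
  exact ⟨n, hn, h⟩
end six

set_option linter.unusedSimpArgs false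
set_option linter.unusedSectionVars false
set_option linter.unusedVariables false
section six
variable {F : Type} [Field F] [Fintype F]

lemma q_cop (p : ℕ) [Fact p.Prime] [CharP F p] : ¬ p ∣ Fintype.card F - 1 ∧ ¬ p ∣ Fintype.card F + 1 := by
  have : 0 < Fintype.card F := Fintype.card_pos
  exact ⟨p_ndvd (F := F) p (k := 1) (Or.inl (by omega)), p_ndvd (F := F) p (k := 1) (Or.inr (by omega))⟩

lemma pp_notin (p : ℕ) [Fact p.Prime] [CharP F p] (hp : 3 ≤ p) (k : ℕ) (h : 5 ≤ p ∨ k ≠ 1) :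
    p * (p * k) ∉ elementOrders (S4 F ⧸ Subgroup.center (S4 F)) := by
  have hp' : p.Prime := Fact.out
  intro hh
  obtain ⟨g, hg⟩ := io_mem.1 hh
  obtain ⟨c1, c2⟩ := q_cop (F := F) p
  have st : ∀ x, p * (p * k) ∣ p * x → p ∣ x := fun x hx => (Dvd.intro k rfl).trans (Nat.dvd_of_mul_dvd_mul_left hp'.pos hx)
  rcases io_PS (F := F) p hp (m := Fintype.card F - 1) (d := 1) (by omega) (by omega) g with h1 | h1 | h1 | h1 | ⟨h1, h2⟩ <;> rw [hg] at h1
  · exact h1 (Dvd.intro _ rfl)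
  · exact c1 (st _ h1)
  · exact c2 (st _ h1)
  · rcases hp'.dvd_mul.1 (st _ h1) with h | h
    · exact c2 h
    · exact c1 h
  · rcases h with h | h
    · have := h2 h
      rw [hg] at this
      have := st 1 (by rwa [mul_one])
      have := Nat.le_of_dvd one_pos this
      omega
    · rw [sq] at h1
      have h3 := Nat.dvd_of_mul_dvd_mul_left hp'.pos h1
      have h4 : p * k ∣ p * 1 := by rwa [mul_one]
      exact h (Nat.dvd_one.1 (Nat.dvd_of_mul_dvd_mul_left hp'.pos h4))

lemma bad_of (p : ℕ) [Fact p.Prime] [CharP F p] (hp : 3 ≤ p) {m d N0 N : ℕ} (hm : m * d = Fintype.card F - 1) (hd : d ∣ 4) (h0 : N0 ∣ N)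
    (h1 : ¬ N0 ∣ Fintype.card F - 1) (h2 : ¬ N0 ∣ Fintype.card F + 1) (h3 : ¬ N0 ∣ (Fintype.card F + 1) * m) (h4 : ¬ N0 ∣ p) :
    p * N ∉ elementOrders (S4 F ⧸ Subgroup.center (S4 F)) := by
  have hp' : p.Prime := Fact.out
  intro hh
  obtain ⟨g, hg⟩ := io_mem.1 hh
  have st : ∀ x, p * N ∣ p * x → N0 ∣ x := fun x hx => h0.trans (Nat.dvd_of_mul_dvd_mul_left hp'.pos hx)
  rcases io_PS (F := F) p hp hm hd g with h5 | h5 | h5 | h5 | ⟨h5, -⟩ <;> rw [hg] at h5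
  · exact h5 (Dvd.intro _ rfl)
  · exact h1 (st _ h5)
  · exact h2 (st _ h5)
  · exact h3 (st _ h5)
  · rw [sq] at h5; exact h4 (st _ h5)

def wM (x y z : F) : S4 F := mkS !![1+x, y-x, z-y, -z; x, 1+(y-x), z-y, -z; x, y-x, 1+(z-y), -z; x, y-x, z-y, 1-z] (by
  simp [Matrix.det_succ_row_zero, Fin.sum_univ_succ, Fin.succAbove]; ring)

lemma wM_mul (x y z x' y' z' : F) : wM x y z * wM x' y' z' = wM (x + x') (y + y') (z + z') := by
  apply mx_inj
  simp only [wM, mx_mul, mx_mkS, mul4]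
  apply ext4 <;> ring

lemma wM_pow (x y z : F) (j : ℕ) : wM x y z ^ j = wM (x * j) (y * j) (z * j) := by
  induction j with
  | zero =>
    apply mx_inj
    rw [pow_zero, mx_one, eta4 1]
    simp only [wM, mx_mkS]
    apply ext4 <;> simp
  | succ j ih => rw [pow_succ, ih, wM_mul]; push_cast; congr 1 <;> ring

lemma dl0 {R : Type*} [CommRing R] (M : Matrix (Fin 4) (Fin 4) R) : dl 0 M = M 0 0 := rfl
lemma dl1 {R : Type*} [CommRing R] (M : Matrix (Fin 4) (Fin 4) R) : dl 1 M = M 0 0 * M 1 1 - M 0 1 * M 1 0 := rfl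

lemma ff_wM (n : Fin 3 → ℕ) (x y z : F) : ff n (mx (wM x y z)) = (1 + x) ^ n 0 * ((1 + y) ^ n 1 * (1 + z) ^ n 2) := by
  have h0 : dl 0 (mx (wM x y z)) = 1 + x := rfl
  have h1 : dl 1 (mx (wM x y z)) = 1 + y := by
    simp [dl, wM]; ring
  have h2 : dl 2 (mx (wM x y z)) = 1 + z := by
    simp [dl, wM]; ring
  rw [ff, h0, h1, h2, mul_assoc]

lemma bound5 (p : ℕ) [Fact p.Prime] [CharP F p] (hp : 5 ≤ p) (n : Fin 3 → ℕ) (hn : ∀ i, n i ≤ Fintype.card F - 1) (hg : Good F p n) :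
    ds p (n 0) + ds p (n 1) + ds p (n 2) < p - 1 := by
  have hp' : p.Prime := Fact.out
  apply lemE p (by omega) n hn
  intro x y z
  have hio : io (wM x y z) ∣ p := by
    rw [io_dvd_iff]
    refine ⟨1, ?_⟩
    rw [← mx_pow, wM_pow, CharP.cast_eq_zero, eta4 (Matrix.scalar (Fin 4) (1 : F))]
    simp only [wM, mx_mkS]
    apply ext4 <;> simp
  rcases (Nat.dvd_prime hp').1 hio with h | h
  · have h1 : io (wM x y z) ∣ 1 := by rw [h]
    obtain ⟨r, hr⟩ := (io_dvd_iff _ _).1 h1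
    rw [pow_one] at hr
    have a1 : x = 0 := by simpa [wM] using congrFun (congrFun hr 1) 0
    have a2 : y - x = 0 := by simpa [wM] using congrFun (congrFun hr 0) 1
    have a3 : z - y = 0 := by simpa [wM] using congrFun (congrFun hr 0) 2
    have b2 : y = 0 := by linear_combination a2 + a1
    have b3 : z = 0 := by linear_combination a3 + b2
    rw [a1, b2, b3]
    simp
  · have := hg.2 (wM x y z) (by rw [h]; simpa using pp_notin (F := F) p (by omega) 1 (Or.inl hp)) 1 1
    rw [h] at this
    rw [← this]
    apply Finset.sum_congr rfl
    intro j _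
    rw [one_mul, mul_one, wM_pow, ff_wM]

lemma centre_pow (p : ℕ) (n : Fin 3 → ℕ) (hg : Good F p n) (c : F) (hc : c ^ 4 = 1) : c ^ (n 0 + 2 * n 1 + 3 * n 2) = 1 := by
  let z : S4 F := mkS (Matrix.scalar (Fin 4) c) (by simp [hc])
  have hz : z ∈ Subgroup.center (S4 F) := by
    rw [Matrix.SpecialLinearGroup.mem_center_iff]
    exact ⟨c, by simpa using hc, rfl⟩
  have h := hg.1 z hz 1
  have h1 : ff n (mx (1 : S4 F)) = 1 := by simp [ff, dl]
  have h2 : ff n (mx z) = c ^ (n 0 + 2 * n 1 + 3 * n 2) := by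
    simp [ff, dl, z]; ring
  rw [mul_one, h1, h2] at h
  exact h

lemma three (p : ℕ) [Fact p.Prime] [CharP F p] (hp : p = 3) (n : Fin 3 → ℕ) (hg : Good F p n) (z u h : S4 F) (hz : mx z * mx z = 1)
    (hzd : ∀ i j, j < i → mx z i j = 0) (hz1 : ff n (mx z) = 1) (hzu : mx z * mx u = mx u * mx z) (hu : mx u ^ 3 = 1)
    (hzs : mx z 1 1 ≠ mx z 0 0 ∨ mx z 2 2 ≠ mx z 0 0) (hus : (∃ r, mx u ^ 2 = Matrix.scalar (Fin 4) r) → u = 1) :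
    ∑ j ∈ Finset.range p, ff n (mx h * mx u ^ j) = 0 := by
  have cm : Commute (mx z) (mx u) := hzu
  have hU : ∀ i x, ff n (x * mx z ^ i) = ff n x := by
    intro i
    induction i with
    | zero => intro x; rw [pow_zero, Matrix.mul_one]
    | succ i ih => intro x; rw [pow_succ, ← Matrix.mul_assoc, ff_U n hzd, hz1, mul_one, ih]
  have h6 : io (z * u) ∣ 6 := by
    rw [io_dvd_iff]
    refine ⟨1, ?_⟩
    rw [mx_mul, cm.mul_pow, show 6 = 2 * 3 from rfl, pow_mul, sq, hz, mul_comm, pow_mul, hu]; simp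
  have h3 : ¬ io (z * u) ∣ 3 := by
    rw [io_dvd_iff]
    rintro ⟨r, hr⟩
    rw [mx_mul, cm.mul_pow, hu, pow_succ, sq, hz, one_mul, mul_one] at hr
    rw [hr] at hzs
    simp at hzs
  by_cases h2 : io (z * u) ∣ 2
  · obtain ⟨r, hr⟩ := (io_dvd_iff _ _).1 h2
    rw [mx_mul, cm.mul_pow, sq (mx z), hz, one_mul] at hr
    rw [hus ⟨r, hr⟩]
    simp
  · have h7 : io (z * u) = 6 := by
      have := Nat.le_of_dvd (by omega) h6
      interval_cases (io (z * u)) <;> omega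
    have h8 := hg.2 (z * u) (by rw [h7]; have := pp_notin (F := F) p (by omega) 2 (Or.inr (by omega)); subst hp; exact this) h 1
    have h9 : ∀ i, ff n (mx (h * (z * u) ^ i * 1)) = ff n (mx h * mx u ^ i) := by
      intro i
      rw [mul_one, mx_mul, mx_pow, mx_mul, hzu, cm.symm.mul_pow, ← Matrix.mul_assoc, hU]
    rw [h7] at h8
    simp only [h9] at h8
    subst hp
    have e : ∀ k, mx u ^ (3 + k) = mx u ^ k := by intro k; rw [pow_add, hu, one_mul]
    rw [show 6 = 3 + 3 from rfl, Finset.sum_range_add] at h8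
    simp only [e] at h8
    have h10 : (2 : F) * ∑ j ∈ Finset.range 3, ff n (mx h * mx u ^ j) = 0 := by rw [two_mul]; exact h8
    rcases mul_eq_zero.1 h10 with h | h
    · exfalso
      have : ((2 : ℕ) : F) = 0 := by exact_mod_cast h
      rw [CharP.cast_eq_zero_iff F 3] at this
      omega
    · exact h

end six

set_option linter.unusedSimpArgs false
set_option linter.unusedSectionVars false
set_option linter.unusedVariables false
section six
variable {F : Type} [Field F] [Fintype F]

lemma three' (p : ℕ) [Fact p.Prime] [CharP F p] (hp : p = 3) (n : Fin 3 → ℕ) (hg : Good F p n) (z : Fin 4 → F) (hz : ∀ i, z i * z i = 1)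
    (hd : z 0 * z 1 * z 2 * z 3 = 1) (hz1 : z 0 ^ n 0 * (z 0 * z 1) ^ n 1 * (z 0 * z 1 * z 2) ^ n 2 = 1)
    (hzs : z 1 ≠ z 0 ∨ z 2 ≠ z 0) (N : Matrix (Fin 4) (Fin 4) F) (hN : N * N = 0) (hN0 : N 0 0 = 0) (hdet : (1 + N).det = 1)
    (hc : Matrix.diagonal z * N = N * Matrix.diagonal z) (h : Matrix (Fin 4) (Fin 4) F) (hh : h.det = 1) :
    ∑ j ∈ Finset.range p, ff n (h + (j : F) • (h * N)) = 0 := by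
  have hpw : ∀ j : ℕ, (1 + N) ^ j = 1 + (j : F) • N := by
    intro j
    induction j with
    | zero => simp
    | succ j ih =>
      rw [pow_succ, ih]
      simp only [mul_add, add_mul, mul_one, one_mul, Matrix.smul_mul, hN, smul_zero, add_zero, Nat.cast_add, Nat.cast_one, add_smul, one_smul]
      abel
  have h3 : (3 : F) = 0 := by
    have := CharP.cast_eq_zero F p
    rw [hp] at this
    exact_mod_cast this
  have key := three p hp n hg (mkS (Matrix.diagonal z) (by rw [Matrix.det_diagonal, Fin.prod_univ_four]; exact hd)) (mkS (1 + N) hdet) (mkS h hh)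
    (by simp only [mx_mkS, Matrix.diagonal_mul_diagonal, hz]; simp)
    (by intro i j hij; simp only [mx_mkS]; exact Matrix.diagonal_apply_ne _ (ne_of_gt hij))
    (by simpa [ff, dl, mul_assoc] using hz1)
    (by simp only [mx_mkS]; rw [mul_add, add_mul, hc, one_mul, mul_one])
    (by simp only [mx_mkS]; rw [hpw]; push_cast; rw [h3, zero_smul, add_zero])
    (by simpa using hzs)
    (by
      rintro ⟨r, hr⟩
      apply mx_inj
      simp only [mx_mkS, mx_one] at hr ⊢
      rw [hpw] at hr
      have h0 := congrFun (congrFun hr 0) 0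
      simp [hN0] at h0
      rw [← h0] at hr
      have h1 : ((2 : ℕ) : F) • N = 0 := by
        have := hr
        simp only [map_one] at this
        exact add_left_cancel (this.trans (add_zero _).symm)
      rcases smul_eq_zero.1 h1 with h | h
      · rw [CharP.cast_eq_zero_iff F p, hp] at h; omega
      · rw [h, add_zero])
  rw [← key]
  apply Finset.sum_congr rfl
  intro j _
  simp only [mx_mkS]
  rw [hpw, mul_add, mul_one, Matrix.mul_smul]


lemma three2 (p : ℕ) [Fact p.Prime] [CharP F p] (hp : p = 3) (n : Fin 3 → ℕ) (hg : Good F p n) (z : Fin 4 → F) (hz : ∀ i, z i * z i = 1)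
    (hd : z 0 * z 1 * z 2 * z 3 = 1) (hz1 : z 0 ^ n 0 * (z 0 * z 1) ^ n 1 * (z 0 * z 1 * z 2) ^ n 2 = 1)
    (hzs : z 1 ≠ z 0 ∨ z 2 ≠ z 0) (a b : Fin 4) (hab : a ≠ b) (hc : z a = z b) (c1 c2 c3 c4 c5 c6 : F) :
    ∑ j ∈ Finset.range p, ff n (!![1,c1,c2,c3;0,1,c4,c5;0,0,1,c6;0,0,0,1] + (j : F) • (!![1,c1,c2,c3;0,1,c4,c5;0,0,1,c6;0,0,0,1] * Matrix.single a b (1 : F))) = 0 := by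
  apply three' p hp n hg z hz hd hz1 hzs
  · exact Matrix.single_mul_single_of_ne 1 a b _ hab.symm 1
  · rw [Matrix.single_apply]
    rw [if_neg]
    rintro ⟨rfl, h⟩
    exact hab h.symm
  · exact Matrix.det_transvection_of_ne a b hab 1
  · ext i j
    rw [Matrix.diagonal_mul, Matrix.mul_diagonal, Matrix.single_apply]
    split_ifs with h
    · rw [← h.1, ← h.2, hc, mul_comm]
    · simp
  · simp [Matrix.det_succ_row_zero, Fin.sum_univ_succ, Fin.succAbove]

lemma ds_par (n : ℕ) : ds 3 n % 2 = n % 2 := by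
  have := ds_mod 3 n (by norm_num)
  exact this.symm

lemma bound3 (p : ℕ) [Fact p.Prime] [CharP F p] (hp : p = 3) (n : Fin 3 → ℕ) (hn : ∀ i, n i ≤ Fintype.card F - 1) (hg : Good F p n) :
    n 0 = 0 ∧ n 2 = 0 := by
  have hne : (1 : F) ≠ -1 := by
    intro h
    have : ((2 : ℕ) : F) = 0 := by push_cast; linear_combination h
    rw [CharP.cast_eq_zero_iff F p, hp] at this; omega
  have hpar : (n 0 + n 2) % 2 = 0 := by
    have := centre_pow p n hg (-1) (by norm_num)
    have h2 : Even (n 0 + 2 * n 1 + 3 * n 2) := by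
      by_contra h
      rw [Nat.not_even_iff_odd] at h
      rw [h.neg_one_pow] at this
      exact hne this.symm
    rw [Nat.even_iff] at h2; omega
  have d0 := ds_par (n 0)
  have d1 := ds_par (n 1)
  have d2 := ds_par (n 2)
  have zz : ∀ k, (ds 3 k < 2) → k % 2 = 0 → k = 0 := by
    intro k h1 h2
    apply ds_pos 3 k _ (by norm_num)
    have := ds_par k; omega
  have eE : ∀ a b : ℕ, a ≤ Fintype.card F - 1 → b ≤ Fintype.card F - 1 → (∀ x y : F, ∑ j ∈ Finset.range p, (1 + x * (j : F)) ^ a * (1 + y * (j : F)) ^ b = 0) → ds 3 a + ds 3 b < 2 := by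
    intro a b ha hb h
    have := lemE (F := F) p (by omega) ![a, b, 0] (by intro i; fin_cases i <;> simp [ha, hb]) (by
      intro x y z
      simpa using h x y)
    have h0 : ds 3 0 = 0 := by simp [ds]
    subst hp
    simpa [h0] using this
  by_cases h0 : n 0 % 2 = 0
  · have e0 : Even (n 0) := Nat.even_iff.2 h0
    have e2 : Even (n 2) := Nat.even_iff.2 (by omega)
    have zprop := three2 p hp n hg ![-1, -1, 1, 1] (by intro i; fin_cases i <;> simp) (by simp) (by simp [e0.neg_one_pow]) (Or.inr (by simpa using hne))
    constructor
    · apply zz _ _ h0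
      have := eE (n 0) 0 (hn 0) (by omega) (by
        intro x y
        rw [← zprop 1 0 (by decide) (by simp) x 0 0 0 0 0]
        apply Finset.sum_congr rfl
        intro j _
        simp only [ff, dl, Matrix.add_apply, Matrix.smul_apply, Matrix.mul_apply, Fin.sum_univ_four, Matrix.single_apply]
        simp
        ring)
      omega
    · apply zz _ _ (by omega)
      have := eE (n 2) 0 (hn 2) (by omega) (by
        intro x y
        rw [← zprop 3 2 (by decide) (by simp) 0 0 0 0 0 x]
        apply Finset.sum_congr rfl
        intro j _
        simp only [ff, dl, Matrix.add_apply, Matrix.smul_apply, Matrix.mul_apply, Fin.sum_univ_four, Matrix.single_apply]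
        simp
        ring)
      omega
  · exfalso
    have e0 : Odd (n 0) := Nat.odd_iff.2 (by omega)
    have e2 : Odd (n 2) := Nat.odd_iff.2 (by omega)
    by_cases h1 : n 1 % 2 = 0
    · have e1 : Even (n 1) := Nat.even_iff.2 h1
      have zprop := three2 p hp n hg ![-1, 1, 1, -1] (by intro i; fin_cases i <;> simp) (by simp)
        (by simp [e0.neg_one_pow, e1.neg_one_pow, e2.neg_one_pow]) (Or.inl (by simpa using hne))
      have z1 : n 1 = 0 := by
        apply zz _ _ h1
        have := eE (n 1) 0 (hn 1) (by omega) (by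
          intro x y
          rw [← zprop 2 1 (by decide) (by simp) 0 0 0 x 0 0]
          apply Finset.sum_congr rfl
          intro j _
          simp only [ff, dl, Matrix.add_apply, Matrix.smul_apply, Matrix.mul_apply, Fin.sum_univ_four, Matrix.single_apply]
          simp
          ring)
        omega
      have := eE (n 0) (n 2) (hn 0) (hn 2) (by
        intro x y
        rw [← zprop 3 0 (by decide) (by simp) 1 0 x 0 (x - y) 0]
        apply Finset.sum_congr rfl
        intro j _
        simp only [ff, dl, Matrix.add_apply, Matrix.smul_apply, Matrix.mul_apply, Fin.sum_univ_four, Matrix.single_apply]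
        simp [z1]
        ring)
      omega
    · have e1 : Odd (n 1) := Nat.odd_iff.2 (by omega)
      have zprop := three2 p hp n hg ![-1, 1, -1, 1] (by intro i; fin_cases i <;> simp) (by simp)
        (by simp [e0.neg_one_pow, e1.neg_one_pow, e2.neg_one_pow]) (Or.inl (by simpa using hne))
      have := eE (n 0) (n 1) (hn 0) (hn 1) (by
        intro x y
        rw [← zprop 2 0 (by decide) (by simp) 1 x 0 (x - y) 0 0]
        apply Finset.sum_congr rfl
        intro j _
        simp only [ff, dl, Matrix.add_apply, Matrix.smul_apply, Matrix.mul_apply, Fin.sum_univ_four, Matrix.single_apply]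
        simp
        ring)
      omega

lemma bound (p : ℕ) [Fact p.Prime] [CharP F p] (hp : 3 ≤ p) (n : Fin 3 → ℕ) (hn : ∀ i, n i ≤ Fintype.card F - 1) (hg : Good F p n) :
    n 0 + n 1 + n 2 < Fintype.card F := by
  have hq : 0 < Fintype.card F := Fintype.card_pos
  by_cases h3 : p = 3
  · obtain ⟨h1, h2⟩ := bound3 p h3 n hn hg
    have := hn 1; omega
  · have h4 : p ≠ 4 := by rintro rfl; exact absurd (Fact.out : Nat.Prime 4) (by norm_num)
    have h5 := bound5 p (by omega) n hn hg
    obtain ⟨k, -, hk⟩ := FiniteField.card F p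
    obtain ⟨a, ha⟩ : ∃ a, (k : ℕ) = a + 1 := ⟨k - 1, by have := k.pos; omega⟩
    rw [ha] at hk
    have e : ∀ i, n i ≤ p ^ a * ds p (n i) := fun i => ds_le p (by omega) a (n i) (by have := hn i; omega)
    have := e 0; have := e 1; have := e 2
    have h6 : p ^ a * (ds p (n 0) + ds p (n 1) + ds p (n 2)) < p ^ a * p := Nat.mul_lt_mul_of_pos_left (by omega) (by positivity)
    rw [hk, pow_succ]
    rw [mul_add, mul_add] at h6
    omega

end six

set_option linter.unusedSimpArgs false
set_option linter.unusedSectionVars false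
set_option linter.unusedVariables false
section six
variable {F : Type} [Field F] [Fintype F]

lemma ext_F (p : ℕ) (n : Fin 3 → ℕ) (hg : Good F p n) (s : S4 F) (hs : p * io s ∉ elementOrders (S4 F ⧸ Subgroup.center (S4 F)))
    (h g : Matrix (Fin 4) (Fin 4) F) : ∑ i ∈ Finset.range (io s), ff n (h * mx s ^ i * g) = 0 := by
  obtain ⟨k, -, hk⟩ := LQ h
  obtain ⟨k', -, hk'⟩ := LQ gᵀ
  have inv : ∀ x : S4 F, mx x * mx x⁻¹ = 1 := fun x => by rw [← mx_mul, mul_inv_cancel, mx_one]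
  have inv' : ∀ x : S4 F, mx x⁻¹ * mx x = 1 := fun x => by rw [← mx_mul, inv_mul_cancel, mx_one]
  have e1 : h = (h * mx k) * mx k⁻¹ := by rw [Matrix.mul_assoc, inv, Matrix.mul_one]
  have ht : mx (trS k') = (mx k')ᵀ := rfl
  have e2 : g = mx (trS k')⁻¹ * (mx (trS k') * g) := by rw [← Matrix.mul_assoc, inv', Matrix.one_mul]
  have hB : ∀ i j, j < i → (mx (trS k') * g) i j = 0 := by
    intro i j hij
    rw [ht, ← Matrix.transpose_transpose g, ← Matrix.transpose_mul, Matrix.transpose_apply]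
    exact hk' j i hij
  have := hg.2 s hs k⁻¹ (trS k')⁻¹
  have e3 : ∀ i, ff n (h * mx s ^ i * g) = ff n (h * mx k) * ff n (mx (k⁻¹ * s ^ i * (trS k')⁻¹)) * ff n (mx (trS k') * g) := by
    intro i
    rw [← ff_L n hk, ← ff_U n hB]
    congr 1
    conv_lhs => rw [e1, e2]
    simp only [mx_mul, mx_pow, Matrix.mul_assoc]
  simp only [e3]
  rw [← Finset.sum_mul, ← Finset.mul_sum, this, mul_zero, zero_mul]

lemma ff_map {R S : Type*} [CommRing R] [CommRing S] (f : R →+* S) (n : Fin 3 → ℕ) (M : Matrix (Fin 4) (Fin 4) R) : ff n (M.map f) = f (ff n M) := by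
  simp [ff, dl]

open MvPolynomial in
lemma gen_ext {K : Type} [Field K] [Algebra F K] (n : Fin 3 → ℕ) (hn : n 0 + n 1 + n 2 < Fintype.card F) (N : ℕ)
    (M : ℕ → Matrix (Fin 4) (Fin 4) K)
    (h0 : ∀ h : Matrix (Fin 4) (Fin 4) F, ∑ i ∈ Finset.range N, ff n (h.map (algebraMap F K) * M i) = 0)
    (h : Matrix (Fin 4) (Fin 4) K) : ∑ i ∈ Finset.range N, ff n (h * M i) = 0 := by
  classical
  let X4 : Matrix (Fin 4) (Fin 4) (MvPolynomial (Fin 4 × Fin 4) K) := fun a b => X (a, b)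
  let E : ℕ → Matrix (Fin 4) (Fin 4) (MvPolynomial (Fin 4 × Fin 4) K) := fun i => X4 * (M i).map C
  let P : MvPolynomial (Fin 4 × Fin 4) K := ∑ i ∈ Finset.range N, ff n (E i)
  have ev : ∀ h : Matrix (Fin 4) (Fin 4) K, eval (fun v => h v.1 v.2) P = ∑ i ∈ Finset.range N, ff n (h * M i) := by
    intro h
    rw [map_sum]
    apply Finset.sum_congr rfl
    intro i _
    rw [← ff_map]
    congr 1
    ext a b
    change eval _ (∑ k, X (a, k) * C (M i k b)) = ∑ k, h a k * M i k b
    simp only [map_sum, map_mul, eval_X, eval_C]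
  have dE : ∀ (v : Fin 4 × Fin 4) i a b, degreeOf v (E i a b) ≤ if a = v.1 then 1 else 0 := by
    intro v i a b
    simp only [E, Matrix.mul_apply]
    refine (degreeOf_sum_le _ _ _).trans (Finset.sup_le ?_)
    intro k _
    rw [Matrix.map_apply]
    refine (degreeOf_mul_C_le _ _ _).trans ?_
    simp only [X4, degreeOf_X]
    split_ifs with h1 h2
    · rfl
    · exact absurd (by rw [h1]) h2
    · omega
    · omega
  have dd : ∀ v i m, degreeOf v (dl m (E i)) ≤ 1 := by
    intro v i m
    have e := dE v i
    obtain ⟨α, β, γ, hs, e0, e1, e2⟩ : ∃ α β γ : ℕ, α + β + γ ≤ 1 ∧ (∀ b, degreeOf v (E i 0 b) ≤ α) ∧ (∀ b, degreeOf v (E i 1 b) ≤ β) ∧ (∀ b, degreeOf v (E i 2 b) ≤ γ) := by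
      refine ⟨_, _, _, ?_, e 0, e 1, e 2⟩
      generalize v.1 = w
      revert w
      decide
    have t3 : ∀ b, degreeOf v (E i 0 b) ≤ 1 := fun b => by have := e0 b; omega
    have t2 : ∀ b c, degreeOf v (E i 0 b * E i 1 c) ≤ 1 := fun b c => (degreeOf_mul_le _ _ _).trans (by have := e0 b; have := e1 c; omega)
    have t1 : ∀ b c d f, degreeOf v (E i 1 b * E i 2 c - E i 1 d * E i 2 f) ≤ β + γ := fun b c d f =>
      (degreeOf_sub_le _ _ _).trans (max_le ((degreeOf_mul_le _ _ _).trans (add_le_add (e1 b) (e2 c))) ((degreeOf_mul_le _ _ _).trans (add_le_add (e1 d) (e2 f))))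
    have t0 : ∀ a b c d f, degreeOf v (E i 0 a * (E i 1 b * E i 2 c - E i 1 d * E i 2 f)) ≤ 1 := fun a b c d f =>
      (degreeOf_mul_le _ _ _).trans (by have := e0 a; have := t1 b c d f; omega)
    match m with
    | 0 => exact t3 0
    | 1 => exact (degreeOf_sub_le _ _ _).trans (max_le (t2 _ _) (t2 _ _))
    | 2 => exact (degreeOf_add_le _ _ _).trans (max_le ((degreeOf_sub_le _ _ _).trans (max_le (t0 _ _ _ _ _) (t0 _ _ _ _ _))) (t0 _ _ _ _ _))
  have dP : ∀ v, degreeOf v P ≤ n 0 + n 1 + n 2 := by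
    intro v
    refine (degreeOf_sum_le _ _ _).trans (Finset.sup_le ?_)
    intro i _
    have t : ∀ m, degreeOf v (dl m (E i) ^ n m) ≤ n m := by
      intro m
      refine (degreeOf_pow_le _ _ _).trans ?_
      have := Nat.mul_le_mul_left (n m) (dd v i m)
      omega
    refine (degreeOf_mul_le _ _ _).trans (add_le_add ((degreeOf_mul_le _ _ _).trans (add_le_add (t 0) (t 1))) (t 2))
  have hP : P = 0 := by
    apply MvPolynomial.eq_zero_of_eval_zero_at_prod_finset P (fun _ => Finset.univ.image (algebraMap F K))
    · intro v
      rw [Finset.card_image_of_injective _ (algebraMap F K).injective, Finset.card_univ]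
      exact (dP v).trans_lt hn
    · intro x hx
      have hx' : ∀ v, ∃ y : F, algebraMap F K y = x v := by
        intro v
        have := hx v
        simpa using this
      choose y hy using hx'
      have := h0 (fun a b => y (a, b))
      rw [← ev] at this
      rw [← this]
      congr 2
      ext v
      exact (hy v).symm
  rw [← ev, hP, map_zero]

lemma ext_K (p : ℕ) (n : Fin 3 → ℕ) (hn : n 0 + n 1 + n 2 < Fintype.card F) (hg : Good F p n) (s : S4 F)
    (hs : p * io s ∉ elementOrders (S4 F ⧸ Subgroup.center (S4 F))) {K : Type} [Field K] [Algebra F K] {t : Fin 4 → K}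
    {V W : Matrix (Fin 4) (Fin 4) K} (h : V * W = 1) (h' : W * V = 1) (e : (mx s).map (algebraMap F K) = W * Matrix.diagonal t * V)
    (x y : Matrix (Fin 4) (Fin 4) K) : ∑ i ∈ Finset.range (io s), ff n (x * Matrix.diagonal (t ^ i) * y) = 0 := by
  have mp : ∀ i, ((mx s) ^ i).map (algebraMap F K) = W * Matrix.diagonal (t ^ i) * V := by
    intro i
    have := map_pow (algebraMap F K).mapMatrix (mx s) i
    rw [RingHom.mapMatrix_apply, RingHom.mapMatrix_apply, e, cj_pow h h', Matrix.diagonal_pow] at this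
    exact this
  have s1 : ∀ (b : Matrix (Fin 4) (Fin 4) F) (a : Matrix (Fin 4) (Fin 4) K), ∑ i ∈ Finset.range (io s), ff n (a * (((mx s) ^ i).map (algebraMap F K) * b.map (algebraMap F K))) = 0 := by
    intro b
    apply gen_ext n hn
    intro a
    have := congrArg (algebraMap F K) (ext_F p n hg s hs a b)
    rw [map_sum, map_zero] at this
    rw [← this]
    apply Finset.sum_congr rfl
    intro i _
    rw [← ff_map, Matrix.map_mul, Matrix.map_mul, Matrix.mul_assoc]
  have s2 : ∀ b a : Matrix (Fin 4) (Fin 4) K, ∑ i ∈ Finset.range (io s), ff n (a * ((b * ((mx s) ^ i).map (algebraMap F K))ᵀ)) = 0 := by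
    intro b
    apply gen_ext n hn
    intro a
    rw [← s1 aᵀ b]
    apply Finset.sum_congr rfl
    intro i _
    rw [← ff_T]
    congr 1
    simp only [Matrix.transpose_mul, Matrix.transpose_transpose, Matrix.transpose_map, Matrix.mul_assoc]
  rw [← s2 (x * V) (W * y)ᵀ]
  apply Finset.sum_congr rfl
  intro i _
  rw [← ff_T, mp]
  congr 1
  simp only [← Matrix.transpose_mul]
  congr 1
  calc x * Matrix.diagonal (t ^ i) * y = x * (V * W) * Matrix.diagonal (t ^ i) * (V * W) * y := by simp [h]
    _ = _ := by simp only [Matrix.mul_assoc]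

end six

set_option linter.unusedSimpArgs false
set_option linter.unusedSectionVars false
set_option linter.unusedVariables false
section six
variable {K : Type} [Field K]

lemma fin_one {N : ℕ} {f : ℕ → K} {ε m : K} (h : ∑ i ∈ Finset.range N, f i = 0) (hf : ∀ i, f i = ε * m ^ i) (hε : ε ≠ 0) (hm : m = 1) : (N : K) = 0 := by
  simp only [hf, hm, one_pow, mul_one] at h
  rw [Finset.sum_const, Finset.card_range, nsmul_eq_mul] at h
  exact (mul_eq_zero.1 h).resolve_right hε

lemma ex_T [Infinite K] (n : ℕ) : ∃ T : Finset K, n < T.card ∧ ∀ τ ∈ T, τ ≠ 0 := by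
  obtain ⟨T, hT⟩ := Infinite.exists_subset_card_eq K (n + 2)
  classical
  refine ⟨T.erase 0, ?_, fun τ h => Finset.ne_of_mem_erase h⟩
  have := Finset.pred_card_le_card_erase (s := T) (a := 0)
  omega

lemma ff_ent (n : Fin 3 → ℕ) {A : Matrix (Fin 4) (Fin 4) K} {d0 d1 d2 : K} (h0 : dl 0 A = d0) (h1 : dl 1 A = d1) (h2 : dl 2 A = d2) :
    ff n A = d0 ^ n 0 * d1 ^ n 1 * d2 ^ n 2 := by rw [ff, h0, h1, h2]

lemma entry (x y : Matrix (Fin 4) (Fin 4) K) (a : Fin 4 → K) (i j : Fin 4) :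
    (x * Matrix.diagonal a * y) i j = x i 0 * a 0 * y 0 j + x i 1 * a 1 * y 1 j + x i 2 * a 2 * y 2 j + x i 3 * a 3 * y 3 j := by
  rw [Matrix.mul_apply, Fin.sum_univ_four]; simp only [Matrix.mul_diagonal]

variable [Infinite K] (p : ℕ) [Fact p.Prime] [CharP K p] {n : Fin 3 → ℕ} {t : Fin 4 → K} {N : ℕ}

lemma pt2 (hX : ∀ x y : Matrix (Fin 4) (Fin 4) K, ∑ i ∈ Finset.range N, ff n (x * Matrix.diagonal (t ^ i) * y) = 0) (l : ℕ) (hl : ¬ p ∣ (n 0 + n 2).choose l) (hln : l ≤ n 0 + n 2)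
    (hm : t 2 ^ (n 0 + n 2 - l) * t 3 ^ l * (t 0 * t 1) ^ (n 1 + n 2) = 1) : (N : K) = 0 := by
  obtain ⟨T, hT, hT0⟩ := ex_T (K := K) (n 0 + n 2)
  have := extract p (Finset.range N) (fun i => (-(t 0 ^ i * t 1 ^ i)) ^ n 1 * (-(t 0 ^ i * t 1 ^ i)) ^ n 2) (fun i => t 2 ^ i) (fun i => t 3 ^ i) (n 0 + n 2) l T hT (by
    intro τ hτ
    have h0 := hT0 τ hτ
    have hh := hX !![1,0,1,1;0,1,0,0;0,0,1,-1;0,0,0,0] !![0,1,0,0;1,0,0,0;1,0,1,0;τ,0,-τ,0]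
    have e : ∀ i, ff n (!![1,0,1,1;0,1,0,0;0,0,1,-1;0,0,0,0] * Matrix.diagonal (t ^ i) * !![0,1,0,0;1,0,0,0;1,0,1,0;τ,0,-τ,0]) = τ ^ 0 * (((-(t 0 ^ i * t 1 ^ i)) ^ n 1 * (-(t 0 ^ i * t 1 ^ i)) ^ n 2) * (t 2 ^ i + τ * (t 3 ^ i)) ^ (n 0 + n 2)) := by
      intro i
      rw [ff_ent n (d0 := (t 2 ^ i + τ * t 3 ^ i)) (d1 := -(t 0 ^ i * t 1 ^ i)) (d2 := -(t 0 ^ i * t 1 ^ i) * (t 2 ^ i + τ * t 3 ^ i)) (by simp only [dl, entry]; simp; try ring) (by simp only [dl, entry]; simp; try ring) (by simp only [dl, entry]; simp; try ring)]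
      simp only [mul_pow, neg_pow (t 0 ^ i * t 1 ^ i), pow_add]
      ring
    simp only [e] at hh
    rw [← Finset.mul_sum] at hh
    exact (mul_eq_zero.1 hh).resolve_left (pow_ne_zero _ h0)) hl hln
  refine fin_one this (ε := (-1) ^ (n 1 + n 2)) ?_ (by simp) hm
  intro i
  simp only [mul_pow, neg_pow (t 0 ^ i * t 1 ^ i)]
  ring

lemma pt1 (hX : ∀ x y : Matrix (Fin 4) (Fin 4) K, ∑ i ∈ Finset.range N, ff n (x * Matrix.diagonal (t ^ i) * y) = 0) (l : ℕ) (hl : ¬ p ∣ (n 0 + n 2).choose l) (hln : l ≤ n 0 + n 2)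
    (hm : t 2 ^ (n 0 + n 2 - l) * t 3 ^ l * ((t 2 * t 3) ^ n 1 * (t 0 * t 1) ^ n 2) = 1) : (N : K) = 0 := by
  obtain ⟨T, hT, hT0⟩ := ex_T (K := K) (n 0 + n 2)
  have := extract p (Finset.range N) (fun i => (t 2 ^ i * t 3 ^ i) ^ n 1 * (-(t 0 ^ i * t 1 ^ i)) ^ n 2) (fun i => t 2 ^ i) (fun i => t 3 ^ i) (n 0 + n 2) l T hT (by
    intro τ hτ
    have h0 := hT0 τ hτ
    have hh := hX !![0,0,1,1;1,0,0,1;0,1,0,0;0,0,0,0] !![0,0,1,0;0,1,0,0;1,0,0,0;τ,τ,0,0]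
    have e : ∀ i, ff n (!![0,0,1,1;1,0,0,1;0,1,0,0;0,0,0,0] * Matrix.diagonal (t ^ i) * !![0,0,1,0;0,1,0,0;1,0,0,0;τ,τ,0,0]) = τ ^ n 1 * (((t 2 ^ i * t 3 ^ i) ^ n 1 * (-(t 0 ^ i * t 1 ^ i)) ^ n 2) * (t 2 ^ i + τ * (t 3 ^ i)) ^ (n 0 + n 2)) := by
      intro i
      rw [ff_ent n (d0 := (t 2 ^ i + τ * t 3 ^ i)) (d1 := τ * (t 2 ^ i * t 3 ^ i)) (d2 := -(t 0 ^ i * t 1 ^ i) * (t 2 ^ i + τ * t 3 ^ i)) (by simp only [dl, entry]; simp; try ring) (by simp only [dl, entry]; simp; try ring) (by simp only [dl, entry]; simp; try ring)]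
      simp only [mul_pow, neg_pow (t 0 ^ i * t 1 ^ i), pow_add]
      ring
    simp only [e] at hh
    rw [← Finset.mul_sum] at hh
    exact (mul_eq_zero.1 hh).resolve_left (pow_ne_zero _ h0)) hl hln
  refine fin_one this (ε := (-1) ^ n 2) ?_ (by simp) hm
  intro i
  simp only [mul_pow, neg_pow (t 0 ^ i * t 1 ^ i)]
  ring

lemma ptCa (hX : ∀ x y : Matrix (Fin 4) (Fin 4) K, ∑ i ∈ Finset.range N, ff n (x * Matrix.diagonal (t ^ i) * y) = 0) (l : ℕ) (hl : ¬ p ∣ (n 1).choose l) (hln : l ≤ n 1)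
    (hm : t 2 ^ n 0 * (t 0 * t 1) ^ (n 1 - l) * (t 2 * t 3) ^ l * (t 0 * t 1 * t 3) ^ n 2 = 1) : (N : K) = 0 := by
  obtain ⟨T, hT, hT0⟩ := ex_T (K := K) (n 1)
  have := extract p (Finset.range N) (fun i => (t 2 ^ i) ^ n 0 * ((-(t 0 ^ i * t 1 ^ i)) ^ n 2 * (t 3 ^ i) ^ n 2)) (fun i => -(t 0 ^ i * t 1 ^ i)) (fun i => t 2 ^ i * t 3 ^ i) (n 1) l T hT (by
    intro τ hτ
    have h0 := hT0 τ hτ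
    have hh := hX !![1,0,1,0;0,1,0,1;0,1,0,0;0,0,0,0] !![0,1,1,0;1,0,0,0;1,0,0,0;0,τ,0,0]
    have e : ∀ i, ff n (!![1,0,1,0;0,1,0,1;0,1,0,0;0,0,0,0] * Matrix.diagonal (t ^ i) * !![0,1,1,0;1,0,0,0;1,0,0,0;0,τ,0,0]) = τ ^ n 2 * (((t 2 ^ i) ^ n 0 * ((-(t 0 ^ i * t 1 ^ i)) ^ n 2 * (t 3 ^ i) ^ n 2)) * (-(t 0 ^ i * t 1 ^ i) + τ * (t 2 ^ i * t 3 ^ i)) ^ (n 1)) := by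
      intro i
      rw [ff_ent n (d0 := t 2 ^ i) (d1 := (-(t 0 ^ i * t 1 ^ i) + τ * (t 2 ^ i * t 3 ^ i))) (d2 := τ * (-(t 0 ^ i * t 1 ^ i) * t 3 ^ i)) (by simp only [dl, entry]; simp; try ring) (by simp only [dl, entry]; simp; try ring) (by simp only [dl, entry]; simp; try ring)]
      simp only [mul_pow, neg_pow (t 0 ^ i * t 1 ^ i), pow_add]
      ring
    simp only [e] at hh
    rw [← Finset.mul_sum] at hh
    exact (mul_eq_zero.1 hh).resolve_left (pow_ne_zero _ h0)) hl hln
  refine fin_one this (ε := (-1) ^ (n 1 - l) * (-1) ^ n 2) ?_ (by simp) hm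
  intro i
  simp only [mul_pow, neg_pow (t 0 ^ i * t 1 ^ i)]
  ring

lemma ptCb (hX : ∀ x y : Matrix (Fin 4) (Fin 4) K, ∑ i ∈ Finset.range N, ff n (x * Matrix.diagonal (t ^ i) * y) = 0) (l : ℕ) (hl : ¬ p ∣ (n 1).choose l) (hln : l ≤ n 1)
    (hm : t 2 ^ n 0 * (t 0 * t 1) ^ (n 1 - l) * (t 2 * t 3) ^ l * (t 0 * t 1 * t 2) ^ n 2 = 1) : (N : K) = 0 := by
  obtain ⟨T, hT, hT0⟩ := ex_T (K := K) (n 1)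
  have := extract p (Finset.range N) (fun i => (t 2 ^ i) ^ n 0 * ((-(t 0 ^ i * t 1 ^ i)) ^ n 2 * (t 2 ^ i) ^ n 2)) (fun i => -(t 0 ^ i * t 1 ^ i)) (fun i => t 2 ^ i * t 3 ^ i) (n 1) l T hT (by
    intro τ hτ
    have h0 := hT0 τ hτ
    have hh := hX !![1,0,1,0;0,1,0,1;1,0,0,0;0,0,0,0] !![0,1,0,0;1,0,1,0;1,0,0,0;0,τ,0,0]
    have e : ∀ i, ff n (!![1,0,1,0;0,1,0,1;1,0,0,0;0,0,0,0] * Matrix.diagonal (t ^ i) * !![0,1,0,0;1,0,1,0;1,0,0,0;0,τ,0,0]) = τ ^ 0 * (((t 2 ^ i) ^ n 0 * ((-(t 0 ^ i * t 1 ^ i)) ^ n 2 * (t 2 ^ i) ^ n 2)) * (-(t 0 ^ i * t 1 ^ i) + τ * (t 2 ^ i * t 3 ^ i)) ^ (n 1)) := by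
      intro i
      rw [ff_ent n (d0 := t 2 ^ i) (d1 := (-(t 0 ^ i * t 1 ^ i) + τ * (t 2 ^ i * t 3 ^ i))) (d2 := -(t 0 ^ i * t 1 ^ i) * t 2 ^ i) (by simp only [dl, entry]; simp; try ring) (by simp only [dl, entry]; simp; try ring) (by simp only [dl, entry]; simp; try ring)]
      simp only [mul_pow, neg_pow (t 0 ^ i * t 1 ^ i), pow_add]
      ring
    simp only [e] at hh
    rw [← Finset.mul_sum] at hh
    exact (mul_eq_zero.1 hh).resolve_left (pow_ne_zero _ h0)) hl hln
  refine fin_one this (ε := (-1) ^ (n 1 - l) * (-1) ^ n 2) ?_ (by simp) hm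
  intro i
  simp only [mul_pow, neg_pow (t 0 ^ i * t 1 ^ i)]
  ring

lemma ptB (hX : ∀ x y : Matrix (Fin 4) (Fin 4) K, ∑ i ∈ Finset.range N, ff n (x * Matrix.diagonal (t ^ i) * y) = 0) (h0 : n 1 = 0) (hm : t 3 ^ n 0 * (t 0 * t 1 * t 2) ^ n 2 = 1) : (N : K) = 0 := by
  refine fin_one (hX !![1,0,0,1;0,1,0,0;0,0,1,0;0,0,0,0] !![0,1,0,0;1,0,0,0;0,0,1,0;1,0,0,0]) (ε := (-1) ^ n 2) ?_ (by simp) hm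
  intro i
  rw [ff_ent n (d0 := t 3 ^ i) (d1 := -(t 0 ^ i * t 1 ^ i)) (d2 := -(t 0 ^ i * t 1 ^ i) * t 2 ^ i) (by simp only [dl, entry]; simp; try ring) (by simp only [dl, entry]; simp; try ring) (by simp only [dl, entry]; simp; try ring), h0]
  simp only [mul_pow, neg_pow (t 0 ^ i * t 1 ^ i)]
  ring

end six

set_option linter.unusedSimpArgs false
set_option linter.unusedSectionVars false
set_option linter.unusedVariables false
section six
variable {F : Type} [Field F] [Fintype F]

def Van (F : Type) [Field F] (n : Fin 3 → ℕ) (t : Fin 4 → AlgebraicClosure F) (N : ℕ) : Prop :=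
  (N : AlgebraicClosure F) ≠ 0 ∧ ∀ x y : Matrix (Fin 4) (Fin 4) (AlgebraicClosure F), ∑ i ∈ Finset.range N, ff n (x * Matrix.diagonal (t ^ i) * y) = 0

lemma van4 (p : ℕ) [Fact p.Prime] [CharP F p] (hp : 3 ≤ p) (hq : 3 ≤ Fintype.card F) (ho : Fintype.card F % 2 = 1) (n : Fin 3 → ℕ) (hn : n 0 + n 1 + n 2 < Fintype.card F)
    (hg : Good F p n) : ∃ t N, Van F n t N ∧ t 0 * t 1 = 1 ∧ t 2 * t 3 = 1 := by
  have hp' : p.Prime := Fact.out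
  have : CharP (AlgebraicClosure F) p := charP_of_injective_algebraMap (algebraMap F _).injective p
  obtain ⟨B, hB⟩ : ∃ B, 2 * B = Fintype.card F ^ 2 + 1 := by
    obtain ⟨k, hk⟩ : ∃ k, Fintype.card F = 2 * k + 1 := ⟨Fintype.card F / 2, by omega⟩
    exact ⟨2 * k ^ 2 + 2 * k + 1, by rw [hk]; ring⟩
  have hB' : ¬ p ∣ B := fun h => p_ndvd (F := F) p (k := Fintype.card F) (Or.inr (by rw [hB, sq])) (Dvd.dvd.mul_left h 2)
  obtain ⟨z, s, V, W, hz, h1, h2, h3, h4⟩ := T4ex (F := F) p hB hq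
  have hsz : Fintype.card F + 1 < B := by nlinarith
  have hz0 : z ≠ 0 := hz.ne_zero (by omega)
  have bad : p * io s ∉ elementOrders (S4 F ⧸ Subgroup.center (S4 F)) := by
    refine bad_of (F := F) p hp (m := Fintype.card F - 1) (d := 1) (N0 := B) (by omega) (by omega) (by rw [h4]) ?_ ?_ ?_ ?_
    · intro h; have := Nat.le_of_dvd (by omega) h; omega
    · intro h; have := Nat.le_of_dvd (by omega) h; omega
    · intro h
      have e : (Fintype.card F + 1) * (Fintype.card F - 1) + 2 = 2 * B := by
        obtain ⟨k, hk⟩ : ∃ k, Fintype.card F = k + 1 := ⟨Fintype.card F - 1, by omega⟩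
        rw [hB, hk, Nat.add_sub_cancel]; ring
      have h5 : B ∣ 2 := (Nat.dvd_add_right h).1 (by rw [e]; exact Dvd.intro_left 2 rfl)
      have := Nat.le_of_dvd (by omega) h5; omega
    · intro h
      rcases (Nat.dvd_prime hp').1 h with h | h
      · omega
      · exact hB' (by rw [h])
  refine ⟨_, io s, ⟨?_, ext_K p n hn hg s bad h1 h2 h3⟩, ?_, ?_⟩
  · rw [h4, Ne, CharP.cast_eq_zero_iff _ p]; exact hB'
  · simp [← mul_pow, hz0]
  · simp [hz0]

lemma van22 (p : ℕ) [Fact p.Prime] [CharP F p] (hp : 3 ≤ p) (n : Fin 3 → ℕ) (hn : n 0 + n 1 + n 2 < Fintype.card F)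
    (hg : Good F p n) (t : Fin 4 → AlgebraicClosure F) (c0 : t 0 ^ Fintype.card F = t 1) (c1 : t 1 ^ Fintype.card F = t 0) (c2 : t 2 ^ Fintype.card F = t 2)
    (c3 : t 3 ^ Fintype.card F = t 3) (h01 : t 0 ≠ t 1) (h23 : t 2 ≠ t 3) (tprod : t 0 * t 1 * t 2 * t 3 = 1)
    {m d N0 : ℕ} (hm : m * d = Fintype.card F - 1) (hd : d ∣ 4) (h0 : ∀ k, t 0 ^ k = t 2 ^ k → N0 ∣ k)
    (h1 : ¬ N0 ∣ Fintype.card F - 1) (h2 : ¬ N0 ∣ Fintype.card F + 1) (h3 : ¬ N0 ∣ (Fintype.card F + 1) * m) (h4 : ¬ N0 ∣ p) : ∃ N, Van F n t N := by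
  have : CharP (AlgebraicClosure F) p := charP_of_injective_algebraMap (algebraMap F _).injective p
  have hq : 0 < Fintype.card F := Fintype.card_pos
  have d12 : t 1 ≠ t 2 := by grind
  have d02 : t 0 ≠ t 2 := by grind
  have d03 : t 0 ≠ t 3 := by grind
  have d13 : t 1 ≠ t 3 := by grind
  obtain ⟨s, V, W, e1, e2, e3⟩ := companion (F := F) t (by
      intro i j hij
      fin_cases i <;> fin_cases j <;> first | rfl | exact absurd hij h01 | exact absurd hij h01.symm | exact absurd hij d12 | exact absurd hij d12.symm | exact absurd hij d02 | exact absurd hij d02.symm | exact absurd hij d03 | exact absurd hij d03.symm | exact absurd hij d13 | exact absurd hij d13.symm | exact absurd hij h23 | exact absurd hij h23.symm)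
    ⟨Equiv.swap 0 1, by
      intro i
      have : ∀ i, (Equiv.swap 0 1 : Equiv.Perm (Fin 4)) i = ![1, 0, 2, 3] i := by decide
      rw [this]
      fin_cases i
      · exact c0
      · exact c1
      · exact c2
      · exact c3⟩ tprod
  have bad := bad_of (F := F) p hp hm hd (h0 _ ((io_comp e1 e2 e3 _).1 (dvd_refl (io s)) 0 2)) h1 h2 h3 h4
  refine ⟨io s, ?_, ext_K p n hn hg s bad e1 e2 e3⟩
  rw [Ne, CharP.cast_eq_zero_iff _ p]
  intro hdv
  have hsq : ∀ i, t i ^ (Fintype.card F * Fintype.card F) = t i := by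
    intro i
    rw [pow_mul]
    fin_cases i
    · change (t 0 ^ _) ^ _ = t 0; rw [c0, c1]
    · change (t 1 ^ _) ^ _ = t 1; rw [c1, c0]
    · change (t 2 ^ _) ^ _ = t 2; rw [c2, c2]
    · change (t 3 ^ _) ^ _ = t 3; rw [c3, c3]
  have hne : ∀ i, t i ≠ 0 := by
    intro i h
    fin_cases i
    · change t 0 = 0 at h; simp [h] at tprod
    · change t 1 = 0 at h; simp [h] at tprod
    · change t 2 = 0 at h; simp [h] at tprod
    · change t 3 = 0 at h; simp [h] at tprod
  have hqq : 0 < Fintype.card F * Fintype.card F := by positivity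
  have h5 : ∀ i, t i ^ (Fintype.card F * Fintype.card F - 1) = 1 := by
    intro i
    apply mul_right_cancel₀ (hne i)
    rw [← pow_succ, Nat.sub_add_cancel hqq, hsq, one_mul]
  have h6 : io s ∣ Fintype.card F * Fintype.card F - 1 := (io_comp e1 e2 e3 _).2 (fun i j => by rw [h5, h5])
  exact p_ndvd (F := F) p (k := Fintype.card F) (Or.inl (Nat.sub_add_cancel hqq).symm) (hdv.trans h6)

lemma two_part (x : ℕ) (hx : 0 < x) : ∃ e r, x = 2 ^ e * r ∧ r % 2 = 1 := by
  obtain ⟨e, r, hr, h⟩ := Nat.exists_eq_two_pow_mul_odd (n := x) (by omega)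
  exact ⟨e, r, h, Nat.odd_iff.1 hr⟩

lemma van3 (p : ℕ) [Fact p.Prime] [CharP F p] (hp : 3 ≤ p) (h43 : Fintype.card F % 4 = 3) (n : Fin 3 → ℕ) (hn : n 0 + n 1 + n 2 < Fintype.card F)
    (hg : Good F p n) : ∃ t N, Van F n t N ∧ t 0 * t 1 = -1 ∧ t 2 = 1 ∧ t 3 = -1 := by
  have hp' : p.Prime := Fact.out
  have hpo : p % 2 = 1 := by rcases hp'.eq_two_or_odd with h | h <;> omega
  set q := Fintype.card F with hqq
  obtain ⟨e, r, her, hr⟩ := two_part (q + 1) (by omega)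
  have he : 2 ≤ e := by
    by_contra h
    have : e = 0 ∨ e = 1 := by omega
    rcases this with h | h <;> rw [h] at her <;> omega
  obtain ⟨k, hk⟩ : ∃ k, q - 1 = 2 * k ∧ k % 2 = 1 := ⟨(q - 1) / 2, by omega, by omega⟩
  have hpN : ¬ p ∣ 2 ^ (e + 1) := by
    intro h
    have := Nat.le_of_dvd (by omega) (hp'.dvd_of_dvd_pow h)
    omega
  obtain ⟨b, hb⟩ := exists_prim (F := F) p _ hpN
  have hb0 : b ≠ 0 := hb.ne_zero (by positivity)
  have hb1 : b ^ (q + 1) = -1 := by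
    have h1 : b ^ (2 ^ e) = -1 := by
      have h2 : (b ^ (2 ^ e)) ^ 2 = 1 := by rw [← pow_mul, ← pow_succ, hb.pow_eq_one]
      have h3 : b ^ (2 ^ e) ≠ 1 := by
        intro h
        have := Nat.le_of_dvd (by positivity) ((hb.pow_eq_one_iff_dvd _).1 h)
        rw [pow_succ] at this
        have : 0 < 2 ^ e := by positivity
        omega
      have h4 : (b ^ (2 ^ e) - 1) * (b ^ (2 ^ e) + 1) = 0 := by linear_combination h2
      rcases mul_eq_zero.1 h4 with h | h
      · exact absurd (sub_eq_zero.1 h) h3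
      · exact eq_neg_of_add_eq_zero_left h
    rw [her, pow_mul, h1, (Nat.odd_iff.2 hr).neg_one_pow]
  have hev : Odd q := Nat.odd_iff.2 (by omega)
  have h4N : 4 ∣ 2 ^ (e + 1) := pow_dvd_pow 2 (show 2 ≤ e + 1 by omega)
  have odd_ndvd : ∀ x, x % 2 = 1 → ¬ 2 ^ (e + 1) ∣ 2 ^ e * x := by
    intro x hx h
    rw [pow_succ] at h
    have := Nat.dvd_of_mul_dvd_mul_left (by positivity) h
    omega
  have hm1 : (-1 : AlgebraicClosure F) ≠ 1 := by
    intro h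
    rw [h] at hb1
    have h3 := (hb.pow_eq_one_iff_dvd _).1 hb1
    rw [her] at h3
    exact odd_ndvd _ hr h3
  have key := van22 (F := F) p hp n hn hg ![b, b ^ q, 1, -1] rfl (by
      change (b ^ q) ^ q = b
      have h1 : b ^ q = - b⁻¹ := by
        field_simp
        rw [← hb1]; ring
      rw [h1, hev.neg_pow, inv_pow, h1]; simp) (by simp) (by simp [← hqq, hev.neg_one_pow]) (by
      change b ≠ b ^ q
      intro h
      have : b ^ (q - 1) = 1 := by
        have : b ^ (q - 1) * b = 1 * b := by rw [← pow_succ, Nat.sub_add_cancel (by omega), ← h, one_mul]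
        exact mul_right_cancel₀ hb0 this
      have := h4N.trans ((hb.pow_eq_one_iff_dvd _).1 this)
      omega) (by simpa using hm1.symm) (by
      change b * b ^ q * 1 * (-1) = 1
      rw [← pow_succ', hb1]; ring) (m := k) (d := 2) (N0 := 2 ^ (e + 1)) (by omega) (by omega)
      (by
        intro k hk
        change b ^ k = 1 ^ k at hk
        rw [one_pow] at hk
        exact (hb.pow_eq_one_iff_dvd _).1 hk)
      (by intro h; have := h4N.trans h; omega)
      (by rw [← hqq, her]; exact odd_ndvd _ hr)
      (by rw [← hqq, her, mul_assoc]; exact odd_ndvd _ (by rw [Nat.mul_mod, hr, hk.2]))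
      (by intro h; have := h4N.trans h; omega)
  obtain ⟨N, hN⟩ := key
  refine ⟨_, N, hN, ?_, rfl, rfl⟩
  change b * b ^ q = -1
  rw [← pow_succ', hb1]

end six

set_option linter.unusedSimpArgs false
set_option linter.unusedSectionVars false
set_option linter.unusedVariables false
section six
variable {F : Type} [Field F] [Fintype F]

lemma van1 (p : ℕ) [Fact p.Prime] [CharP F p] (hp : 3 ≤ p) (h41 : Fintype.card F % 4 = 1) (h5 : 5 ≤ Fintype.card F) (n : Fin 3 → ℕ) (hn : n 0 + n 1 + n 2 < Fintype.card F)
    (hg : Good F p n) : ∃ (e : ℕ) (w : AlgebraicClosure F), IsPrimitiveRoot w (2 ^ e) ∧ ∀ i : ℤ, ∃ t N, Van F n t N ∧ t 0 * t 1 = w ^ (2 * i) ∧ t 2 = w ^ (1 - i) ∧ t 3 = w ^ (-1 - i) := by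
  have hp' : p.Prime := Fact.out
  have hpo : p % 2 = 1 := by rcases hp'.eq_two_or_odd with h | h <;> omega
  obtain ⟨q1, q2⟩ := q_cop (F := F) p
  set q := Fintype.card F with hqq
  obtain ⟨e, r, her, hr⟩ := two_part (q - 1) (by omega)
  have he : 2 ≤ e := by
    by_contra h
    have : e = 0 ∨ e = 1 := by omega
    rcases this with h | h <;> rw [h] at her <;> omega
  obtain ⟨B, hB, hBo⟩ : ∃ B, q + 1 = 2 * B ∧ B % 2 = 1 := ⟨(q + 1) / 2, by omega, by omega⟩
  obtain ⟨w, hw⟩ := exists_prim (F := F) p (2 ^ e) (fun h => q1 (by rw [her]; exact h.mul_right _))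
  obtain ⟨z, hz⟩ := exists_prim (F := F) p B (fun h => q2 (by rw [hB]; exact h.mul_left _))
  have h4N : 4 ∣ 2 ^ e := pow_dvd_pow 2 he
  have hw0 : w ≠ 0 := hw.ne_zero (by positivity)
  have hz0 : z ≠ 0 := hz.ne_zero (by omega)
  have wq : ∀ j : ℤ, (w ^ j) ^ q = w ^ j := by
    intro j
    have : w ^ q = w := by
      have : q = 2 ^ e * r + 1 := by omega
      rw [this, pow_succ, pow_mul, hw.pow_eq_one, one_pow, one_mul]
    rw [← zpow_natCast, ← _root_.zpow_mul, mul_comm, _root_.zpow_mul, zpow_natCast, this]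
  have zq : z ^ q = z⁻¹ := by
    apply eq_inv_of_mul_eq_one_left
    rw [← pow_succ, hB, mul_comm, pow_mul, hz.pow_eq_one, one_pow]
  refine ⟨e, w, hw, ?_⟩
  intro i
  have cop : Nat.Coprime (2 ^ e) B := Nat.Coprime.pow_left _ ((Nat.coprime_two_left).2 (Nat.odd_iff.2 hBo))
  have key := van22 (F := F) p hp n hn hg ![w ^ i * z, w ^ i * z⁻¹, w ^ (1 - i), w ^ (-1 - i)] (by
      change (w ^ i * z) ^ q = w ^ i * z⁻¹
      rw [mul_pow, wq, zq]) (by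
      change (w ^ i * z⁻¹) ^ q = w ^ i * z
      rw [mul_pow, wq, inv_pow, zq, inv_inv]) (wq _) (wq _) (by
      change w ^ i * z ≠ w ^ i * z⁻¹
      intro h
      have h := mul_left_cancel₀ (zpow_ne_zero _ hw0) h
      have h : z ^ 2 = 1 := by rw [sq]; nth_rw 1 [h]; exact inv_mul_cancel₀ hz0
      have := Nat.le_of_dvd (by omega) ((hz.pow_eq_one_iff_dvd _).1 h)
      omega) (by
      change w ^ (1 - i) ≠ w ^ (-1 - i)
      intro h
      have h : w ^ (2 : ℤ) = 1 := by
        rw [show (2 : ℤ) = (1 - i) - (-1 - i) by ring, zpow_sub₀ hw0, h, div_self (zpow_ne_zero _ hw0)]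
      have := Nat.le_of_dvd (by omega) (h4N.trans ((hw.pow_eq_one_iff_dvd 2).1 (by exact_mod_cast h)))
      omega) (by
      change w ^ i * z * (w ^ i * z⁻¹) * w ^ (1 - i) * w ^ (-1 - i) = 1
      calc _ = (z * z⁻¹) * (w ^ i * w ^ i * w ^ (1 - i) * w ^ (-1 - i)) := by ring
        _ = _ := by
          rw [mul_inv_cancel₀ hz0, ← zpow_add₀ hw0, ← zpow_add₀ hw0, ← zpow_add₀ hw0, show i + i + (1 - i) + (-1 - i) = 0 by ring, zpow_zero, one_mul])
      (m := (q - 1) / 4) (d := 4) (N0 := 2 ^ e * B) (by omega) (by omega)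
      (by
        intro k hk
        change (w ^ i * z) ^ k = (w ^ (1 - i)) ^ k at hk
        have hk1 : z ^ k = w ^ ((1 - 2 * i) * k) := by
          rw [mul_pow] at hk
          apply mul_left_cancel₀ (pow_ne_zero k (zpow_ne_zero i hw0))
          rw [hk, ← zpow_natCast, ← zpow_natCast, ← _root_.zpow_mul, ← _root_.zpow_mul, ← zpow_add₀ hw0]
          congr 1; ring
        apply cop.mul_dvd_of_dvd_of_dvd
        · have h1 : w ^ ((1 - 2 * i) * k * B) = 1 := by
            rw [_root_.zpow_mul, ← hk1, zpow_natCast, ← pow_mul, mul_comm, pow_mul, hz.pow_eq_one, one_pow]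
          have h2 := (hw.zpow_eq_one_iff_dvd _).1 h1
          have c1 : IsCoprime ((2 ^ e : ℕ) : ℤ) (1 - 2 * i) := by
            push_cast
            apply IsCoprime.pow_left
            exact ⟨i, 1, by ring⟩
          have c2 : IsCoprime ((2 ^ e : ℕ) : ℤ) (B : ℤ) := Nat.isCoprime_iff_coprime.2 cop
          have h3 := c2.dvd_of_dvd_mul_right h2
          exact Int.natCast_dvd_natCast.1 (c1.dvd_of_dvd_mul_left h3)
        · have h1 : z ^ (k * 2 ^ e) = 1 := by
            rw [pow_mul, hk1, ← zpow_natCast, ← _root_.zpow_mul, mul_comm, _root_.zpow_mul, zpow_natCast, hw.pow_eq_one, _root_.one_zpow]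
          exact cop.symm.dvd_of_dvd_mul_right ((hz.pow_eq_one_iff_dvd _).1 h1))
      (by
        intro h
        have h1 : B ∣ q - 1 := (Dvd.intro_left _ rfl).trans h
        have h2 : B ∣ 2 * B - (q - 1) := Nat.dvd_sub (Dvd.intro_left _ rfl) h1
        have := Nat.le_of_dvd (by omega) h2
        omega)
      (by
        intro h
        have := (h4N.trans (Dvd.intro _ rfl)).trans h
        omega)
      (by
        intro h
        rw [← hqq, hB, mul_right_comm] at h
        have h1 := Nat.dvd_of_mul_dvd_mul_right (by omega) h
        obtain ⟨f, rfl⟩ : ∃ f, e = f + 2 := ⟨e - 2, by omega⟩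
        have h2 : (q - 1) / 4 = 2 ^ f * r := by
          rw [her, show 2 ^ (f + 2) * r = 4 * (2 ^ f * r) by ring]; omega
        rw [h2, show 2 ^ (f + 2) = 2 * 2 ^ f * 2 by ring, ← mul_assoc] at h1
        have := Nat.dvd_of_mul_dvd_mul_left (by positivity) h1
        omega)
      (by
        intro h
        have := (h4N.trans (Dvd.intro _ rfl)).trans h
        omega)
  obtain ⟨N, hN⟩ := key
  refine ⟨_, N, hN, ?_, rfl, rfl⟩
  change w ^ i * z * (w ^ i * z⁻¹) = _
  rw [two_mul, zpow_add₀ hw0]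
  field_simp

lemma solve2 (e : ℕ) (E μ : ℤ) (hE : E % 4 = 0) (hμ : μ % 8 = 4) : ∃ i : ℤ, ((2 ^ e : ℕ) : ℤ) ∣ E + i * μ := by
  obtain ⟨E', rfl⟩ : ∃ E', E = 4 * E' := ⟨E / 4, by omega⟩
  obtain ⟨k, rfl⟩ : ∃ k, μ = 4 * (2 * k + 1) := ⟨μ / 8, by omega⟩
  have c1 : IsCoprime ((2 ^ e : ℕ) : ℤ) (2 * k + 1) := by
    push_cast
    apply IsCoprime.pow_left
    exact ⟨-k, 1, by ring⟩
  obtain ⟨a, b, hab⟩ := c1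
  exact ⟨-E' * b, 4 * E' * a, by linear_combination (-4 * E') * hab⟩

lemma finale (p : ℕ) [Fact p.Prime] [CharP F p] (hp : 3 ≤ p) (n : Fin 3 → ℕ) (hn : n 0 + n 1 + n 2 < Fintype.card F) (hg : Good F p n) : False := by
  have hp' : p.Prime := Fact.out
  have hpo : p % 2 = 1 := by rcases hp'.eq_two_or_odd with h | h <;> omega
  have : CharP (AlgebraicClosure F) p := charP_of_injective_algebraMap (algebraMap F _).injective p
  have ho : Fintype.card F % 2 = 1 := by
    obtain ⟨k, -, hk⟩ := FiniteField.card F p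
    rw [hk]; exact Nat.odd_iff.1 ((Nat.odd_iff.2 hpo).pow)
  have hq : 3 ≤ Fintype.card F := by
    have := Fintype.one_lt_card (α := F); omega
  have h1c : ∀ k : ℕ, ¬ p ∣ k.choose 0 := by intro k h; rw [Nat.choose_zero_right] at h; have := Nat.le_of_dvd one_pos h; omega
  have hne : (1 : F) ≠ -1 := by
    intro h
    have : ((2 : ℕ) : F) = 0 := by push_cast; linear_combination h
    rw [CharP.cast_eq_zero_iff F p] at this
    have := Nat.le_of_dvd (by omega) this; omega
  have hpar : (n 0 + n 2) % 2 = 0 := by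
    have := centre_pow p n hg (-1) (by norm_num)
    have h2 : Even (n 0 + 2 * n 1 + 3 * n 2) := by
      by_contra h
      rw [Nat.not_even_iff_odd] at h
      rw [h.neg_one_pow] at this
      exact hne this.symm
    rw [Nat.even_iff] at h2; omega
  obtain ⟨h, hh⟩ : ∃ h, n 0 + n 2 = 2 * h := ⟨(n 0 + n 2) / 2, by omega⟩
  rcases lemD p hp h with hA | ⟨l, hl1, hl2, hl3⟩
  · obtain ⟨t, N, ⟨hN, hX⟩, e1, e2⟩ := van4 (F := F) p hp hq ho n hn hg
    apply hN
    refine pt2 p hX h (by rw [hh]; exact hA) (by omega) ?_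
    rw [e1, one_pow, mul_one, show n 0 + n 2 - h = h by omega, ← mul_pow, e2, one_pow]
  rw [← hh] at hl2 hl3
  by_cases h43 : Fintype.card F % 4 = 3
  · obtain ⟨t, N, ⟨hN, hX⟩, e1, e2, e3⟩ := van3 (F := F) p hp h43 n hn hg
    apply hN
    by_cases hs : (n 1 + n 2) % 2 = 0
    · refine pt2 p hX 0 (h1c _) (by omega) ?_
      rw [e1, e2, (Nat.even_iff.2 hs).neg_one_pow]; simp
    · refine pt2 p hX l hl3 hl2 ?_
      rw [e1, e2, e3, (Nat.odd_iff.2 hl1).neg_one_pow, (Nat.odd_iff.2 (show (n 1 + n 2) % 2 = 1 by omega)).neg_one_pow]; simp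
  have h41 : Fintype.card F % 4 = 1 := by omega
  have hc4 : (n 0 + 2 * n 1 + 3 * n 2) % 4 = 0 := by
    obtain ⟨c, hc⟩ := (FiniteField.isSquare_neg_one_iff (F := F)).2 (by omega)
    have h2 := centre_pow p n hg c (by linear_combination -(c * c - 1) * hc)
    have hc2 : c ^ 2 = -1 := by rw [hc, sq]
    by_contra h4
    obtain ⟨k, hk⟩ : ∃ k, n 0 + 2 * n 1 + 3 * n 2 = 2 * (2 * k + 1) := ⟨(n 0 + 2 * n 1 + 3 * n 2) / 4, by omega⟩
    rw [hk, pow_mul, hc2, (Nat.odd_iff.2 (show (2 * k + 1) % 2 = 1 by omega)).neg_one_pow] at h2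
    exact hne h2.symm
  obtain ⟨e, w, hw, hT⟩ := van1 (F := F) p hp h41 (by omega) n hn hg
  have hw0 : w ≠ 0 := hw.ne_zero (by positivity)
  by_cases hn1 : n 1 = 0
  · obtain ⟨t, N, ⟨hN, hX⟩, e1, e2, e3⟩ := hT (-1)
    apply hN
    refine ptB hX hn1 ?_
    rw [e1, e2, e3, ← zpow_add₀ hw0]
    norm_num
  have pw : ∀ (a : ℤ) (k : ℕ), (w ^ a) ^ k = w ^ (a * k) := fun a k => by rw [_root_.zpow_mul, zpow_natCast]
  have fin : ∀ (a E μ i : ℤ), ((2 ^ e : ℕ) : ℤ) ∣ E + i * μ → a = E + i * μ → w ^ a = 1 := by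
    intro a E μ i h1 h2
    rw [h2]; exact (hw.zpow_eq_one_iff_dvd _).2 h1
  by_cases hC : n 0 % 2 = 1 ∨ (n 0 + n 2) % 4 = 0
  · obtain ⟨l2, hl2a, hl2b, hμ⟩ : ∃ l2, l2 ≤ n 1 ∧ ¬ p ∣ (n 1).choose l2 ∧ ((n 2 : ℤ) - n 0 + 2 * n 1 - 4 * l2) % 8 = 4 := by
      obtain ⟨l', g1, g2, g3⟩ := lemO p hp (n 1) (by omega)
      by_cases h8 : ((n 2 : ℤ) - n 0 + 2 * n 1) % 8 = 4
      · exact ⟨0, by omega, h1c _, by omega⟩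
      · exact ⟨l', g2, g3, by omega⟩
    by_cases hE : ((n 0 : ℤ) - n 2) % 4 = 0
    · obtain ⟨i, hi⟩ := solve2 e _ _ hE hμ
      obtain ⟨t, N, ⟨hN, hX⟩, e1, e2, e3⟩ := hT i
      apply hN
      refine ptCa p hX l2 hl2b hl2a ?_
      rw [e1, e2, e3]
      simp only [← zpow_add₀ hw0, pw]
      refine fin _ _ _ i hi ?_
      rw [Nat.cast_sub hl2a]; ring
    · obtain ⟨i, hi⟩ := solve2 e ((n 0 : ℤ) + n 2) _ (by omega) hμ
      obtain ⟨t, N, ⟨hN, hX⟩, e1, e2, e3⟩ := hT i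
      apply hN
      refine ptCb p hX l2 hl2b hl2a ?_
      rw [e1, e2, e3]
      simp only [← zpow_add₀ hw0, pw]
      refine fin _ _ _ i hi ?_
      rw [Nat.cast_sub hl2a]; ring
  · push Not at hC
    have hE : ((n 0 : ℤ) + n 2 - 2 * l) % 4 = 0 := by omega
    by_cases h8 : ((n 2 : ℤ) - n 0 + 2 * n 1) % 8 = 4
    · obtain ⟨i, hi⟩ := solve2 e _ _ hE h8
      obtain ⟨t, N, ⟨hN, hX⟩, e1, e2, e3⟩ := hT i
      apply hN
      refine pt2 p hX l hl3 hl2 ?_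
      rw [e1, e2, e3]
      simp only [← zpow_add₀ hw0, pw]
      refine fin _ _ _ i hi ?_
      rw [Nat.cast_sub hl2]; push_cast; ring
    · obtain ⟨i, hi⟩ := solve2 e _ ((n 2 : ℤ) - n 0 - 2 * n 1) hE (by omega)
      obtain ⟨t, N, ⟨hN, hX⟩, e1, e2, e3⟩ := hT i
      apply hN
      refine pt1 p hX l hl3 hl2 ?_
      rw [e1, e2, e3]
      simp only [← zpow_add₀ hw0, pw]
      refine fin _ _ _ i hi ?_
      rw [Nat.cast_sub hl2]; push_cast; ring

end six

/-- `PSL₄(q)` for `q` odd is recognizable by spectrum among covers: if a finite group `H`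
has a normal subgroup `K` with `H ⧸ K ≅ PSL₄(q)` and `ω(H) = ω(PSL₄(q))`,
then `H ≅ PSL₄(q)`. -/
theorem psl4_recognizable_among_covers
    (F : Type) [Field F] [Fintype F] (hq : Odd (Fintype.card F))
    (H : Type) [Group H] [Finite H] (K : Subgroup H) [K.Normal]
    (e : (H ⧸ K) ≃* (SpecialLinearGroup (Fin 4) F ⧸
        Subgroup.center (SpecialLinearGroup (Fin 4) F)))
    (hω : elementOrders H = elementOrders (SpecialLinearGroup (Fin 4) F ⧸
        Subgroup.center (SpecialLinearGroup (Fin 4) F))) :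
    Nonempty (H ≃* (SpecialLinearGroup (Fin 4) F ⧸
        Subgroup.center (SpecialLinearGroup (Fin 4) F))) := by
  obtain ⟨p, hpc⟩ := CharP.exists F
  obtain ⟨a, hp', ha⟩ := FiniteField.card F p
  have : Fact p.Prime := ⟨hp'⟩
  have hp : 3 ≤ p := by
    have h2 := hp'.two_le
    rcases Nat.lt_or_ge 2 p with h | h
    · omega
    · exfalso
      have h3 : p = 2 := by omega
      rw [ha, h3, Nat.odd_iff] at hq
      have h4 : 2 ∣ 2 ^ (a : ℕ) := dvd_pow_self 2 a.ne_zero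
      omega
  have hker := red_main (S4 F ⧸ Subgroup.center (S4 F)) (by
    intro r hr V _ _ _ ρ hV hsum
    by_cases hrp : r = p
    · subst hrp
      obtain ⟨n, hn, hg⟩ := exists_good (F := F) r V ρ hV hsum
      exact finale r hp n (bound r hp n hn hg) hg
    · exact P4 (F := F) p hp r hr.out hrp V ρ hV hsum) _ H rfl (e.toMonoidHom.comp (QuotientGroup.mk' K))
    (e.surjective.comp (QuotientGroup.mk'_surjective K)) hω.le
  exact ⟨MulEquiv.ofBijective (e.toMonoidHom.comp (QuotientGroup.mk' K))
    ⟨(MonoidHom.ker_eq_bot_iff _).1 hker, e.surjective.comp (QuotientGroup.mk'_surjective K)⟩⟩
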